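/- Let p > 3 be a prime. Then for every integer i ≥ 2: H^{2i}(SL₂(ℤ[1/p]), ℤ) ≅ (ℤ/2)^{(p-7)/6} ⊕ ℤ/12 if p ≡ 1 (mod 12), (ℤ/2)^{(p+1)/6} ⊕ ℤ/12 ⊕ ℤ/3 if p ≡ 5 (mod 12), (ℤ/2)^{(p-7)/6} ⊕ ℤ/12 ⊕ ℤ/4 if p ≡ 7 (mod 12), and (ℤ/2)^{(p+1)/6} ⊕ ℤ/12 ⊕ ℤ/12 if p ≡ 11 (mod 12). -/

import Mathlib

open CategoryTheory

namespace EC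
variable {k G : Type} [CommRing k] [Group G]

/-- The map induced on cohomology by a morphism of coefficients. -/
noncomputable def Hm {A B : Rep.{0} k G} (f : A ⟶ B) (n : ℕ) :
    groupCohomology A n →+ groupCohomology B n :=
  (groupCohomology.map (MonoidHom.id G) f n).hom.toAddMonoidHom

lemma Hm_id (A : Rep.{0} k G) (n : ℕ) (x) : Hm (𝟙 A) n x = x := by
  have := (groupCohomology.functor k G n).map_id A
  exact congrArg (fun z => z.hom x) this

lemma Hm_comp {A B C : Rep.{0} k G} (f : A ⟶ B) (g : B ⟶ C) (n : ℕ) (x) :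
    Hm (f ≫ g) n x = Hm g n (Hm f n x) := by
  have := (groupCohomology.functor k G n).map_comp f g
  exact congrArg (fun z => z.hom x) this

lemma rep_ext {A B : Rep.{0} k G} {f g : A ⟶ B} (h : ∀ x, f.hom x = g.hom x) : f = g :=
  Rep.hom_ext (Representation.IntertwiningMap.ext (LinearMap.ext h))

/-- Short exact sequence of representations, elementwise. -/
structure SES {A B C : Rep.{0} k G} (f : A ⟶ B) (g : B ⟶ C) : Prop where
  inj : ∀ a, f.hom a = 0 → a = 0
  surj : ∀ c, ∃ b, g.hom b = c
  comp : ∀ a, g.hom (f.hom a) = 0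
  exact : ∀ b, g.hom b = 0 → ∃ a, f.hom a = b

lemma SES.zero {A B C : Rep.{0} k G} {f : A ⟶ B} {g : B ⟶ C} (h : SES f g) : f ≫ g = 0 := by
  exact rep_ext h.comp

lemma SES.shortExact {A B C : Rep.{0} k G} {f : A ⟶ B} {g : B ⟶ C} (h : SES f g) :
    (ShortComplex.mk f g h.zero).ShortExact where
  exact := by
    have : ((ShortComplex.mk f g h.zero).map (forget₂ (Rep.{0} k G) (ModuleCat.{0} k))).Exact := by
      rw [ShortComplex.moduleCat_exact_iff]
      intro b hb
      exact h.exact b hb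
    exact (ShortComplex.exact_map_iff_of_faithful _ _).1 this
  mono_f := (Rep.mono_iff_injective f).2 ((injective_iff_map_eq_zero f.hom).2 h.inj)
  epi_g := (Rep.epi_iff_surjective g).2 h.surj

/-- Connecting map. -/
noncomputable def del {A B C : Rep.{0} k G} {f : A ⟶ B} {g : B ⟶ C} (h : SES f g) (n : ℕ) :
    groupCohomology C n →+ groupCohomology A (n+1) :=
  (groupCohomology.δ h.shortExact n (n+1) rfl).hom.toAddMonoidHom

lemma ex2 {A B C : Rep.{0} k G} {f : A ⟶ B} {g : B ⟶ C} (h : SES f g) (n : ℕ) (x) :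
    Hm g n x = 0 ↔ ∃ y, Hm f n y = x := by
  have := (ShortComplex.moduleCat_exact_iff _).1 (groupCohomology.mapShortComplex₂_exact h.shortExact n)
  constructor
  · intro hx; exact this x hx
  · rintro ⟨y, rfl⟩
    rw [← Hm_comp, h.zero]
    exact congrArg (fun z => z.hom y) ((groupCohomology.functor k G n).map_zero A C)

lemma ex3 {A B C : Rep.{0} k G} {f : A ⟶ B} {g : B ⟶ C} (h : SES f g) (n : ℕ) (x) :
    del h n x = 0 ↔ ∃ y, Hm g n y = x := by
  have := (ShortComplex.moduleCat_exact_iff _).1 (groupCohomology.mapShortComplex₃_exact h.shortExact (rfl : n+1 = n+1))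
  constructor
  · intro hx; exact this x hx
  · rintro ⟨y, rfl⟩
    exact congrArg (fun z => z.hom y) ((groupCohomology.mapShortComplex₃ h.shortExact (rfl : n+1 = n+1)).zero)

lemma ex1 {A B C : Rep.{0} k G} {f : A ⟶ B} {g : B ⟶ C} (h : SES f g) (n : ℕ) (x) :
    Hm f (n+1) x = 0 ↔ ∃ y, del h n y = x := by
  have := (ShortComplex.moduleCat_exact_iff _).1 (groupCohomology.mapShortComplex₁_exact h.shortExact (rfl : n+1 = n+1))
  constructor
  · intro hx; exact this x hx
  · rintro ⟨y, rfl⟩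
    exact congrArg (fun z => z.hom y) ((groupCohomology.mapShortComplex₁ h.shortExact (rfl : n+1 = n+1)).zero)

lemma del_nat {A B C A' B' C' : Rep.{0} k G} {f : A ⟶ B} {g : B ⟶ C} (h : SES f g)
    {f' : A' ⟶ B'} {g' : B' ⟶ C'} (h' : SES f' g') (a : A ⟶ A') (b : B ⟶ B') (c : C ⟶ C')
    (h1 : ∀ x, b.hom (f.hom x) = f'.hom (a.hom x))
    (h2 : ∀ x, c.hom (g.hom x) = g'.hom (b.hom x)) (n : ℕ) (x) :
    Hm a (n+1) (del h n x) = del h' n (Hm c n x) := by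
  have h1' : f ≫ b = a ≫ f' := rep_ext h1
  have h2' : g ≫ c = b ≫ g' := rep_ext h2
  have := groupCohomology.δ_naturality h.shortExact h'.shortExact
    ⟨a, b, c, h1'.symm, h2'.symm⟩ n (n+1) rfl
  exact congrArg (fun z => z.hom x) this

/-- Invariants. -/
def Inv (A : Rep.{0} k G) : AddSubgroup A where
  carrier := {a | ∀ g, A.ρ g a = a}
  add_mem' ha hb g := by rw [map_add, ha g, hb g]
  zero_mem' g := map_zero _
  neg_mem' ha g := by rw [map_neg, ha g]

/-- `H^0` from invariants. -/
noncomputable def H0 (A : Rep.{0} k G) : Inv A →+ groupCohomology A 0 :=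
  (groupCohomology.H0Iso A).inv.hom.toAddMonoidHom

lemma H0_bij (A : Rep.{0} k G) : Function.Bijective (H0 A) :=
  (groupCohomology.H0Iso A).symm.toLinearEquiv.bijective

/-- Map on invariants -/
def invMap {A B : Rep.{0} k G} (f : A ⟶ B) : Inv A →+ Inv B where
  toFun a := ⟨f.hom a.1, fun g => by rw [← Rep.hom_comm_apply, a.2 g]⟩
  map_zero' := by ext; simp
  map_add' x y := by ext; simp

lemma H0_nat {A B : Rep.{0} k G} (f : A ⟶ B) (a : Inv A) :
    Hm f 0 (H0 A a) = H0 B (invMap f a) := by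
  apply (groupCohomology.H0Iso B).toLinearEquiv.injective
  have h := congrArg (fun z => z.hom (H0 A a)) (groupCohomology.map_id_comp_H0Iso_hom f)
  have h2 : (groupCohomology.H0Iso A).hom.hom (H0 A a) = a :=
    (groupCohomology.H0Iso A).toLinearEquiv.right_inv a
  have h3 : (groupCohomology.H0Iso B).hom.hom (H0 B (invMap f a)) = invMap f a :=
    (groupCohomology.H0Iso B).toLinearEquiv.right_inv (invMap f a)
  refine h.trans ?_
  refine Eq.trans ?_ h3.symm
  exact congrArg (fun z => ((Rep.invariantsFunctor k G).map f).hom z) h2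

end EC

open CategoryTheory

namespace EC
variable {k G : Type} [CommRing k] [Group G]

/-- build a morphism of representations -/
def mkHom {A B : Rep.{0} k G} (f : A.V →ₗ[k] B.V) (h : ∀ g a, f (A.ρ g a) = B.ρ g (f a)) : A ⟶ B :=
  Rep.ofHom ⟨f, fun g => LinearMap.ext fun a => h g a⟩

@[simp] lemma mkHom_apply {A B : Rep.{0} k G} (f : A.V →ₗ[k] B.V) (h) (a : A.V) :
    (mkHom (A := A) (B := B) f h).hom a = f a := rfl

/-- Vanishing in positive degrees. -/
def Acyc (A : Rep.{0} k G) : Prop := ∀ n, ∀ x : groupCohomology A (n+1), x = 0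

lemma acyc_coind (V : Type) [AddCommGroup V] [Module k V] :
    Acyc (Rep.coind (⊥ : Subgroup G).subtype (Rep.trivial k (⊥ : Subgroup G) V)) := by
  intro n x
  have h1 := isZero_groupCohomology_succ_of_subsingleton (Rep.trivial k (⊥ : Subgroup G) V) n
  have h2 := h1.of_iso (groupCohomology.coindIso (Rep.trivial k (⊥ : Subgroup G) V) (n+1))
  have := ModuleCat.isZero_iff_subsingleton.1 h2
  exact Subsingleton.elim _ _

lemma acyc_of_retract {M : Rep.{0} k G} (r : (G → M.V) →ₗ[k] M.V)
    (h1 : ∀ φ g, r (fun h => φ (h * g)) = M.ρ g (r φ)) (h2 : ∀ m, r (fun h => M.ρ h m) = m) :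
    Acyc M := by
  intro n x
  let C := Rep.coind (⊥ : Subgroup G).subtype (Rep.trivial k (⊥ : Subgroup G) M.V)
  let i : M ⟶ C := mkHom (B := C)
    { toFun := fun m => ⟨fun h => M.ρ h m, by
        rintro ⟨g, hg⟩ h
        obtain rfl := Subgroup.mem_bot.1 hg
        simp⟩
      map_add' := fun a b => Subtype.ext (funext fun h => map_add (M.ρ h) a b)
      map_smul' := fun a b => Subtype.ext (funext fun h => map_smul (M.ρ h) a b) }
    (by
      intro g a; apply Subtype.ext; funext h
      show M.ρ h (M.ρ g a) = M.ρ (h * g) a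
      simp)
  let q : C ⟶ M := mkHom (A := C)
    { toFun := fun φ => r φ.1
      map_add' := fun a b => r.map_add a.1 b.1
      map_smul' := fun a b => r.map_smul a b.1 }
    (by intro g a; exact h1 a.1 g)
  have hiq : i ≫ q = 𝟙 M := rep_ext fun m => h2 m
  rw [← Hm_id M (n+1) x, ← hiq, Hm_comp, acyc_coind M.V n (Hm i (n+1) x), map_zero]

/-- Functions on a `G`-set with values in a representation. -/
abbrev Fn (Y : Type) [MulAction G Y] (A : Rep.{0} k G) : Rep.{0} k G :=
  Rep.of (X := Y → A.V)
    { toFun := fun g =>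
        { toFun := fun f y => A.ρ g (f (g⁻¹ • y))
          map_add' := fun a b => by ext; simp
          map_smul' := fun a b => by ext; simp }
      map_one' := by ext; simp
      map_mul' := fun a b => by
        apply LinearMap.ext; intro f; funext y
        simp [mul_smul] }

@[simp] lemma Fn_ρ (Y : Type) [MulAction G Y] (A : Rep.{0} k G) (g : G) (f : Y → A.V) (y : Y) :
    ((Fn Y A).ρ g : (Y → A.V) → (Y → A.V)) f y = A.ρ g (f (g⁻¹ • y)) := rfl

/-- functoriality in coefficients -/
def Fn.map (Y : Type) [MulAction G Y] {A B : Rep.{0} k G} (f : A ⟶ B) : Fn Y A ⟶ Fn Y B :=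
  mkHom (A := Fn Y A) (B := Fn Y B) (f.hom.toLinearMap.compLeft Y) (by
    intro g a; funext y
    exact Rep.hom_comm_apply f g _)

@[simp] lemma Fn.map_apply (Y : Type) [MulAction G Y] {A B : Rep.{0} k G} (f : A ⟶ B) (a : Y → A.V)
    (y : Y) : ((Fn.map Y f).hom a : Y → B.V) y = f.hom (a y) := rfl

lemma Fn.ses (Y : Type) [MulAction G Y] {A B C : Rep.{0} k G} {f : A ⟶ B} {g : B ⟶ C}
    (h : SES f g) : SES (Fn.map Y f) (Fn.map Y g) where
  inj a ha := by
    funext y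
    exact h.inj _ (congrFun ha y)
  surj c := by
    choose b hb using h.surj
    exact ⟨fun y => b (c y), funext fun y => hb (c y)⟩
  comp a := funext fun y => h.comp _
  exact b hb := by
    choose a ha using fun y => h.exact (b y) (congrFun hb y)
    exact ⟨a, funext ha⟩

section per
variable (χ : G →* Multiplicative (ZMod 12))

/-- `Fun(Z/12, A)`. -/
abbrev Per (A : Rep.{0} k G) : Rep.{0} k G :=
  Rep.of (X := ZMod 12 → A.V)
    { toFun := fun g =>
        { toFun := fun f q => A.ρ g (f (q - (χ g).toAdd))
          map_add' := fun a b => by ext; simp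
          map_smul' := fun a b => by ext; simp }
      map_one' := by ext; simp
      map_mul' := fun a b => by
        apply LinearMap.ext; intro f; funext y
        simp [sub_sub] }

@[simp] lemma Per_ρ (A : Rep.{0} k G) (g : G) (f : ZMod 12 → A.V) (q : ZMod 12) :
    ((Per χ A).ρ g : (ZMod 12 → A.V) → (ZMod 12 → A.V)) f q = A.ρ g (f (q - (χ g).toAdd)) := rfl

def Per.map {A B : Rep.{0} k G} (f : A ⟶ B) : Per χ A ⟶ Per χ B :=
  mkHom (A := Per χ A) (B := Per χ B) (f.hom.toLinearMap.compLeft (ZMod 12)) (by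
    intro g a; funext y
    exact Rep.hom_comm_apply f g _)

@[simp] lemma Per.map_apply {A B : Rep.{0} k G} (f : A ⟶ B) (a : ZMod 12 → A.V)
    (y : ZMod 12) : ((Per.map χ f).hom a : ZMod 12 → B.V) y = f.hom (a y) := rfl

def pconst (A : Rep.{0} k G) : A ⟶ Per χ A :=
  mkHom (B := Per χ A) (LinearMap.pi fun _ => LinearMap.id) (by intro g a; rfl)

def psumL (A : Rep.{0} k G) : (ZMod 12 → A.V) →ₗ[k] A.V :=
    { toFun := fun f => ∑ q, f q
      map_add' := fun a b => by simp [Finset.sum_add_distrib]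
      map_smul' := fun a b => by simp [Finset.smul_sum] }

lemma psumL_ρ (A : Rep.{0} k G) (g : G) (f : ZMod 12 → A.V) :
    psumL A ((Per χ A).ρ g f) = A.ρ g (psumL A f) := by
  simp only [psumL, LinearMap.coe_mk, AddHom.coe_mk, map_sum]
  exact Fintype.sum_equiv (Equiv.subRight (χ g).toAdd) _ _ fun q => rfl

def psum (A : Rep.{0} k G) : Per χ A ⟶ A :=
  mkHom (A := Per χ A) (psumL A) (psumL_ρ χ A)

abbrev PK (A : Rep.{0} k G) : Rep.{0} k G :=
  Rep.subrepresentation (Per χ A) (LinearMap.ker (psumL A)) (by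
    intro g f hf
    have : psumL A f = 0 := hf
    exact (psumL_ρ χ A g f).trans (by rw [this, map_zero]))

def pincl (A : Rep.{0} k G) : PK χ A ⟶ Per χ A :=
  mkHom (A := PK χ A) (B := Per χ A) (Submodule.subtype _) (by intro g a; rfl)

def pdiff (A : Rep.{0} k G) : Per χ A ⟶ PK χ A :=
  mkHom (A := Per χ A) (B := PK χ A)
    { toFun := fun (f : ZMod 12 → A.V) => ⟨fun q => f (q+1) - f q, by
        show ∑ q, (f (q+1) - f q) = 0
        rw [Finset.sum_sub_distrib, sub_eq_zero]
        exact Fintype.sum_equiv (Equiv.addRight 1) _ _ fun q => rfl⟩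
      map_add' := fun a b => by
        apply Subtype.ext; funext q
        show (a (q+1) + b (q+1)) - (a q + b q) = (a (q+1) - a q) + (b (q+1) - b q)
        abel
      map_smul' := fun a (b : ZMod 12 → A.V) => by
        apply Subtype.ext; funext q
        exact (smul_sub a (b (q+1)) (b q)).symm }
    (by
      intro g a; apply Subtype.ext; funext q
      show A.ρ g (a (q + 1 - (χ g).toAdd)) - A.ρ g (a (q - (χ g).toAdd)) =
        A.ρ g (a (q - (χ g).toAdd + 1) - a (q - (χ g).toAdd))
      rw [map_sub, sub_add_eq_add_sub])

lemma ses1 (A : Rep.{0} k G) : SES (pconst χ A) (pdiff χ A) where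
  inj a ha := congrFun ha (0 : ZMod 12)
  surj := by
    rintro ⟨c, hc⟩
    have hc : ∑ q : ZMod 12, (c : ZMod 12 → A.V) q = 0 := hc
    change ZMod 12 → A.V at c
    have hc' : ∑ j ∈ Finset.range 12, c (j : ZMod 12) = 0 := by
      rw [← hc]
      exact (Fin.sum_univ_eq_sum_range (fun j => c (j : ZMod 12)) 12).symm.trans
        (Finset.sum_congr rfl fun q _ => congrArg c (ZMod.natCast_zmod_val (n := 12) q))
    refine ⟨fun q : ZMod 12 => ∑ j ∈ Finset.range q.val, c (j : ZMod 12), Subtype.ext ?_⟩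
    funext q
    show (∑ j ∈ Finset.range (q+1).val, c (j : ZMod 12)) -
      (∑ j ∈ Finset.range q.val, c (j : ZMod 12)) = c q
    by_cases h : q = 11
    · subst h
      have e1 : ((11 : ZMod 12) + 1).val = 0 := by decide
      have e2 : (11 : ZMod 12).val = 11 := by decide
      rw [e1, e2]
      rw [Finset.sum_range_succ] at hc'
      rw [Finset.sum_range_zero, zero_sub]
      exact (eq_neg_of_add_eq_zero_right hc').symm
    · have : (q+1).val = q.val + 1 := by
        revert h; revert q; decide
      rw [this, Finset.sum_range_succ]
      simp
  comp a := Subtype.ext (funext fun q => sub_self _)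
  exact b hb := by
    have h : ∀ q : ZMod 12, b (q+1) = b q := fun q =>
      sub_eq_zero.1 (congrFun (congrArg Subtype.val hb) q)
    refine ⟨b (0 : ZMod 12), funext fun q : ZMod 12 => ?_⟩
    show b (0 : ZMod 12) = b q
    have : ∀ n : ℕ, b (n : ZMod 12) = b (0 : ZMod 12) := by
      intro n
      induction n with
      | zero => simp
      | succ n ih => rw [Nat.cast_succ, h, ih]
    rw [← this q.val]; simp

lemma ses2 (A : Rep.{0} k G) : SES (pincl χ A) (psum χ A) where
  inj a ha := Subtype.ext ha
  surj c := by
    refine ⟨(Pi.single (0 : ZMod 12) c : ZMod 12 → A.V), ?_⟩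
    show ∑ q, (Pi.single (0 : ZMod 12) c : ZMod 12 → A.V) q = c
    simp
  comp a := a.2
  exact b hb := ⟨⟨b, hb⟩, rfl⟩

/-- the periodicity operator -/
noncomputable def per (A : Rep.{0} k G) (n : ℕ) :
    groupCohomology A n →+ groupCohomology A (n+2) :=
  (del (ses1 χ A) (n+1)).comp (del (ses2 χ A) n)

def PK.map {A B : Rep.{0} k G} (f : A ⟶ B) : PK χ A ⟶ PK χ B :=
  mkHom (A := PK χ A) (B := PK χ B)
    (((Per.map χ f).hom.toLinearMap.restrict (p := LinearMap.ker (psumL A))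
      (q := LinearMap.ker (psumL B)) (by
      intro a ha
      change ZMod 12 → A.V at a
      have ha : ∑ q, a q = 0 := ha
      show ∑ q, f.hom (a q) = 0
      rw [← map_sum, ha, map_zero]))) (by
    intro g a; apply Subtype.ext; funext y
    exact Rep.hom_comm_apply f g _)

lemma per_nat {A B : Rep.{0} k G} (f : A ⟶ B) (n : ℕ) (x) :
    Hm f (n+2) (per χ A n x) = per χ B n (Hm f n x) := by
  show Hm f (n+2) (del (ses1 χ A) (n+1) (del (ses2 χ A) n x)) = _
  rw [del_nat (ses1 χ A) (ses1 χ B) f (Per.map χ f) (PK.map χ f),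
    del_nat (ses2 χ A) (ses2 χ B) (PK.map χ f) (Per.map χ f) f]
  · rfl
  · intro x; rfl
  · intro x; change ZMod 12 → A.V at x; show f.hom (∑ q, x q) = ∑ q, f.hom (x q)
    rw [map_sum]
  · intro x; rfl
  · intro x; apply Subtype.ext; funext q; show f.hom (_ - _) = f.hom _ - f.hom _
    rw [map_sub]

/-- cup product of invariants with powers of the class -/
noncomputable def u (A : Rep.{0} k G) : (m : ℕ) → Inv A →+ groupCohomology A (2*m)
  | 0 => H0 A
  | m+1 => (per χ A (2*m)).comp (u A m)

lemma u_nat {A B : Rep.{0} k G} (f : A ⟶ B) (m : ℕ) (a : Inv A) :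
    Hm f (2*m) (u χ A m a) = u χ B m (invMap f a) := by
  induction m with
  | zero => exact H0_nat f a
  | succ m ih => exact (per_nat χ f _ _).trans (congrArg _ ih)

lemma per_bij {A : Rep.{0} k G} (h : Acyc (Per χ A)) (n : ℕ) :
    Function.Bijective (per χ A (n+1)) := by
  constructor
  · refine (injective_iff_map_eq_zero _).2 fun x hx => ?_
    obtain ⟨y, hy⟩ := (ex3 (ses1 χ A) _ _).1 hx
    rw [h _ y, map_zero] at hy
    obtain ⟨y, hy⟩ := (ex3 (ses2 χ A) _ _).1 hy.symm
    rw [h _ y, map_zero] at hy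
    exact hy.symm
  · intro x
    obtain ⟨y, rfl⟩ := (ex1 (ses1 χ A) _ x).1 (h _ _)
    obtain ⟨z, rfl⟩ := (ex1 (ses2 χ A) _ y).1 (h _ _)
    exact ⟨z, rfl⟩

lemma u_surj {A : Rep.{0} k G} (h : Acyc (Per χ A)) (m : ℕ) :
    Function.Surjective (u χ A (m+1)) := by
  induction m with
  | zero =>
    intro x
    obtain ⟨y, rfl⟩ := (ex1 (ses1 χ A) _ x).1 (h _ _)
    obtain ⟨z, rfl⟩ := (ex1 (ses2 χ A) _ y).1 (h _ _)
    obtain ⟨w, rfl⟩ := (H0_bij A).2 z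
    exact ⟨w, rfl⟩
  | succ m ih => exact (per_bij χ h (2*m+1)).2.comp ih

lemma u_zero {A : Rep.{0} k G} (h : Acyc (Per χ A)) (m : ℕ) (a : Inv A) :
    u χ A (m+1) a = 0 ↔ ∃ f : Inv (Per χ A), invMap (psum χ A) f = a := by
  induction m with
  | zero =>
    constructor
    · intro hx
      obtain ⟨y, hy⟩ := (ex3 (ses1 χ A) _ _).1 hx
      rw [h _ y, map_zero] at hy
      obtain ⟨y, hy⟩ := (ex3 (ses2 χ A) _ _).1 hy.symm
      obtain ⟨w, rfl⟩ := (H0_bij _).2 y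
      rw [H0_nat] at hy
      exact ⟨w, (H0_bij A).1 hy⟩
    · rintro ⟨f, rfl⟩
      show del (ses1 χ A) 1 (del (ses2 χ A) 0 (H0 A _)) = 0
      rw [← H0_nat, (ex3 (ses2 χ A) _ _).2 ⟨_, rfl⟩, map_zero]
  | succ m ih =>
    rw [← ih]
    exact map_eq_zero_iff _ (per_bij χ h (2*m+1)).1

/-- unconditional half -/
lemma u_psum {A : Rep.{0} k G} (m : ℕ) (f : Inv (Per χ A)) :
    u χ A (m+1) (invMap (psum χ A) f) = 0 := by
  induction m with
  | zero =>
    show del (ses1 χ A) 1 (del (ses2 χ A) 0 (H0 A _)) = 0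
    rw [← H0_nat, (ex3 (ses2 χ A) _ _).2 ⟨_, rfl⟩, map_zero]
  | succ m ih =>
    exact (congrArg (per χ A (2*(m+1))) ih).trans (map_zero (per χ A (2*(m+1))))

lemma odd_zero {A : Rep.{0} k G} (h : Acyc (Per χ A)) (h1 : ∀ x : groupCohomology A 1, x = 0)
    (m : ℕ) : ∀ x : groupCohomology A (2*m+1), x = 0 := by
  induction m with
  | zero => exact h1
  | succ m ih =>
    intro x
    obtain ⟨y, rfl⟩ := (per_bij χ h (2*m)).2 x
    rw [ih y, map_zero]

lemma acyc_Fn {Y : Type} [MulAction G Y] (hfree : ∀ (g : G) (y : Y), g • y = y → χ g = 1 → g = 1)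
    (A : Rep.{0} k G) : Acyc (Per χ (Fn Y A)) := by
  classical
  -- action on the product
  let act : G → ZMod 12 × Y → ZMod 12 × Y := fun g z => (z.1 + (χ g).toAdd, g • z.2)
  have act_mul : ∀ a b z, act (a * b) z = act a (act b z) := by
    intro a b z; simp [act, mul_smul, add_left_comm, add_comm]
  have act_one : ∀ z, act 1 z = z := by intro z; simp [act]
  have act_free : ∀ g z, act g z = z → g = 1 := by
    intro g z h
    have h1 := congrArg Prod.fst h
    have h2 := congrArg Prod.snd h
    refine hfree g z.2 h2 ?_
    simpa [act] using h1
  let S : Setoid (ZMod 12 × Y) :=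
    { r := fun a b => ∃ g, act g b = a
      iseqv := ⟨fun a => ⟨1, act_one a⟩,
        fun {a b} ⟨g, hg⟩ => ⟨g⁻¹, by rw [← hg, ← act_mul, inv_mul_cancel, act_one]⟩,
        fun {a b c} ⟨g, hg⟩ ⟨g', hg'⟩ => ⟨g * g', by rw [act_mul, hg', hg]⟩⟩ }
  let o : ZMod 12 × Y → ZMod 12 × Y := fun z => (Quotient.mk S z).out
  have ho : ∀ z, ∃ g, act g (o z) = z := fun z => Setoid.symm (Quotient.mk_out (s := S) z)
  choose s hs using ho
  have hso : ∀ g z, o (act g z) = o z := by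
    intro g z
    show (Quotient.mk S (act g z)).out = (Quotient.mk S z).out
    rw [Quotient.sound (s := S) (⟨g, rfl⟩ : S.r (act g z) z)]
  have hsg : ∀ g z, s (act g z) = g * s z := by
    intro g z
    have h1 := hs (act g z)
    rw [hso] at h1
    have h2 : act (g * s z) (o z) = act g z := by rw [act_mul, hs]
    have h3 : act ((g * s z)⁻¹ * s (act g z)) (o z) = o z := by
      rw [act_mul, h1, ← h2, ← act_mul, inv_mul_cancel, act_one]
    have := act_free _ _ h3
    exact (inv_mul_eq_one.1 this).symm
  let M := Per χ (Fn Y A)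
  refine acyc_of_retract (M := M)
    { toFun := fun φ (q : ZMod 12) (y : Y) =>
        A.ρ (s (q, y)) ((φ (s (q, y))⁻¹ : ZMod 12 → Y → A.V) (q - (χ (s (q, y))).toAdd) ((s (q, y))⁻¹ • y))
      map_add' := fun a b => by
        funext q y
        exact map_add (A.ρ (s (q,y))) _ _
      map_smul' := fun c b => by
        funext q y
        exact map_smul (A.ρ (s (q,y))) _ _ } ?_ ?_
  · intro φ g
    funext q y
    have : s (q - (χ g).toAdd, g⁻¹ • y) = g⁻¹ * s (q, y) := by
      rw [← hsg]; simp [act, sub_eq_add_neg]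
    show A.ρ (s (q, y)) ((φ ((s (q, y))⁻¹ * g) : ZMod 12 → Y → A.V) (q - (χ (s (q, y))).toAdd) ((s (q, y))⁻¹ • y))
      = A.ρ g (A.ρ (s (q - (χ g).toAdd, g⁻¹ • y)) ((φ (s (q - (χ g).toAdd, g⁻¹ • y))⁻¹ : ZMod 12 → Y → A.V) (q - (χ g).toAdd - (χ (s (q - (χ g).toAdd, g⁻¹ • y))).toAdd) ((s (q - (χ g).toAdd, g⁻¹ • y))⁻¹ • g⁻¹ • y)))
    rw [this, ← Module.End.mul_apply, ← map_mul]
    have e : q - (χ g).toAdd - (-(χ g).toAdd + (χ (s (q, y))).toAdd) = q - (χ (s (q, y))).toAdd := by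
      ring
    simp [mul_smul, e]
  · intro m
    funext q y
    show A.ρ (s (q, y)) (A.ρ (s (q,y))⁻¹ ((m : ZMod 12 → Y → A.V) (q - (χ (s (q, y))).toAdd - (χ (s (q, y))⁻¹).toAdd) (((s (q, y))⁻¹)⁻¹ • (s (q, y))⁻¹ • y))) = (m : ZMod 12 → Y → A.V) q y
    rw [← Module.End.mul_apply, ← map_mul]
    simp

end per
end EC

open CategoryTheory

namespace EC
variable {k G : Type} [CommRing k] [Group G]

/-- vanishing of the first cohomology of functions on a set with finite stabilizers -/
lemma H1_zero {Y : Type} [MulAction G Y] (A : Rep.{0} k G)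
    (hfin : ∀ (y : Y) (g : G), g • y = y → ∃ n : ℕ, n ≠ 0 ∧ g ^ n = 1)
    (htriv : ∀ (y : Y) (g : G), g • y = y → ∀ a : A.V, A.ρ g a = a)
    (htf : ∀ (n : ℕ) (a : A.V), n ≠ 0 → n • a = 0 → a = 0) :
    ∀ x : groupCohomology (Fn Y A) 1, x = 0 := by
  intro x
  induction x using groupCohomology.H1_induction_on with
  | h c =>
    rw [groupCohomology.H1π_eq_zero_iff]
    have hc := (groupCohomology.mem_cocycles₁_iff _).1 c.2
    obtain ⟨c, hc'⟩ := c
    replace hc : ∀ g h : G, (c (g * h) : Y → A.V) = (Fn Y A).ρ g (c h) + c g := hc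
    have hc : ∀ (g h : G) (y : Y), (c (g * h) : Y → A.V) y =
        A.ρ g ((c h : Y → A.V) (g⁻¹ • y)) + (c g : Y → A.V) y :=
      fun g h y => congrFun (hc g h) y
    show c ∈ _
    -- vanishing on stabilizers
    have hst : ∀ (y : Y) (g : G), g • y = y → (c g : Y → A.V) y = 0 := by
      intro y g hg
      have hg' : g⁻¹ • y = y := inv_smul_eq_iff.2 hg.symm
      have hpow : ∀ n : ℕ, (c (g ^ (n+1)) : Y → A.V) y = (n+1) • (c g : Y → A.V) y := by
        intro n
        induction n with
        | zero => simp
        | succ n ih =>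
          rw [pow_succ', hc, hg', htriv y g hg, ih, ← succ_nsmul]
      obtain ⟨n, hn, h1⟩ := hfin y g hg
      obtain ⟨n, rfl⟩ := Nat.exists_eq_succ_of_ne_zero hn
      have h2 := hpow n
      have h3 : (c 1 : Y → A.V) y = 0 := by
        have := hc 1 1 y
        simpa using this
      rw [← Nat.succ_eq_add_one, h1, h3] at h2
      exact htf _ _ hn h2.symm
    let o : Y → Y := fun y => (Quotient.mk (MulAction.orbitRel G Y) y).out
    have ho : ∀ y, ∃ g : G, g • o y = y := fun y =>
      (MulAction.orbitRel G Y).symm' (Quotient.mk_out (s := MulAction.orbitRel G Y) y)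
    choose s hs using ho
    have hog : ∀ (g : G) (y : Y), o (g • y) = o y := by
      intro g y
      show (Quotient.mk (MulAction.orbitRel G Y) (g • y)).out = (Quotient.mk (MulAction.orbitRel G Y) y).out
      rw [Quotient.sound (s := MulAction.orbitRel G Y) (⟨g, rfl⟩ : (MulAction.orbitRel G Y).r (g • y) y)]
    let F : Y → A.V := fun y => - (c (s y) : Y → A.V) y
    refine ⟨F, ?_⟩
    funext g
    show (Fn Y A).ρ g F - F = c g
    funext y
    show A.ρ g (- (c (s (g⁻¹ • y)) : Y → A.V) (g⁻¹ • y)) - (- (c (s y) : Y → A.V) y) = (c g : Y → A.V) y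
    rw [map_neg, sub_neg_eq_add, neg_add_eq_iff_eq_add, ← hc g]
    have e : g * s (g⁻¹ • y) = s y * ((s y)⁻¹ * (g * s (g⁻¹ • y))) := by group
    have e2 : ((s y)⁻¹ * (g * s (g⁻¹ • y))) • o y = o y := by
      rw [mul_smul, mul_smul, inv_smul_eq_iff, hs y, ← hog g⁻¹ y, hs, smul_inv_smul]
    have e3 : (s y)⁻¹ • y = o y := by rw [inv_smul_eq_iff, hs]
    rw [e, hc (s y), e3, hst _ _ e2, map_zero, zero_add]

section Nm
variable (χ : G →* Multiplicative (ZMod 12))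

/-- being a norm -/
def Nm (Y : Type) [MulAction G Y] (A : Rep.{0} k G) (f : Y → A.V) : Prop :=
  ∃ F : ZMod 12 → Y → A.V, (∀ g q y, A.ρ g (F (q - (χ g).toAdd) (g⁻¹ • y)) = F q y) ∧
    ∀ y, ∑ q, F q y = f y

lemma nm_iff {Y : Type} [MulAction G Y] (A : Rep.{0} k G) (f : Inv (Fn Y A)) :
    (∃ F : Inv (Per χ (Fn Y A)), invMap (psum χ (Fn Y A)) F = f) ↔ Nm χ Y A f.1 := by
  constructor
  · rintro ⟨⟨F, hF⟩, rfl⟩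
    refine ⟨F, fun g q y => congrFun (congrFun (hF g) q) y, fun y => ?_⟩
    exact (Finset.sum_apply y Finset.univ (F : ZMod 12 → Y → A.V)).symm
  · rintro ⟨F, h1, h2⟩
    refine ⟨⟨F, fun g => funext fun q => funext fun y => h1 g q y⟩, Subtype.ext (funext fun y => ?_)⟩
    refine Eq.trans ?_ (h2 y)
    exact (Finset.sum_apply y Finset.univ (F : ZMod 12 → Y → A.V))

lemma u_zero_nm {Y : Type} [MulAction G Y] (hfree : ∀ (g : G) (y : Y), g • y = y → χ g = 1 → g = 1)
    (A : Rep.{0} k G) (m : ℕ) (f : Inv (Fn Y A)) :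
    u χ (Fn Y A) (m+1) f = 0 ↔ Nm χ Y A f.1 := by
  rw [u_zero χ (acyc_Fn χ hfree A), nm_iff]

lemma Nm_sum {Y Z : Type} [MulAction G Y] [MulAction G Z] (A : Rep.{0} k G) (f : Y ⊕ Z → A.V) :
    Nm χ (Y ⊕ Z) A f ↔ Nm χ Y A (f ∘ Sum.inl) ∧ Nm χ Z A (f ∘ Sum.inr) := by
  constructor
  · rintro ⟨F, h1, h2⟩
    exact ⟨⟨fun q y => F q (Sum.inl y), fun g q y => h1 g q (Sum.inl y), fun y => h2 (Sum.inl y)⟩,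
      ⟨fun q y => F q (Sum.inr y), fun g q y => h1 g q (Sum.inr y), fun y => h2 (Sum.inr y)⟩⟩
  · rintro ⟨⟨F, h1, h2⟩, ⟨F', h1', h2'⟩⟩
    refine ⟨fun q => Sum.elim (F q) (F' q), ?_, ?_⟩
    · rintro g q (y | y)
      · exact h1 g q y
      · exact h1' g q y
    · rintro (y | y)
      · exact h2 y
      · exact h2' y

/-- value of an invariant function on a coset space -/
lemma inv_coset {S : Subgroup G} (A : Rep.{0} k G) (f : Inv (Fn (G ⧸ S) A)) (g : G) :
    (f.1 : G ⧸ S → A.V) (g : G ⧸ S) = A.ρ g ((f.1 : G ⧸ S → A.V) ((1 : G) : G ⧸ S)) := by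
  have h := congrFun (f.2 g) (g : G ⧸ S)
  rw [← h]
  show A.ρ g ((f.1 : G ⧸ S → A.V) (g⁻¹ • (g : G ⧸ S))) = _
  have e : g⁻¹ • (g : G ⧸ S) = ((1 : G) : G ⧸ S) := by
    show ((g⁻¹ * g : G) : G ⧸ S) = _
    rw [inv_mul_cancel]
  exact congrArg (fun z => A.ρ g ((f.1 : G ⧸ S → A.V) z)) e

/-- the invariant function on a coset space with given value -/
def mkInv {S : Subgroup G} (A : Rep.{0} k G) (a : A.V) (ha : ∀ g ∈ S, A.ρ g a = a) :
    Inv (Fn (G ⧸ S) A) :=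
  ⟨fun y => Quotient.liftOn' y (fun g => A.ρ g a) (by
    intro x y h
    have := ha _ (QuotientGroup.leftRel_apply.1 h)
    show A.ρ x a = A.ρ y a
    conv_lhs => rw [← this]
    rw [← Module.End.mul_apply, ← map_mul, mul_inv_cancel_left]), by
  intro g
  funext y
  induction y using Quotient.inductionOn' with
  | h y =>
    show A.ρ g (A.ρ (g⁻¹ * y) a) = A.ρ y a
    rw [← Module.End.mul_apply, ← map_mul, mul_inv_cancel_left]⟩

lemma mkInv_apply {S : Subgroup G} (A : Rep.{0} k G) (a : A.V) (ha : ∀ g ∈ S, A.ρ g a = a) (g : G) :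
    ((mkInv A a ha).1 : G ⧸ S → A.V) (g : G ⧸ S) = A.ρ g a := rfl

lemma inv_coset_mem {S : Subgroup G} (A : Rep.{0} k G) (f : Inv (Fn (G ⧸ S) A)) (g : G) (hg : g ∈ S) :
    A.ρ g ((f.1 : G ⧸ S → A.V) ((1 : G) : G ⧸ S)) = (f.1 : G ⧸ S → A.V) ((1 : G) : G ⧸ S) := by
  rw [← inv_coset]
  have e : (g : G ⧸ S) = ((1 : G) : G ⧸ S) := QuotientGroup.eq.2 (by simpa using hg)
  rw [e]

lemma Nm_coset {S : Subgroup G} [Fintype S] (hS : ∀ g ∈ S, χ g = 1 → g = 1)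
    (A : Rep.{0} k G) (f : Inv (Fn (G ⧸ S) A)) :
    Nm χ (G ⧸ S) A f.1 ↔ ∃ a : A.V, (f.1 : G ⧸ S → A.V) ((1 : G) : G ⧸ S) = ∑ t : S, A.ρ t.1 a := by
  classical
  constructor
  · rintro ⟨F, h1, h2⟩
    rw [← h2]
    let H : Subgroup (Multiplicative (ZMod 12)) := S.map χ
    obtain ⟨D, hD, -⟩ := H.exists_isComplement_right 1
    have hb := hD
    let e : S ≃ H := Equiv.ofBijective (fun t => ⟨χ t.1, ⟨t.1, t.2, rfl⟩⟩) (by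
      constructor
      · intro a b hab
        have hab : χ a.1 = χ b.1 := congrArg Subtype.val hab
        have := hS (a.1 * b.1⁻¹) (S.mul_mem a.2 (S.inv_mem b.2)) (by simp [hab])
        exact Subtype.ext (mul_inv_eq_one.1 this)
      · rintro ⟨_, t, ht, rfl⟩
        exact ⟨⟨t, ht⟩, rfl⟩)
    let E : S × D ≃ ZMod 12 :=
      ((Equiv.prodCongr e (Equiv.refl D)).trans (Equiv.ofBijective _ hb)).trans Multiplicative.toAdd
    refine ⟨∑ d : D, F (d.1.toAdd) ((1 : G) : G ⧸ S), ?_⟩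
    rw [← E.sum_comp, Fintype.sum_prod_type]
    refine Finset.sum_congr rfl fun t _ => ?_
    rw [map_sum]
    refine Finset.sum_congr rfl fun d _ => ?_
    rw [← h1 t.1]
    have e1 : E (t, d) - (χ t.1).toAdd = d.1.toAdd := by
      show ((χ t.1) * d.1).toAdd - (χ t.1).toAdd = d.1.toAdd
      rw [toAdd_mul, add_sub_cancel_left]
    have e2 : (t.1)⁻¹ • ((1 : G) : G ⧸ S) = ((1 : G) : G ⧸ S) := by
      show (((t.1)⁻¹ * 1 : G) : G ⧸ S) = _
      exact (QuotientGroup.eq.2 (by simp))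
    rw [e1, e2]
  · rintro ⟨a, ha⟩
    refine ⟨fun q y => ∑ t : S, if (χ (y.out * t.1)).toAdd = q then A.ρ (y.out * t.1) a else 0, ?_, ?_⟩
    · intro g q y
      rw [map_sum]
      have h0 : (y.out)⁻¹ * (g * (g⁻¹ • y).out) ∈ S := by
        rw [← QuotientGroup.eq, QuotientGroup.out_eq']
        show y = g • (((g⁻¹ • y).out : G) : G ⧸ S)
        rw [QuotientGroup.out_eq', smul_inv_smul]
      refine Fintype.sum_equiv (Equiv.mulLeft (⟨_, h0⟩ : S)) _ _ fun t => ?_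
      have h1 : y.out * ((Equiv.mulLeft (⟨_, h0⟩ : S)) t).1 = g * ((g⁻¹ • y).out * t.1) := by
        show y.out * ((y.out)⁻¹ * (g * (g⁻¹ • y).out) * t.1) = _
        group
      rw [h1, map_mul χ g, toAdd_mul, map_mul A.ρ g, Module.End.mul_apply]
      by_cases hq : (χ ((g⁻¹ • y).out * t.1)).toAdd = q - (χ g).toAdd
      · rw [if_pos hq, if_pos (by rw [hq]; ring)]
      · rw [if_neg hq, if_neg (fun h => hq (by rw [← h]; ring)), map_zero]
    · intro y
      rw [Finset.sum_comm]
      simp only [Finset.sum_ite_eq, Finset.mem_univ, if_true]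
      conv_rhs => rw [← QuotientGroup.out_eq' y]
      rw [inv_coset, ha, map_sum]
      simp only [map_mul, Module.End.mul_apply]

lemma coset_free {S : Subgroup G} (hS : ∀ g ∈ S, χ g = 1 → g = 1) :
    ∀ (g : G) (y : G ⧸ S), g • y = y → χ g = 1 → g = 1 := by
  intro g y
  induction y using Quotient.inductionOn' with
  | h y =>
    intro h hg
    have h : ((g * y : G) : G ⧸ S) = (y : G ⧸ S) := h
    have := hS _ (QuotientGroup.eq.1 h.symm) (by simp [hg])
    have h2 : g = y * (y⁻¹ * (g * y)) * y⁻¹ := by group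
    rw [h2, this]; group

lemma coset_fin {S : Subgroup G} [Finite S] :
    ∀ (y : G ⧸ S) (g : G), g • y = y → ∃ n : ℕ, n ≠ 0 ∧ g ^ n = 1 := by
  intro y g
  induction y using Quotient.inductionOn' with
  | h y =>
    intro h
    have h : ((g * y : G) : G ⧸ S) = (y : G ⧸ S) := h
    have hm := (QuotientGroup.eq.1 h.symm)
    refine ⟨Nat.card S, Nat.card_pos.ne', ?_⟩
    have h1 : (⟨_, hm⟩ : S) ^ Nat.card S = 1 := pow_card_eq_one'
    have h1 : (y⁻¹ * (g * y)) ^ Nat.card S = 1 := congrArg Subtype.val h1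
    have h3 : (y⁻¹ * g * (y⁻¹)⁻¹) ^ Nat.card S = 1 := by rw [inv_inv, mul_assoc]; exact h1
    rw [conj_pow] at h3
    have h2 : g ^ Nat.card S = y * (y⁻¹ * g ^ Nat.card S * (y⁻¹)⁻¹) * y⁻¹ := by group
    rw [h2, h3]; group

end Nm
end EC


namespace EC

/-- Tree lemma: uniqueness part. -/
lemma tree_uniq {G M : Type*} [Group G] {A B : Subgroup G} (lA lB : G → ℕ)
    (hA : ∀ x, ∀ a ∈ A, lA (x * a) = lA x) (hB : ∀ x, ∀ b ∈ B, lB (x * b) = lB x)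
    (a1 : ∀ x, ∃ a ∈ A, lB (x * a) < lA (x * a))
    (b1 : ∀ x, x ∈ B ∨ ∃ b ∈ B, lA (x * b) < lB (x * b))
    (f : G → M) (fA : ∀ x, ∀ a ∈ A, f (x * a) = f x) (fB : ∀ x, ∀ b ∈ B, f (x * b) = f x)
    (x : G) : f x = f 1 := by
  induction h : lB x using Nat.strong_induction_on generalizing x with
  | h n ih =>
    subst h
    rcases b1 x with hx | ⟨b, hb, h1⟩
    · simpa using fB 1 x hx
    · obtain ⟨a, ha, h2⟩ := a1 (x * b)
      rw [hA _ a ha] at h2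
      rw [hB _ b hb] at h1
      rw [← fB x b hb, ← fA _ a ha]
      exact ih _ (h2.trans h1) _ rfl

/-- Tree lemma: existence part. -/
lemma tree_exists {G M : Type*} [Group G] [AddCommGroup M] {A B : Subgroup G} (lA lB : G → ℕ)
    (hA : ∀ x, ∀ a ∈ A, lA (x * a) = lA x) (hB : ∀ x, ∀ b ∈ B, lB (x * b) = lB x)
    (hne : ∀ x, lA x ≠ lB x)
    (a1 : ∀ x, ∃ a ∈ A, lB (x * a) < lA (x * a))
    (a2 : ∀ x, ∀ a ∈ A, lB x < lA x → lB (x * a) < lA (x * a) → a ∈ B)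
    (b1 : ∀ x, x ∈ B ∨ ∃ b ∈ B, lA (x * b) < lB (x * b))
    (b2 : ∀ x, ∀ b ∈ B, lA x < lB x → lA (x * b) < lB (x * b) → b ∈ A)
    (b3 : ∀ x ∈ B, lB x < lA x)
    (φ : G → M) (hφ : ∀ x c, c ∈ A → c ∈ B → φ (x * c) = φ x) :
    ∃ f g : G → M, (∀ x, ∀ a ∈ A, f (x * a) = f x) ∧ (∀ x, ∀ b ∈ B, g (x * b) = g x) ∧
      ∀ x, φ x = f x - g x := by
  classical
  choose a ha1 ha2 using a1
  have hb : ∀ x, ∃ b ∈ B, x ∉ B → lA (x * b) < lB (x * b) := by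
    intro x
    rcases b1 x with hx | ⟨b, hb, h1⟩
    · exact ⟨1, B.one_mem, fun h => absurd hx h⟩
    · exact ⟨b, hb, fun _ => h1⟩
  choose b hb1 hb2 using hb
  let y : G → G := fun x => x * b x
  let z : G → G := fun x => y x * a (y x)
  have hz : ∀ x, x ∉ B → lB (z x) < lB x := by
    intro x hx
    have h1 := hb2 x hx
    rw [hB _ _ (hb1 x)] at h1
    refine lt_trans ?_ h1
    show lB (x * b x * a (x * b x)) < _
    have h2 := ha2 (x * b x)
    rwa [hA _ _ (ha1 _)] at h2
  let g : G → M := WellFounded.fix (measure lB).wf fun x ih =>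
    if h : lB (z x) < lB x then if x ∈ B then 0 else ih (z x) h + φ (z x) - φ (y x) else 0
  have hgB : ∀ x, x ∈ B → g x = 0 := by
    intro x hx
    simp only [g]
    rw [WellFounded.fix_eq]
    simp [hx]
  have hg : ∀ x, x ∉ B → g x = g (z x) + φ (z x) - φ (y x) := by
    intro x hx
    conv_lhs => simp only [g]
    rw [WellFounded.fix_eq]
    simp only [hx, if_false, dif_pos (hz x hx)]
    rfl
  -- comparison of chosen down edges at an A-vertex
  have keyA : ∀ x, ∀ c ∈ A, ∃ d, d ∈ A ∧ d ∈ B ∧ x * c * a (x * c) = x * a x * d := by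
    intro x c hc
    refine ⟨(a x)⁻¹ * c * a (x * c), A.mul_mem (A.mul_mem (A.inv_mem (ha1 x)) hc) (ha1 _), ?_, by group⟩
    refine a2 (x * a x) _ (A.mul_mem (A.mul_mem (A.inv_mem (ha1 x)) hc) (ha1 _)) (ha2 x) ?_
    have : x * a x * ((a x)⁻¹ * c * a (x * c)) = x * c * a (x * c) := by group
    rw [this]; exact ha2 _
  have keyB : ∀ x, x ∉ B → ∀ c ∈ B, ∃ d, d ∈ A ∧ d ∈ B ∧ x * c * b (x * c) = x * b x * d := by
    intro x hx c hc
    have hxc : x * c ∉ B := fun h => hx ((Subgroup.mul_mem_cancel_right B hc).1 h)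
    refine ⟨(b x)⁻¹ * c * b (x * c), ?_, B.mul_mem (B.mul_mem (B.inv_mem (hb1 x)) hc) (hb1 _), by group⟩
    refine b2 (x * b x) _ (B.mul_mem (B.mul_mem (B.inv_mem (hb1 x)) hc) (hb1 _)) (hb2 x hx) ?_
    have : x * b x * ((b x)⁻¹ * c * b (x * c)) = x * c * b (x * c) := by group
    rw [this]; exact hb2 _ hxc
  have gB : ∀ n x, lB x = n → ∀ c ∈ B, g (x * c) = g x := by
    intro n
    induction n using Nat.strong_induction_on with
    | h n ih =>
      intro x hn c hc
      by_cases hx : x ∈ B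
      · rw [hgB x hx, hgB _ (B.mul_mem hx hc)]
      · have hxc : x * c ∉ B := fun h => hx ((Subgroup.mul_mem_cancel_right B hc).1 h)
        rw [hg x hx, hg _ hxc]
        obtain ⟨d, dA, dB, hd⟩ := keyB x hx c hc
        obtain ⟨d', dA', dB', hd'⟩ := keyA (x * b x) d dA
        have e1 : y (x * c) = y x * d := hd
        have e2 : z (x * c) = z x * d' := by
          show y (x * c) * a (y (x * c)) = _
          rw [e1]; exact hd'
        rw [e1, e2, hφ _ d dA dB, hφ _ d' dA' dB',
          ih (lB (z x)) (by rw [← hn]; exact hz x hx) (z x) rfl d' dB']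
  have gB : ∀ x, ∀ c ∈ B, g (x * c) = g x := fun x => gB _ x rfl
  refine ⟨fun x => g (x * a x) + φ (x * a x), g, ?_, gB, ?_⟩
  · intro x c hc
    obtain ⟨d, dA, dB, hd⟩ := keyA x c hc
    show g (x * c * a (x * c)) + φ (x * c * a (x * c)) = _
    rw [hd, hφ _ d dA dB, gB _ d dB]
  · intro x
    rcases lt_or_gt_of_ne (hne x) with h | h
    · have hx : x ∉ B := fun hx => absurd (b3 x hx) (by omega)
      have hbA : b x ∈ A := b2 x _ (hb1 x) h (hb2 x hx)
      obtain ⟨d, dA, dB, hd⟩ := keyA x (b x) hbA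
      rw [hg x hx]
      have e1 : z x = x * a x * d := hd
      rw [e1, hφ _ d dA dB, gB _ d dB]
      show _ = _ - (_ - φ (x * b x))
      rw [hφ _ _ hbA (hb1 x)]
      exact (sub_sub_cancel _ _).symm
    · have haB : a x ∈ B := a2 x _ (ha1 x) h (ha2 x)
      show _ = g (x * a x) + φ (x * a x) - g x
      rw [hφ _ _ (ha1 x) haB, gB _ _ haB]
      abel

end EC


namespace EC

/-- The modular group. -/
abbrev Gam : Type := Matrix.SpecialLinearGroup (Fin 2) ℤ

/-- element of order 4 -/
def gs : Gam := ⟨!![0, -1; 1, 0], by simp [Matrix.det_fin_two]⟩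
/-- element of order 6 -/
def gr : Gam := ⟨!![0, 1; -1, 1], by simp [Matrix.det_fin_two]⟩

/-- dot product of the columns -/
def dt (x : Gam) : ℤ := x 0 0 * x 0 1 + x 1 0 * x 1 1
/-- norm of a basis -/
def hB (x : Gam) : ℤ := x 0 0 ^ 2 + x 1 0 ^ 2 + x 0 1 ^ 2 + x 1 1 ^ 2

lemma det1 (x : Gam) : x 0 0 * x 1 1 - x 0 1 * x 1 0 = 1 := by
  have := x.2
  rwa [Matrix.det_fin_two] at this

lemma gam_ext {x y : Gam} (h1 : x 0 0 = y 0 0) (h2 : x 0 1 = y 0 1) (h3 : x 1 0 = y 1 0)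
    (h4 : x 1 1 = y 1 1) : x = y := by
  ext i j; fin_cases i <;> fin_cases j <;> assumption

lemma zp_mem {G : Type*} [Group G] {g x : G} {n : ℕ} (hn : n ≠ 0) (h1 : g ^ n = 1)
    (hx : x ∈ Subgroup.zpowers g) : ∃ k < n, x = g ^ k := by
  obtain ⟨m, rfl⟩ := Subgroup.mem_zpowers_iff.1 hx
  have hn' : (n : ℤ) ≠ 0 := by exact_mod_cast hn
  refine ⟨(m % n).toNat, ?_, ?_⟩
  · have := Int.emod_lt_of_pos m (b := n) (by omega)
    have := Int.emod_nonneg m hn'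
    omega
  · have h2 := Int.emod_nonneg m hn'
    rw [← zpow_natCast, Int.toNat_of_nonneg h2, Int.emod_def, zpow_sub, zpow_mul, zpow_natCast, h1]
    simp

lemma mul_ent (x y : Gam) (i j : Fin 2) : (x * y) i j = x i 0 * y 0 j + x i 1 * y 1 j := by
  show (x.1 * y.1) i j = _
  simp [Matrix.mul_apply, Fin.sum_univ_two]

@[simp] lemma gs_ent : gs 0 0 = 0 ∧ gs 0 1 = -1 ∧ gs 1 0 = 1 ∧ gs 1 1 = 0 := ⟨rfl, rfl, rfl, rfl⟩
@[simp] lemma gr_ent : gr 0 0 = 0 ∧ gr 0 1 = 1 ∧ gr 1 0 = -1 ∧ gr 1 1 = 1 := ⟨rfl, rfl, rfl, rfl⟩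

lemma mul_gs (x : Gam) : (x * gs) 0 0 = x 0 1 ∧ (x * gs) 0 1 = - x 0 0 ∧
    (x * gs) 1 0 = x 1 1 ∧ (x * gs) 1 1 = - x 1 0 := by
  simp [mul_ent, gs_ent]

lemma mul_gr (x : Gam) : (x * gr) 0 0 = - x 0 1 ∧ (x * gr) 0 1 = x 0 0 + x 0 1 ∧
    (x * gr) 1 0 = - x 1 1 ∧ (x * gr) 1 1 = x 1 0 + x 1 1 := by
  simp [mul_ent, gr_ent]

lemma gs2 : gs ^ 2 = -1 := by decide
lemma gr3 : gr ^ 3 = -1 := by decide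
lemma gs4 : gs ^ 4 = 1 := by decide
lemma gr6 : gr ^ 6 = 1 := by decide

lemma dt_neg (x : Gam) : dt (-x) = dt x := by simp [dt]
lemma dt_gs (x : Gam) : dt (x * gs) = - dt x := by
  obtain ⟨h1, h2, h3, h4⟩ := mul_gs x
  simp only [dt, h1, h2, h3, h4]; ring
lemma hB_gs (x : Gam) : hB (x * gs) = hB x := by
  obtain ⟨h1, h2, h3, h4⟩ := mul_gs x
  simp only [hB, h1, h2, h3, h4]; ring
lemma hA_gr (x : Gam) : hB (x * gr) + dt (x * gr) = hB x + dt x := by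
  obtain ⟨h1, h2, h3, h4⟩ := mul_gr x
  simp only [hB, dt, h1, h2, h3, h4]; ring
lemma hB_nonneg (x : Gam) : 0 ≤ hB x := by unfold hB; positivity
lemma hA_nonneg (x : Gam) : 0 ≤ hB x + dt x := by
  unfold hB dt
  nlinarith [sq_nonneg (x 0 0 + x 0 1), sq_nonneg (x 1 0 + x 1 1), sq_nonneg (x 0 0), sq_nonneg (x 0 1),
    sq_nonneg (x 1 0), sq_nonneg (x 1 1)]

lemma dt_gr (x : Gam) : dt (x * gr) = - (dt x + x 0 1 ^ 2 + x 1 1 ^ 2) := by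
  obtain ⟨h1, h2, h3, h4⟩ := mul_gr x
  simp only [dt, h1, h2, h3, h4]; ring
lemma dt_gr2 (x : Gam) : dt (x * gr ^ 2) = - (dt x + x 0 0 ^ 2 + x 1 0 ^ 2) := by
  obtain ⟨h1, h2, h3, h4⟩ := mul_gr x
  rw [pow_two, ← mul_assoc, dt_gr, dt_gr]
  simp only [dt, h2, h4]; ring

lemma col_pos (x : Gam) : 0 < x 0 0 ^ 2 + x 1 0 ^ 2 ∧ 0 < x 0 1 ^ 2 + x 1 1 ^ 2 := by
  have h := det1 x
  constructor
  · by_contra hc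
    have h1 : x 0 0 = 0 := by nlinarith [sq_nonneg (x 0 0), sq_nonneg (x 1 0)]
    have h2 : x 1 0 = 0 := by nlinarith [sq_nonneg (x 0 0), sq_nonneg (x 1 0)]
    rw [h1, h2] at h; simp at h
  · by_contra hc
    have h1 : x 0 1 = 0 := by nlinarith [sq_nonneg (x 0 1), sq_nonneg (x 1 1)]
    have h2 : x 1 1 = 0 := by nlinarith [sq_nonneg (x 0 1), sq_nonneg (x 1 1)]
    rw [h1, h2] at h; simp at h

lemma gram (x : Gam) : (x 0 0 ^ 2 + x 1 0 ^ 2) * (x 0 1 ^ 2 + x 1 1 ^ 2) = 1 + dt x ^ 2 := by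
  have h := det1 x
  unfold dt
  linear_combination (x 0 0 * x 1 1 - x 0 1 * x 1 0 + 1) * h

/-- level of a superbase -/
def levA (x : Gam) : ℕ := 2 * (hB x + dt x).toNat + 1
/-- level of a base -/
def levB (x : Gam) : ℕ := 2 * (hB x).toNat

lemma D_iff (x : Gam) : levB x < levA x ↔ 0 ≤ dt x := by
  have h1 := hB_nonneg x; have h2 := hA_nonneg x
  unfold levA levB; omega
lemma D_iff' (x : Gam) : levA x < levB x ↔ dt x < 0 := by
  have h1 := hB_nonneg x; have h2 := hA_nonneg x
  unfold levA levB; omega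

lemma inv_of_gen {G M : Type*} [Group G] {g : G} {l : G → M} (h : ∀ x, l (x * g) = l x) :
    ∀ x, ∀ a ∈ Subgroup.zpowers g, l (x * a) = l x := by
  intro x a ha
  obtain ⟨n, rfl⟩ := Subgroup.mem_zpowers_iff.1 ha
  induction n with
  | zero => simp
  | succ n ih => rw [zpow_add_one, ← mul_assoc, h]; exact ih ⟨n, rfl⟩
  | pred n ih =>
    rw [zpow_sub_one, ← mul_assoc, ← h (_ * g⁻¹), inv_mul_cancel_right]; exact ih ⟨-n, rfl⟩

lemma hA_lev : ∀ x, ∀ a ∈ Subgroup.zpowers gr, levA (x * a) = levA x :=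
  inv_of_gen fun x => by unfold levA; rw [hA_gr]
lemma hB_lev : ∀ x, ∀ a ∈ Subgroup.zpowers gs, levB (x * a) = levB x :=
  inv_of_gen fun x => by unfold levB; rw [hB_gs]

lemma neg_mem_s : (-1 : Gam) ∈ Subgroup.zpowers gs := ⟨2, by rw [← gs2]; rfl⟩
lemma neg_mem_r : (-1 : Gam) ∈ Subgroup.zpowers gr := ⟨3, by rw [← gr3]; rfl⟩

lemma t_a1 (x : Gam) : ∃ a ∈ Subgroup.zpowers gr, levB (x * a) < levA (x * a) := by
  simp only [D_iff]
  by_contra! hc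
  have h0 := hc 1 (Subgroup.one_mem _)
  have h1 := hc gr (Subgroup.mem_zpowers _)
  have h2 := hc (gr ^ 2) (Subgroup.pow_mem _ (Subgroup.mem_zpowers _) 2)
  rw [mul_one] at h0
  rw [dt_gr] at h1
  rw [dt_gr2] at h2
  have hg := gram x
  nlinarith [mul_pos (show 0 < dt x + x 0 1 ^ 2 + x 1 1 ^ 2 by linarith)
    (show 0 < dt x + x 0 0 ^ 2 + x 1 0 ^ 2 by linarith), mul_pos (show 0 < dt x + x 0 1 ^ 2 + x 1 1 ^ 2 by linarith)
    (show 0 < - dt x by linarith), mul_pos (show 0 < dt x + x 0 0 ^ 2 + x 1 0 ^ 2 by linarith)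
    (show 0 < - dt x by linarith)]

lemma t_a2 (x : Gam) : ∀ a ∈ Subgroup.zpowers gr, levB x < levA x → levB (x * a) < levA (x * a) →
    a ∈ Subgroup.zpowers gs := by
  intro a ha h1 h2
  rw [D_iff] at h1 h2
  obtain ⟨k, hk, rfl⟩ := zp_mem (by norm_num) gr6 ha
  obtain ⟨c1, c2⟩ := col_pos x
  have e1 := dt_gr x
  have e2 := dt_gr2 x
  interval_cases k
  · exact Subgroup.one_mem _
  · rw [pow_one] at h2; linarith
  · linarith
  · rw [gr3]; exact neg_mem_s
  · rw [show gr ^ 4 = -gr by decide, mul_neg, dt_neg] at h2; linarith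
  · rw [show gr ^ 5 = -gr^2 by decide, mul_neg, dt_neg] at h2; linarith

lemma t_b1 (x : Gam) : x ∈ Subgroup.zpowers gs ∨ ∃ b ∈ Subgroup.zpowers gs, levA (x * b) < levB (x * b) := by
  simp only [D_iff']
  rcases lt_trichotomy (dt x) 0 with h | h | h
  · right; exact ⟨1, Subgroup.one_mem _, by rwa [mul_one]⟩
  · left
    have hg := gram x
    obtain ⟨c1, c2⟩ := col_pos x
    have hd := det1 x
    rw [h] at hg
    have e1 : x 0 0 ^ 2 + x 1 0 ^ 2 = 1 := by nlinarith
    have e2 : x 0 1 ^ 2 + x 1 1 ^ 2 = 1 := by nlinarith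
    unfold dt at h
    have f : x 0 1 = - x 1 0 := by
      linear_combination (- x 0 1) * e1 + x 0 0 * h - x 1 0 * hd
    have f2 : x 1 1 = x 0 0 := by
      linear_combination (- x 1 1) * e1 + x 1 0 * h + x 0 0 * hd
    have b1 : x 0 0 ≤ 1 := by nlinarith [sq_nonneg (x 1 0)]
    have b2 : -1 ≤ x 0 0 := by nlinarith [sq_nonneg (x 1 0)]
    have b3 : x 1 0 ≤ 1 := by nlinarith [sq_nonneg (x 0 0)]
    have b4 : -1 ≤ x 1 0 := by nlinarith [sq_nonneg (x 0 0)]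
    generalize ha : x 0 0 = a at *
    generalize hc : x 1 0 = c at *
    have hs := Subgroup.mem_zpowers gs
    interval_cases a <;> interval_cases c <;> try (norm_num at e1)
    · have : x = -1 := by apply gam_ext <;> simp [*]
      rw [this]; exact neg_mem_s
    · have : x = -gs := by apply gam_ext <;> simp [*, gs_ent]
      rw [this, show -gs = gs ^ 3 by decide]; exact Subgroup.pow_mem _ hs 3
    · have : x = gs := by apply gam_ext <;> simp [*, gs_ent]
      rw [this]; exact hs
    · have : x = 1 := by apply gam_ext <;> simp [*]
      rw [this]; exact Subgroup.one_mem _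
  · right; exact ⟨gs, Subgroup.mem_zpowers _, by rw [dt_gs]; linarith⟩

lemma t_b2 (x : Gam) : ∀ b ∈ Subgroup.zpowers gs, levA x < levB x → levA (x * b) < levB (x * b) →
    b ∈ Subgroup.zpowers gr := by
  intro a ha h1 h2
  rw [D_iff'] at h1 h2
  obtain ⟨k, hk, rfl⟩ := zp_mem (by norm_num) gs4 ha
  have e1 := dt_gs x
  interval_cases k
  · exact Subgroup.one_mem _
  · rw [pow_one] at h2; linarith
  · rw [gs2]; exact neg_mem_r
  · rw [show gs ^ 3 = -gs by decide, mul_neg, dt_neg] at h2; linarith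

lemma t_b3 (x : Gam) (ha : x ∈ Subgroup.zpowers gs) : levB x < levA x := by
  rw [D_iff]
  obtain ⟨k, hk, rfl⟩ := zp_mem (by norm_num) gs4 ha
  interval_cases k <;> decide

lemma t_ne (x : Gam) : levA x ≠ levB x := by unfold levA levB; omega

lemma inter_mem (x : Gam) (h1 : x ∈ Subgroup.zpowers gr) (h2 : x ∈ Subgroup.zpowers gs) :
    x ∈ Subgroup.zpowers (-1 : Gam) := by
  obtain ⟨k, hk, rfl⟩ := zp_mem (by norm_num) gs4 h2
  obtain ⟨l, hl, h⟩ := zp_mem (by norm_num) gr6 h1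
  interval_cases k
  · exact Subgroup.one_mem _
  · exfalso; revert h; interval_cases l <;> decide
  · rw [gs2]; exact Subgroup.mem_zpowers _
  · exfalso; revert h; interval_cases l <;> decide

lemma gam_uniq {M : Type*} (f : Gam → M) (fA : ∀ x, ∀ a ∈ Subgroup.zpowers gr, f (x * a) = f x)
    (fB : ∀ x, ∀ b ∈ Subgroup.zpowers gs, f (x * b) = f x) (x : Gam) : f x = f 1 :=
  tree_uniq levA levB hA_lev hB_lev t_a1 t_b1 f fA fB x

lemma gam_exists {M : Type*} [AddCommGroup M] (φ : Gam → M)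
    (hφ : ∀ x, φ (-x) = φ x) :
    ∃ f g : Gam → M, (∀ x, ∀ a ∈ Subgroup.zpowers gr, f (x * a) = f x) ∧
      (∀ x, ∀ b ∈ Subgroup.zpowers gs, g (x * b) = g x) ∧ ∀ x, φ x = f x - g x :=
  tree_exists levA levB hA_lev hB_lev t_ne t_a1 t_a2 t_b1 t_b2 t_b3 φ (by
    intro x c h1 h2
    exact inv_of_gen (g := (-1 : Gam)) (l := φ) (by intro x; rw [mul_neg, mul_one, hφ]) x c
      (inter_mem c h1 h2))

end EC

open CategoryTheory

namespace EC

/-- polynomial giving the character -/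
def chiP {R : Type*} [CommRing R] (a b c d : R) : R :=
  (1 - c^2) * (b*d + 3*(c-1)*d + c + 3) + c*(a + d - 3)

lemma chi3 : ∀ a b c d : ZMod 3, a * d - b * c = 1 → ∀ a' b' c' d' : ZMod 3, a' * d' - b' * c' = 1 →
    chiP (a*a'+b*c') (a*b'+b*d') (c*a'+d*c') (c*b'+d*d') = chiP a b c d + chiP a' b' c' d' := by
  unfold chiP
  decide +kernel

lemma chi4 : ∀ a b c d : ZMod 4, a * d - b * c = 1 → ∀ a' b' c' d' : ZMod 4, a' * d' - b' * c' = 1 →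
    chiP (a*a'+b*c') (a*b'+b*d') (c*a'+d*c') (c*b'+d*d') = chiP a b c d + chiP a' b' c' d' := by
  unfold chiP
  decide +kernel

lemma zmod12_ext : ∀ x y : ZMod 12, ZMod.castHom (show 3 ∣ 12 by norm_num) (ZMod 3) x =
    ZMod.castHom (show 3 ∣ 12 by norm_num) (ZMod 3) y →
    ZMod.castHom (show 4 ∣ 12 by norm_num) (ZMod 4) x = ZMod.castHom (show 4 ∣ 12 by norm_num) (ZMod 4) y →
    x = y := by decide +kernel

lemma map_chiP {R S : Type*} [CommRing R] [CommRing S] (f : R →+* S) (a b c d : R) :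
    f (chiP a b c d) = chiP (f a) (f b) (f c) (f d) := by
  have h3 : f 3 = 3 := map_ofNat f 3
  simp [chiP, h3]

/-- The character of order 12, for any ring mapping to `ZMod 12`. -/
def chiOf {R : Type*} [CommRing R] (φ : R →+* ZMod 12) :
    Matrix.SpecialLinearGroup (Fin 2) R →* Multiplicative (ZMod 12) where
  toFun x := Multiplicative.ofAdd (chiP (φ (x 0 0)) (φ (x 0 1)) (φ (x 1 0)) (φ (x 1 1)))
  map_one' := by
    show Multiplicative.ofAdd (chiP (φ 1) (φ 0) (φ 0) (φ 1)) = 1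
    simp [chiP]
  map_mul' x y := by
    have hx := x.2
    have hy := y.2
    rw [Matrix.det_fin_two] at hx hy
    have e : ∀ i j, (x * y) i j = x i 0 * y 0 j + x i 1 * y 1 j := by
      intro i j
      show (x.1 * y.1) i j = _
      simp [Matrix.mul_apply, Fin.sum_univ_two]
    rw [← ofAdd_add]
    congr 1
    simp only [e, map_add, map_mul]
    apply zmod12_ext
    · simp only [map_add, map_chiP, map_mul]
      apply chi3
      · simp only [← map_mul, ← map_sub]; rw [show x 0 0 * x 1 1 - x 0 1 * x 1 0 = 1 from hx, map_one, map_one]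
      · simp only [← map_mul, ← map_sub]; rw [show y 0 0 * y 1 1 - y 0 1 * y 1 0 = 1 from hy, map_one, map_one]
    · simp only [map_add, map_chiP, map_mul]
      apply chi4
      · simp only [← map_mul, ← map_sub]; rw [show x 0 0 * x 1 1 - x 0 1 * x 1 0 = 1 from hx, map_one, map_one]
      · simp only [← map_mul, ← map_sub]; rw [show y 0 0 * y 1 1 - y 0 1 * y 1 0 = 1 from hy, map_one, map_one]

lemma chiOf_apply {R : Type*} [CommRing R] (φ : R →+* ZMod 12) (x : Matrix.SpecialLinearGroup (Fin 2) R) :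
    chiOf φ x = Multiplicative.ofAdd (chiP (φ (x 0 0)) (φ (x 0 1)) (φ (x 1 0)) (φ (x 1 1))) := rfl

/-- the character of the modular group -/
def chi : Gam →* Multiplicative (ZMod 12) := chiOf (Int.castRingHom (ZMod 12))

lemma chi_gs : chi gs = Multiplicative.ofAdd 9 := by decide +kernel
lemma chi_gr : chi gr = Multiplicative.ofAdd 4 ∨ chi gr = Multiplicative.ofAdd 2 ∨ chi gr = Multiplicative.ofAdd 10 := by decide +kernel

lemma free_zp {G : Type*} [Group G] (χ : G →* Multiplicative (ZMod 12)) {g : G} {n : ℕ} (hn : n ≠ 0)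
    (h1 : g ^ n = 1) {q : ZMod 12} (hq : χ g = Multiplicative.ofAdd q)
    (h : ∀ k < n, k ≠ 0 → k • q ≠ 0) : ∀ x ∈ Subgroup.zpowers g, χ x = 1 → x = 1 := by
  intro x hx h2
  obtain ⟨k, hk, rfl⟩ := zp_mem hn h1 hx
  by_cases hk0 : k = 0
  · simp [hk0]
  · exfalso
    refine h k hk hk0 ?_
    rw [map_pow, hq, ← ofAdd_nsmul] at h2
    exact h2

lemma free_gs : ∀ x ∈ Subgroup.zpowers gs, chi x = 1 → x = 1 :=
  free_zp chi (n := 4) (by norm_num) gs4 chi_gs (by decide)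
lemma free_gr : ∀ x ∈ Subgroup.zpowers gr, chi x = 1 → x = 1 := by
  rcases chi_gr with h | h | h
  · exfalso; revert h; decide +kernel
  · exact free_zp chi (n := 6) (by norm_num) gr6 h (by decide)
  · exact free_zp chi (n := 6) (by norm_num) gr6 h (by decide)
lemma free_neg : ∀ x ∈ Subgroup.zpowers (-1 : Gam), chi x = 1 → x = 1 :=
  fun x hx => free_gs x ((Subgroup.zpowers_le.2 neg_mem_s) hx)

lemma sum_zp {G M : Type*} [Group G] [AddCommMonoid M] {g : G} {n : ℕ} (hn : orderOf g = n) (h0 : n ≠ 0)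
    [Fintype (Subgroup.zpowers g)] (F : G → M) :
    ∑ t : Subgroup.zpowers g, F t.1 = ∑ k ∈ Finset.range n, F (g ^ k) := by
  subst hn
  have hf : IsOfFinOrder g := orderOf_pos_iff.1 (Nat.pos_of_ne_zero h0)
  rw [← (finEquivZPowers hf).sum_comp, Finset.sum_range]
  rfl

lemma ord_gs : orderOf gs = 4 := by
  rw [orderOf_eq_iff (by norm_num)]
  exact ⟨gs4, by decide⟩
lemma ord_gr : orderOf gr = 6 := by
  rw [orderOf_eq_iff (by norm_num)]
  exact ⟨gr6, by decide⟩
lemma ord_neg : orderOf (-1 : Gam) = 2 := by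
  rw [orderOf_eq_iff (by norm_num)]
  exact ⟨by decide, by decide⟩

noncomputable instance fin_gs : Fintype (Subgroup.zpowers gs) :=
  Fintype.ofEquiv _ (finEquivZPowers (orderOf_pos_iff.1 (by rw [ord_gs]; norm_num)))
noncomputable instance fin_gr : Fintype (Subgroup.zpowers gr) :=
  Fintype.ofEquiv _ (finEquivZPowers (orderOf_pos_iff.1 (by rw [ord_gr]; norm_num)))
noncomputable instance fin_neg : Fintype (Subgroup.zpowers (-1 : Gam)) :=
  Fintype.ofEquiv _ (finEquivZPowers (orderOf_pos_iff.1 (by rw [ord_neg]; norm_num)))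

/-- vertices -/
abbrev VV : Type := (Gam ⧸ Subgroup.zpowers gs) ⊕ (Gam ⧸ Subgroup.zpowers gr)
/-- edges -/
abbrev EE : Type := Gam ⧸ Subgroup.zpowers (-1 : Gam)

lemma free_VV : ∀ (g : Gam) (y : VV), g • y = y → chi g = 1 → g = 1 := by
  rintro g (y | y) h
  · exact coset_free chi free_gs g y (Sum.inl_injective h)
  · exact coset_free chi free_gr g y (Sum.inr_injective h)
lemma free_EE : ∀ (g : Gam) (y : EE), g • y = y → chi g = 1 → g = 1 :=
  coset_free chi free_neg

lemma fin_VV : ∀ (y : VV) (g : Gam), g • y = y → ∃ n : ℕ, n ≠ 0 ∧ g ^ n = 1 := by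
  rintro (y | y) g h
  · exact coset_fin y g (Sum.inl_injective h)
  · exact coset_fin y g (Sum.inr_injective h)
lemma fin_EE : ∀ (y : EE) (g : Gam), g • y = y → ∃ n : ℕ, n ≠ 0 ∧ g ^ n = 1 :=
  fun y g h => coset_fin y g h

lemma stab_EE (y : EE) (g : Gam) : g • y = y → g = 1 ∨ g = -1 := by
  induction y using Quotient.inductionOn' with
  | h y =>
    intro h
    have h : ((g * y : Gam) : EE) = (y : EE) := h
    obtain ⟨k, hk, hm⟩ := zp_mem (n := 2) (by norm_num) (by decide) (QuotientGroup.eq.1 h.symm)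
    have h2 : g = y * (y⁻¹ * (g * y)) * y⁻¹ := by group
    rw [hm] at h2
    interval_cases k
    · left; rw [h2]; simp
    · right; rw [h2]; simp

variable {k G : Type} [CommRing k] [Group G]

/-- constant functions -/
def Fn.const (Y : Type) [MulAction G Y] (A : Rep.{0} k G) : A ⟶ Fn Y A :=
  mkHom (B := Fn Y A) (LinearMap.pi fun _ => LinearMap.id) (by intro g a; rfl)

lemma Fn.const_apply (Y : Type) [MulAction G Y] (A : Rep.{0} k G) (a : A.V) (y : Y) :
  ((Fn.const Y A).hom a : Y → A.V) y = a := rfl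

/-- pullback of functions -/
def Fn.pull {Y Z : Type} [MulAction G Y] [MulAction G Z] (π : Y → Z) (hπ : ∀ (g : G) y, π (g • y) = g • π y)
    (A : Rep.{0} k G) : Fn Z A ⟶ Fn Y A :=
  mkHom (A := Fn Z A) (B := Fn Y A) (LinearMap.funLeft k A.V π) (by
    intro g a; funext y
    show A.ρ g ((a : Z → A.V) (g⁻¹ • π y)) = A.ρ g ((a : Z → A.V) (π (g⁻¹ • y)))
    rw [hπ])

/-- the edge difference map -/
def dV (A : Rep.{0} k Gam) : Fn VV A ⟶ Fn EE A :=
  mkHom (A := Fn VV A) (B := Fn EE A)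
    { toFun := fun (f : VV → A.V) (y : EE) =>
        f (Sum.inl (Subgroup.quotientMapOfLE (Subgroup.zpowers_le.2 neg_mem_s) y)) -
          f (Sum.inr (Subgroup.quotientMapOfLE (Subgroup.zpowers_le.2 neg_mem_r) y))
      map_add' := fun (a b : VV → A.V) => by
        funext y
        exact add_sub_add_comm _ _ _ _
      map_smul' := fun c (a : VV → A.V) => by
        funext y
        exact (smul_sub c (a _) (a _)).symm }
    (by
      intro g a
      funext y
      induction y using Quotient.inductionOn' with
      | h y => exact (map_sub (A.ρ g) _ _).symm)

lemma dV_apply (A : Rep.{0} k Gam) (f : VV → A.V) (g : Gam) :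
    ((dV A).hom f : EE → A.V) (g : EE) =
      f (Sum.inl (g : Gam ⧸ Subgroup.zpowers gs)) - f (Sum.inr (g : Gam ⧸ Subgroup.zpowers gr)) := rfl

lemma gam_ses (A : Rep.{0} k Gam) : SES (Fn.const VV A) (dV A) where
  inj a ha := congrFun ha (Sum.inl ((1 : Gam) : Gam ⧸ Subgroup.zpowers gs))
  surj := by
    intro c
    change EE → A.V at c
    obtain ⟨f, g, hf, hg, h⟩ := gam_exists (fun x : Gam => c (x : EE)) (by
      intro x
      have : ((-x : Gam) : EE) = (x : EE) := QuotientGroup.eq.2 (by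
        rw [inv_neg, neg_mul, inv_mul_cancel]; exact Subgroup.mem_zpowers _)
      rw [this])
    refine ⟨Sum.elim (fun y => Quotient.liftOn' y (fun x => - g x) ?_)
      (fun y => Quotient.liftOn' y (fun x => - f x) ?_), ?_⟩
    · intro x y hxy
      have := hg x _ (QuotientGroup.leftRel_apply.1 hxy)
      show - g x = - g y
      rw [← this, mul_inv_cancel_left]
    · intro x y hxy
      have := hf x _ (QuotientGroup.leftRel_apply.1 hxy)
      show - f x = - f y
      rw [← this, mul_inv_cancel_left]
    · funext y
      induction y using Quotient.inductionOn' with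
      | h y =>
        show - g y - - f y = c (y : EE)
        rw [h y]
        abel
  comp a := by
    funext y
    exact sub_self _
  exact := by
    intro b hb
    change VV → A.V at b
    have h : ∀ x : Gam, b (Sum.inl (x : Gam ⧸ Subgroup.zpowers gs)) =
        b (Sum.inr (x : Gam ⧸ Subgroup.zpowers gr)) := fun x => sub_eq_zero.1 (congrFun hb (x : EE))
    have key := gam_uniq (fun x : Gam => b (Sum.inl (x : Gam ⧸ Subgroup.zpowers gs))) (by
      intro x a ha
      show b _ = b _
      rw [h, h]
      congr 2
      exact (QuotientGroup.eq.2 (by simpa using ha))) (by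
      intro x a ha
      show b _ = b _
      congr 2
      exact (QuotientGroup.eq.2 (by simpa using ha)))
    refine ⟨b (Sum.inl ((1 : Gam) : Gam ⧸ Subgroup.zpowers gs)), ?_⟩
    funext y
    rcases y with y | y
    · induction y using Quotient.inductionOn' with
      | h y => exact (key y).symm
    · induction y using Quotient.inductionOn' with
      | h y => exact (key y).symm.trans (h y)

end EC

open CategoryTheory
namespace EC

section cok
variable {k G : Type} [CommRing k] [Group G]

/-- cokernel of a morphism -/
abbrev Cok {A B : Rep.{0} k G} (f : A ⟶ B) : Rep.{0} k G :=
  Rep.quotient B (LinearMap.range f.hom.toLinearMap) (by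
    rintro g _ ⟨a, rfl⟩
    exact ⟨A.ρ g a, Rep.hom_comm_apply f g a⟩)

/-- projection to the cokernel -/
def Cok.pr {A B : Rep.{0} k G} (f : A ⟶ B) : B ⟶ Cok f := Rep.mkQ B _ _

lemma Cok.pr_surj {A B : Rep.{0} k G} (f : A ⟶ B) (c : Cok f) : ∃ b, (Cok.pr f).hom b = c :=
  Submodule.mkQ_surjective _ c

lemma Cok.pr_zero {A B : Rep.{0} k G} (f : A ⟶ B) (b : B) :
    (Cok.pr f).hom b = 0 ↔ ∃ a, f.hom a = b :=
  (Submodule.Quotient.mk_eq_zero _)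

lemma Cok.ses {A B : Rep.{0} k G} (f : A ⟶ B) (h : ∀ a, f.hom a = 0 → a = 0) : SES f (Cok.pr f) where
  inj := h
  surj := Cok.pr_surj f
  comp a := (Cok.pr_zero f _).2 ⟨a, rfl⟩
  exact _ hb := (Cok.pr_zero f _).1 hb

/-- multiplication by two -/
def two (A : Rep.{0} k G) : A ⟶ A := mkHom ((2 : k) • LinearMap.id) (by intro g a; simp)

lemma two_apply (A : Rep.{0} k G) (a : A) : (two A).hom a = a + a := two_smul k a

end cok

section VE
variable {k : Type} [CommRing k]

lemma exV (A : Rep.{0} k Gam) (a b : A.V) (ha : A.ρ gs a = a) (hb : A.ρ gr b = b) :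
    ∃ f : Inv (Fn VV A), (f.1 : VV → A.V) (Sum.inl ((1 : Gam) : Gam ⧸ Subgroup.zpowers gs)) = a ∧
      (f.1 : VV → A.V) (Sum.inr ((1 : Gam) : Gam ⧸ Subgroup.zpowers gr)) = b := by
  have ha' : ∀ g ∈ Subgroup.zpowers gs, A.ρ g a = a := by
    intro g hg
    obtain ⟨j, -, rfl⟩ := zp_mem (n := 4) (by norm_num) gs4 hg
    induction j with
    | zero => simp
    | succ j ih => rw [pow_succ, map_mul]; simp [ha]; simpa using ih (pow_mem (Subgroup.mem_zpowers _) _)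
  have hb' : ∀ g ∈ Subgroup.zpowers gr, A.ρ g b = b := by
    intro g hg
    obtain ⟨j, -, rfl⟩ := zp_mem (n := 6) (by norm_num) gr6 hg
    induction j with
    | zero => simp
    | succ j ih => rw [pow_succ, map_mul]; simp [hb]; simpa using ih (pow_mem (Subgroup.mem_zpowers _) _)
  refine ⟨⟨Sum.elim ((mkInv A a ha').1 : Gam ⧸ Subgroup.zpowers gs → A.V)
    ((mkInv A b hb').1 : Gam ⧸ Subgroup.zpowers gr → A.V), ?_⟩, ?_, ?_⟩
  · intro g
    funext y
    rcases y with y | y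
    · exact congrFun ((mkInv A a ha').2 g) y
    · exact congrFun ((mkInv A b hb').2 g) y
  · show A.ρ 1 a = a
    simp
  · show A.ρ 1 b = b
    simp

/-- restriction of an invariant function to the first orbit of vertices -/
def resL (A : Rep.{0} k Gam) (f : Inv (Fn VV A)) : Inv (Fn (Gam ⧸ Subgroup.zpowers gs) A) :=
  ⟨fun y => (f.1 : VV → A.V) (Sum.inl y), fun g => funext fun y => congrFun (f.2 g) (Sum.inl y)⟩
/-- restriction of an invariant function to the second orbit of vertices -/
def resR (A : Rep.{0} k Gam) (f : Inv (Fn VV A)) : Inv (Fn (Gam ⧸ Subgroup.zpowers gr) A) :=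
  ⟨fun y => (f.1 : VV → A.V) (Sum.inr y), fun g => funext fun y => congrFun (f.2 g) (Sum.inr y)⟩

/-- value at the first base vertex -/
def vS {A : Rep.{0} k Gam} (f : Inv (Fn VV A)) : A.V :=
  (f.1 : VV → A.V) (Sum.inl ((1 : Gam) : Gam ⧸ Subgroup.zpowers gs))
/-- value at the second base vertex -/
def vR {A : Rep.{0} k Gam} (f : Inv (Fn VV A)) : A.V :=
  (f.1 : VV → A.V) (Sum.inr ((1 : Gam) : Gam ⧸ Subgroup.zpowers gr))
/-- value at the base edge -/
def vE {A : Rep.{0} k Gam} (f : Inv (Fn EE A)) : A.V :=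
  (f.1 : EE → A.V) ((1 : Gam) : EE)

lemma vS_inv {A : Rep.{0} k Gam} (f : Inv (Fn VV A)) : A.ρ gs (vS f) = vS f :=
  inv_coset_mem A (resL A f) gs (Subgroup.mem_zpowers _)
lemma vR_inv {A : Rep.{0} k Gam} (f : Inv (Fn VV A)) : A.ρ gr (vR f) = vR f :=
  inv_coset_mem A (resR A f) gr (Subgroup.mem_zpowers _)
lemma vE_inv {A : Rep.{0} k Gam} (f : Inv (Fn EE A)) : A.ρ (-1) (vE f) = vE f :=
  inv_coset_mem A f (-1) (Subgroup.mem_zpowers _)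

lemma uV_zero (A : Rep.{0} k Gam) (m : ℕ) (f : Inv (Fn VV A)) :
    u chi (Fn VV A) (m+1) f = 0 ↔
      (∃ a, vS f = ∑ j ∈ Finset.range 4, A.ρ (gs ^ j) a) ∧
      (∃ a, vR f = ∑ j ∈ Finset.range 6, A.ρ (gr ^ j) a) := by
  rw [u_zero_nm chi free_VV]
  refine (Nm_sum chi A _).trans (and_congr ?_ ?_)
  · refine (Nm_coset chi free_gs A (resL A f)).trans (exists_congr fun a => ?_)
    rw [sum_zp ord_gs (by norm_num) (fun t => A.ρ t a)]
    rfl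
  · refine (Nm_coset chi free_gr A (resR A f)).trans (exists_congr fun a => ?_)
    rw [sum_zp ord_gr (by norm_num) (fun t => A.ρ t a)]
    rfl

lemma uE_zero (A : Rep.{0} k Gam) (m : ℕ) (f : Inv (Fn EE A)) :
    u chi (Fn EE A) (m+1) f = 0 ↔ ∃ a, vE f = a + A.ρ (-1) a := by
  rw [u_zero_nm chi free_EE]
  refine (Nm_coset chi free_neg A f).trans (exists_congr fun a => ?_)
  rw [sum_zp ord_neg (by norm_num) (fun t => A.ρ t a), Finset.sum_range_succ, Finset.sum_range_one,
    pow_zero, pow_one, map_one]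
  rfl

/-- invariant functions on edges -/
def eE (A : Rep.{0} k Gam) (h : ∀ a, A.ρ (-1) a = a) : A.V →+ Inv (Fn EE A) where
  toFun a := mkInv A a (by
    intro g hg
    obtain ⟨j, hj, rfl⟩ := zp_mem (n := 2) (by norm_num) (by decide) hg
    interval_cases j
    · simp
    · simpa using h a)
  map_zero' := by
    apply Subtype.ext; funext y
    induction y using Quotient.inductionOn' with
    | h y => exact map_zero (A.ρ y)
  map_add' a b := by
    apply Subtype.ext; funext y
    induction y using Quotient.inductionOn' with
    | h y => exact map_add (A.ρ y) a b

lemma vE_eE (A : Rep.{0} k Gam) (h : ∀ a, A.ρ (-1) a = a) (a : A.V) : vE (eE A h a) = a := by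
  show A.ρ 1 a = a
  simp

lemma eE_vE (A : Rep.{0} k Gam) (h : ∀ a, A.ρ (-1) a = a) (f : Inv (Fn EE A)) : eE A h (vE f) = f := by
  apply Subtype.ext; funext y
  induction y using Quotient.inductionOn' with
  | h y => exact (inv_coset A f y).symm

lemma vE_dV (A : Rep.{0} k Gam) (f : Inv (Fn VV A)) : vE (invMap (dV A) f) = vS f - vR f := rfl
lemma vE_sub {A : Rep.{0} k Gam} (f g : Inv (Fn EE A)) : vE (f - g) = vE f - vE g := rfl
lemma vS_sub {A : Rep.{0} k Gam} (f g : Inv (Fn VV A)) : vS (f - g) = vS f - vS g := rfl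
lemma vR_sub {A : Rep.{0} k Gam} (f g : Inv (Fn VV A)) : vR (f - g) = vR f - vR g := rfl
lemma vS_map {A B : Rep.{0} k Gam} (φ : A ⟶ B) (f : Inv (Fn VV A)) :
    vS (invMap (Fn.map VV φ) f) = φ.hom (vS f) := rfl
lemma vR_map {A B : Rep.{0} k Gam} (φ : A ⟶ B) (f : Inv (Fn VV A)) :
    vR (invMap (Fn.map VV φ) f) = φ.hom (vR f) := rfl
lemma vS_const {A : Rep.{0} k Gam} (a : Inv A) : vS (invMap (Fn.const VV A) a) = a.1 := rfl
lemma vR_const {A : Rep.{0} k Gam} (a : Inv A) : vR (invMap (Fn.const VV A) a) = a.1 := rfl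

lemma uV_surj (A : Rep.{0} k Gam) (m : ℕ) (x : groupCohomology (Fn VV A) (2*(m+1))) :
    ∃ f, u chi (Fn VV A) (m+1) f = x := u_surj chi (acyc_Fn chi free_VV A) m x
lemma uE_surj (A : Rep.{0} k Gam) (m : ℕ) (x : groupCohomology (Fn EE A) (2*(m+1))) :
    ∃ f, u chi (Fn EE A) (m+1) f = x := u_surj chi (acyc_Fn chi free_EE A) m x

lemma oddE (A : Rep.{0} k Gam) (h : ∀ a, A.ρ (-1) a = a)
    (htf : ∀ (n : ℕ) (a : A.V), n ≠ 0 → n • a = 0 → a = 0) (m : ℕ)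
    (x : groupCohomology (Fn EE A) (2*m+1)) : x = 0 :=
  odd_zero chi (acyc_Fn chi free_EE A) (H1_zero A fin_EE (by
    intro y g hg a
    rcases stab_EE y g hg with rfl | rfl
    · simp
    · exact h a) htf) m x

/-- the connecting map from coefficients to odd cohomology -/
noncomputable def rW (A : Rep.{0} k Gam) (h : ∀ a, A.ρ (-1) a = a) (m : ℕ) :
    A.V →+ groupCohomology A (2*(m+1)+1) :=
  (del (gam_ses A) (2*(m+1))).comp ((u chi (Fn EE A) (m+1)).comp (eE A h))

lemma rW_zero (A : Rep.{0} k Gam) (h : ∀ a, A.ρ (-1) a = a) (m : ℕ) (w : A.V) :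
    rW A h m w = 0 ↔ ∃ a b c : A.V, A.ρ gs a = a ∧ A.ρ gr b = b ∧ w = a - b + (c + c) := by
  refine (ex3 (gam_ses A) _ _).trans ?_
  constructor
  · rintro ⟨y, hy⟩
    obtain ⟨f, rfl⟩ := uV_surj A m y
    rw [u_nat] at hy
    have h2 : u chi (Fn EE A) (m+1) (eE A h w - invMap (dV A) f) = 0 := by
      rw [map_sub, hy]; exact sub_self _
    obtain ⟨c, hc⟩ := (uE_zero A m _).1 h2
    rw [vE_sub, vE_eE, vE_dV, h] at hc
    exact ⟨vS f, vR f, c, vS_inv f, vR_inv f, by rw [← hc]; abel⟩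
  · rintro ⟨a, b, c, ha, hb, rfl⟩
    obtain ⟨f, h1, h2⟩ := exV A a b ha hb
    refine ⟨u chi (Fn VV A) (m+1) f, ?_⟩
    rw [u_nat]
    refine sub_eq_zero.1 ?_
    refine (map_sub (u chi (Fn EE A) (m+1)) _ _).symm.trans ((uE_zero A m _).2 ⟨-c, ?_⟩)
    rw [vE_sub, vE_eE, vE_dV, h]
    show vS f - vR f - _ = _
    rw [show vS f = a from h1, show vR f = b from h2]
    abel

lemma rW_range (A : Rep.{0} k Gam) (h : ∀ a, A.ρ (-1) a = a) (m : ℕ)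
    (x : groupCohomology A (2*(m+1)+1)) :
    (∃ w, rW A h m w = x) ↔ Hm (Fn.const VV A) (2*(m+1)+1) x = 0 := by
  rw [ex1 (gam_ses A)]
  constructor
  · rintro ⟨w, rfl⟩
    exact ⟨_, rfl⟩
  · rintro ⟨y, rfl⟩
    obtain ⟨f, rfl⟩ := uE_surj A m y
    refine ⟨vE f, ?_⟩
    show del (gam_ses A) _ (u chi _ _ (eE A h (vE f))) = _
    rw [eE_vE]

lemma rW_two (A : Rep.{0} k Gam) (h : ∀ a, A.ρ (-1) a = a) (m : ℕ) (w : A.V) :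
    rW A h m w + rW A h m w = 0 := by
  rw [← map_add]
  exact (rW_zero A h m _).2 ⟨0, 0, w, map_zero _, map_zero _, by abel⟩

end VE

section Z

/-- the trivial module over the modular group -/
abbrev ZZ : Rep.{0} ℤ Gam := Rep.trivial ℤ Gam ℤ

/-- invariants of the trivial module -/
def one_inv {G : Type} [Group G] (n : ℤ) : Inv (Rep.trivial ℤ G ℤ) := ⟨n, fun _ => rfl⟩

lemma ZZ_tf (n : ℕ) (a : ℤ) : n ≠ 0 → n • a = 0 → a = 0 := by
  intro h h2
  simpa [h] using h2

lemma oddVZ (m : ℕ) (x : groupCohomology (Fn VV ZZ) (2*m+1)) : x = 0 :=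
  odd_zero chi (acyc_Fn chi free_VV ZZ) (H1_zero ZZ fin_VV (fun _ _ _ _ => rfl) ZZ_tf) m x

lemma uVZ_zero (m : ℕ) (f : Inv (Fn VV ZZ)) :
    u chi (Fn VV ZZ) (m+1) f = 0 ↔ (4:ℤ) ∣ (vS f : ℤ) ∧ (6:ℤ) ∣ (vR f : ℤ) := by
  rw [uV_zero]
  have h4 : ∀ a : ℤ, ∑ j ∈ Finset.range 4, ZZ.ρ (gs ^ j) a = 4 * a := by
    intro a
    show ∑ j ∈ Finset.range 4, a = 4 * a
    simp
  have h6 : ∀ a : ℤ, ∑ j ∈ Finset.range 6, ZZ.ρ (gr ^ j) a = 6 * a := by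
    intro a
    show ∑ j ∈ Finset.range 6, a = 6 * a
    simp
  exact and_congr (exists_congr fun a => by rw [h4]) (exists_congr fun a => by rw [h6])

lemma gamZ_even (m : ℕ) (x : groupCohomology ZZ (2*(m+1))) :
    ∃ n : ℤ, x = u chi ZZ (m+1) (one_inv n) := by
  obtain ⟨f, hf⟩ := uV_surj ZZ m (Hm (Fn.const VV ZZ) _ x)
  have h1 : u chi (Fn EE ZZ) (m+1) (invMap (dV ZZ) f) = 0 := by
    rw [← u_nat, hf]
    exact (ex2 (gam_ses ZZ) _ _).2 ⟨x, rfl⟩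
  obtain ⟨c, hc⟩ := (uE_zero ZZ m _).1 h1
  rw [vE_dV] at hc
  obtain ⟨a, ha⟩ : ∃ a : ℤ, a = vS f := ⟨_, rfl⟩
  obtain ⟨b, hb⟩ : ∃ a : ℤ, a = vR f := ⟨_, rfl⟩
  have hc' : a - b = c + c := by rw [ha, hb]; exact hc
  change ℤ at c
  refine ⟨a + 4 * c, ?_⟩
  rw [← sub_eq_zero]
  set n : ℤ := a + 4 * c with hn
  have h3 : Hm (Fn.const VV ZZ) (2*(m+1)) (x - u chi ZZ (m+1) (one_inv n)) = 0 := by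
    rw [map_sub, u_nat, ← hf, ← map_sub]
    refine (uVZ_zero m _).2 ⟨?_, ?_⟩
    · rw [vS_sub, vS_const, ← ha]
      show (4:ℤ) ∣ a - n
      omega
    · rw [vR_sub, vR_const, ← hb]
      show (6:ℤ) ∣ b - n
      omega
  obtain ⟨y, hy⟩ := (ex1 (gam_ses ZZ) (2*m+1) _).1 h3
  rw [← hy, oddE ZZ (fun _ => rfl) ZZ_tf m y]
  exact map_zero _

lemma gamZ_odd (m : ℕ) (x : groupCohomology ZZ (2*(m+1)+1)) : x = 0 := by
  obtain ⟨y, rfl⟩ := (ex1 (gam_ses ZZ) _ _).1 (oddVZ (m+1) (Hm (Fn.const VV ZZ) _ x))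
  obtain ⟨f, rfl⟩ := uE_surj ZZ m y
  refine (ex3 (gam_ses ZZ) _ _).2 ?_
  obtain ⟨F, h1, h2⟩ := exV ZZ (vE f) 0 rfl rfl
  refine ⟨u chi _ (m+1) F, ?_⟩
  rw [u_nat]
  congr 1
  rw [← eE_vE ZZ (fun _ => rfl) f, ← eE_vE ZZ (fun _ => rfl) (invMap (dV ZZ) F), vE_dV]
  congr 1
  rw [show vS F = vE f from h1, show vR F = 0 from h2, sub_zero]

end Z
end EC

open CategoryTheory
namespace EC

lemma Hm_add {k G : Type} [CommRing k] [Group G] {A B : Rep.{0} k G} (f g : A ⟶ B) (n : ℕ) (x) :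
    Hm (f + g) n x = Hm f n x + Hm g n x := by
  have h : groupCohomology.cochainsMap (MonoidHom.id G) (f + g) =
    groupCohomology.cochainsMap (MonoidHom.id G) f + groupCohomology.cochainsMap (MonoidHom.id G) g :=
    (groupCohomology.cochainsFunctor k G).map_add (f := f) (g := g)
  have h2 : groupCohomology.map (MonoidHom.id G) (f + g) n =
      groupCohomology.map (MonoidHom.id G) f n + groupCohomology.map (MonoidHom.id G) g n := by
    unfold groupCohomology.map
    rw [h]
    exact HomologicalComplex.homologyMap_add _ _ _
  show (groupCohomology.map (MonoidHom.id G) (f + g) n).hom x = _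
  rw [h2]
  rfl

/-- the properties of the finite set of points used below -/
structure PHyp (P : Type) [MulAction Gam P] (pt : P) : Prop where
  neg : ∀ x : P, (-1 : Gam) • x = x
  cusp : (gs * gr) • pt = pt
  tr : ∀ t : P, ∃ g : Gam, g • pt = t

section P
variable {P : Type} [MulAction Gam P] {pt : P}

/-- integral functions -/
abbrev MM (P : Type) [MulAction Gam P] : Rep.{0} ℤ Gam := Fn P ZZ
/-- integral functions modulo constants -/
abbrev WW (P : Type) [MulAction Gam P] : Rep.{0} ℤ Gam := Cok (Fn.const P ZZ)

/-- projection from functions to functions modulo constants -/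
def prW (P : Type) [MulAction Gam P] : MM P ⟶ WW P := Cok.pr (Fn.const P ZZ)

lemma prW_zero (f : P → ℤ) : (prW P).hom f = 0 ↔ ∃ c : ℤ, ∀ t, f t = c := by
  refine (Cok.pr_zero (Fn.const P ZZ) f).trans (exists_congr fun c => ?_)
  exact ⟨fun h t => (congrFun h t).symm, fun h => funext fun t => (h t).symm⟩

lemma prW_surj (w : WW P) : ∃ f : P → ℤ, (prW P).hom f = w := Cok.pr_surj _ w

lemma W_ses (pt : P) : SES (Fn.const P ZZ) (prW P) :=
  Cok.ses _ (fun _ ha => congrFun ha pt)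

lemma M_rho (g : Gam) (f : P → ℤ) (t : P) : ((MM P).ρ g f : P → ℤ) t = f (g⁻¹ • t) := rfl

lemma W_rho (g : Gam) (f : P → ℤ) : (WW P).ρ g ((prW P).hom f) = (prW P).hom (fun t => f (g⁻¹ • t)) := rfl

lemma M_neg (h : PHyp P pt) (a : MM P) : (MM P).ρ (-1) a = a := by
  funext t
  change P → ℤ at a
  show a ((-1 : Gam)⁻¹ • t) = a t
  rw [inv_neg, inv_one, h.neg]

lemma W_neg (h : PHyp P pt) (a : WW P) : (WW P).ρ (-1) a = a := by
  obtain ⟨f, rfl⟩ := prW_surj a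
  exact congrArg (prW P).hom (M_neg h f)

lemma W_tf (pt : P) (n : ℕ) (a : (WW P).V) (hn : n ≠ 0) (h : n • a = 0) : a = 0 := by
  obtain ⟨f, rfl⟩ := prW_surj a
  rw [← map_nsmul] at h
  obtain ⟨c, hc⟩ := (prW_zero _).1 h
  refine (prW_zero _).2 ⟨f pt, fun t => ?_⟩
  have h1 : (n : ℤ) * f t = c := by rw [← nsmul_eq_mul]; exact hc t
  have h2 : (n : ℤ) * f pt = c := by rw [← nsmul_eq_mul]; exact hc pt
  exact mul_left_cancel₀ (by exact_mod_cast hn) (h1.trans h2.symm)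

lemma H1_VM (x : groupCohomology (Fn VV (MM P)) 1) : x = 0 := by
  let a : Fn VV (MM P) ⟶ Fn (VV × P) ZZ := mkHom (A := Fn VV (MM P)) (B := Fn (VV × P) ZZ)
    { toFun := fun (f : VV → P → ℤ) (y : VV × P) => f y.1 y.2
      map_add' := fun _ _ => rfl
      map_smul' := fun _ _ => rfl } (fun _ _ => rfl)
  let b : Fn (VV × P) ZZ ⟶ Fn VV (MM P) := mkHom (A := Fn (VV × P) ZZ) (B := Fn VV (MM P))
    { toFun := fun (f : VV × P → ℤ) (y : VV) (t : P) => f (y, t)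
      map_add' := fun _ _ => rfl
      map_smul' := fun _ _ => rfl } (fun _ _ => rfl)
  have hab : a ≫ b = 𝟙 _ := rep_ext fun _ => rfl
  have h1 : Hm a 1 x = 0 := H1_zero ZZ (by
    intro y g hg
    exact fin_VV y.1 g (congrArg Prod.fst hg)) (fun _ _ _ _ => rfl) ZZ_tf _
  rw [← Hm_id _ 1 x, ← hab, Hm_comp, h1, map_zero]

lemma oddVM (m : ℕ) (x : groupCohomology (Fn VV (MM P)) (2*m+1)) : x = 0 :=
  odd_zero chi (acyc_Fn chi free_VV (MM P)) H1_VM m x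

/-- the map detecting the quotient of the odd cohomology of `WW` -/
noncomputable def theta (pt : P) (m : ℕ) :
    groupCohomology (WW P) (2*(m+1)+1) →+ groupCohomology (Fn VV ZZ) (2*(m+1+1)) :=
  (del (Fn.ses VV (W_ses pt)) (2*(m+1)+1)).comp (Hm (Fn.const VV (WW P)) (2*(m+1)+1))

lemma theta_zero' (pt : P) (m : ℕ) (x) :
    theta pt m x = 0 ↔ Hm (Fn.const VV (WW P)) (2*(m+1)+1) x = 0 := by
  constructor
  · intro hx
    obtain ⟨y, hy⟩ := (ex3 (Fn.ses VV (W_ses pt)) _ _).1 hx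
    rw [← hy, oddVM (m+1) y]
    exact map_zero _
  · intro hx
    show del (Fn.ses VV (W_ses pt)) (2*(m+1)+1) (Hm (Fn.const VV (WW P)) (2*(m+1)+1) x) = 0
    rw [hx, map_zero]

lemma theta_zero (h : PHyp P pt) (m : ℕ) (x) :
    theta pt m x = 0 ↔ ∃ w, rW (WW P) (W_neg h) m w = x :=
  (theta_zero' pt m x).trans (rW_range _ _ _ _).symm

lemma M_sum {P : Type} (s : Finset ℕ) (F : ℕ → P → ℤ) (t : P) :
    (∑ j ∈ s, F j) t = ∑ j ∈ s, F j t := Finset.sum_apply t _ _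

lemma theta_range (h : PHyp P pt) (m : ℕ) (f : Inv (Fn VV ZZ)) :
    (∃ x, theta pt m x = u chi (Fn VV ZZ) (m+1+1) f) ↔
      (∃ F : P → ℤ, ∀ t, vS f = ∑ j ∈ Finset.range 4, F ((gs ^ j)⁻¹ • t)) ∧
      (∃ F : P → ℤ, ∀ t, vR f = ∑ j ∈ Finset.range 6, F ((gr ^ j)⁻¹ • t)) := by
  trans Hm (Fn.map VV (Fn.const P ZZ)) _ (u chi (Fn VV ZZ) (m+1+1) f) = 0
  · constructor
    · rintro ⟨x, hx⟩
      rw [← hx]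
      exact (ex1 (Fn.ses VV (W_ses pt)) _ _).2 ⟨_, rfl⟩
    · intro hx
      obtain ⟨y, hy⟩ := (ex1 (Fn.ses VV (W_ses pt)) _ _).1 hx
      obtain ⟨x, rfl⟩ := (ex2 (gam_ses (WW P)) _ y).1 (oddE (WW P) (W_neg h) (W_tf pt) (m+1) _)
      exact ⟨x, hy⟩
  · rw [u_nat, uV_zero]
    refine and_congr (exists_congr fun F => ?_) (exists_congr fun F => ?_)
    · change P → ℤ at F
      rw [vS_map]
      constructor
      · intro h1 t
        refine (congrFun h1 t).trans ?_
        exact M_sum _ _ t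
      · intro h1
        funext t
        refine (h1 t).trans ?_
        exact (M_sum (Finset.range 4) (fun j => (MM P).ρ (gs ^ j) F) t).symm
    · change P → ℤ at F
      rw [vR_map]
      constructor
      · intro h1 t
        refine (congrFun h1 t).trans ?_
        exact M_sum _ _ t
      · intro h1
        funext t
        refine (h1 t).trans ?_
        exact (M_sum (Finset.range 6) (fun j => (MM P).ρ (gr ^ j) F) t).symm

/-- functions almost invariant under the generators are constant -/
lemma two_inv (h : PHyp P pt) (φ : P → ZMod 2) (c d : ZMod 2) (hs : ∀ t, φ (gs⁻¹ • t) = φ t + c)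
    (hr : ∀ t, φ (gr⁻¹ • t) = φ t + d) (t : P) : φ t = φ pt := by
  have hd : d = 0 := by
    have h1 : φ (gr⁻¹ • gr⁻¹ • gr⁻¹ • pt) = φ pt := by
      rw [smul_smul, smul_smul, show gr⁻¹ * gr⁻¹ * gr⁻¹ = (-1 : Gam) by decide, h.neg]
    rw [hr, hr, hr] at h1
    have h2 : d + d = 0 := CharTwo.add_self_eq_zero d
    linear_combination h1 - h2
  have hr' : ∀ t, φ (gr • t) = φ t := fun t => by
    have := hr (gr • t)
    rw [inv_smul_smul, hd, add_zero] at this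
    exact this.symm
  have hc : c = 0 := by
    have h1 := hs pt
    rw [show gs⁻¹ • pt = gr • pt by rw [inv_smul_eq_iff, smul_smul, h.cusp], hr'] at h1
    simpa using h1
  have hs' : ∀ t, φ (gs • t) = φ t := fun t => by
    have := hs (gs • t)
    rw [inv_smul_smul, hc, add_zero] at this
    exact this.symm
  obtain ⟨g, rfl⟩ := h.tr t
  have key := gam_uniq (fun x : Gam => φ (x⁻¹ • pt)) ?_ ?_ g⁻¹
  · simpa using key
  · intro x a ha
    obtain ⟨j, -, hj⟩ := zp_mem (n := 6) (by norm_num) gr6 (Subgroup.inv_mem _ ha)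
    show φ _ = φ _
    rw [mul_inv_rev, hj]
    clear hj
    induction j with
    | zero => simp
    | succ j ih => rw [pow_succ', mul_assoc, mul_smul, hr', ih]
  · intro x a ha
    obtain ⟨j, -, hj⟩ := zp_mem (n := 4) (by norm_num) gs4 (Subgroup.inv_mem _ ha)
    show φ _ = φ _
    rw [mul_inv_rev, hj]
    clear hj
    induction j with
    | zero => simp
    | succ j ih => rw [pow_succ', mul_assoc, mul_smul, hs', ih]

/-- reduction of `WW` modulo two -/
abbrev W2 (P : Type) [MulAction Gam P] : Rep.{0} ℤ Gam := Cok (two (WW P))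

lemma W2_ses (pt : P) : SES (two (WW P)) (Cok.pr (two (WW P))) :=
  Cok.ses _ (fun a ha => W_tf pt 2 a (by norm_num) (by rw [two_nsmul, ← two_apply]; exact ha))

lemma W2_fix (g : Gam) (f : P → ℤ)
    (h : (W2 P).ρ g ((Cok.pr (two (WW P))).hom ((prW P).hom f)) = (Cok.pr (two (WW P))).hom ((prW P).hom f)) :
    ∃ c : ZMod 2, ∀ t, (f (g⁻¹ • t) : ZMod 2) = f t + c := by
  rw [← sub_eq_zero] at h
  have h1 : (Cok.pr (two (WW P))).hom ((prW P).hom ((fun t => f (g⁻¹ • t)) - f)) = 0 := h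
  obtain ⟨w, hw⟩ := (Cok.pr_zero _ _).1 h1
  obtain ⟨e, rfl⟩ := prW_surj w
  rw [two_apply] at hw
  have h2 : (prW P).hom (((fun t => f (g⁻¹ • t)) - f) - (e + e)) = 0 := by
    have := sub_eq_zero.2 hw.symm
    exact this
  obtain ⟨c, hc⟩ := (prW_zero _).1 h2
  refine ⟨c, fun t => ?_⟩
  have h3 : f (g⁻¹ • t) - f t - (e t + e t) = c := hc t
  have h4 : f (g⁻¹ • t) = f t + c + (e t + e t) := by linarith
  rw [h4]
  push_cast
  rw [CharTwo.add_self_eq_zero (e t : ZMod 2), add_zero]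

lemma W2_inv (h : PHyp P pt) (w : W2 P) (hs : (W2 P).ρ gs w = w) (hr : (W2 P).ρ gr w = w) : w = 0 := by
  obtain ⟨v, rfl⟩ := Cok.pr_surj _ w
  obtain ⟨f, rfl⟩ := prW_surj v
  obtain ⟨c, hc⟩ := W2_fix gs f hs
  obtain ⟨d, hd⟩ := W2_fix gr f hr
  have key := two_inv h (fun t => (f t : ZMod 2)) c d hc hd
  have h2 : ∀ t, ∃ e : ℤ, f t - f pt = e + e := by
    intro t
    have h1 := (ZMod.intCast_eq_intCast_iff_dvd_sub _ _ 2).1 (key t).symm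
    obtain ⟨e, he⟩ := h1
    refine ⟨e, ?_⟩
    rw [he]
    push_cast
    ring
  choose e he using h2
  refine (Cok.pr_zero _ _).2 ⟨(prW P).hom e, ?_⟩
  rw [two_apply]
  refine sub_eq_zero.1 ?_
  have h3 : (prW P).hom (e + e - f) = 0 := by
    refine (prW_zero _).2 ⟨- f pt, fun t => ?_⟩
    show e t + e t - f t = _
    rw [← he]
    ring
  exact h3

lemma theta_tors (h : PHyp P pt) (m : ℕ) (x : groupCohomology (WW P) (2*(m+1)+1)) (hx : x + x = 0) :
    theta pt m x = 0 := by
  rw [theta_zero']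
  have h1 : Hm (two (WW P)) (2*(m+1)+1) x = x + x := by
    have e : two (WW P) = 𝟙 (WW P) + 𝟙 (WW P) := rep_ext fun a => two_apply (WW P) a
    rw [e, Hm_add, Hm_id]
  rw [hx] at h1
  obtain ⟨z, rfl⟩ := (ex1 (W2_ses pt) _ _).1 h1
  rw [del_nat (W2_ses pt) (Fn.ses VV (W2_ses pt)) (Fn.const VV (WW P)) (Fn.const VV (WW P)) (Fn.const VV (W2 P))
    (fun _ => rfl) (fun _ => rfl)]
  have h2 : Hm (Fn.const VV (W2 P)) (2*(m+1)) z = 0 := by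
    obtain ⟨f, hf⟩ := uV_surj (W2 P) m (Hm (Fn.const VV (W2 P)) _ z)
    have h3 : u chi (Fn EE (W2 P)) (m+1) (invMap (dV (W2 P)) f) = 0 := by
      rw [← u_nat, hf]
      exact (ex2 (gam_ses (W2 P)) _ _).2 ⟨z, rfl⟩
    obtain ⟨c, hc⟩ := (uE_zero _ m _).1 h3
    have hc2 : c + (W2 P).ρ (-1) c = 0 := by
      obtain ⟨v, rfl⟩ := Cok.pr_surj _ c
      have : (W2 P).ρ (-1) ((Cok.pr (two (WW P))).hom v) = (Cok.pr (two (WW P))).hom v :=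
        congrArg (Cok.pr (two (WW P))).hom (W_neg h v)
      rw [this, ← map_add]
      exact (Cok.pr_zero _ _).2 ⟨v, two_apply _ _⟩
    rw [hc2, vE_dV, sub_eq_zero] at hc
    have h5 : vR f = 0 := W2_inv h _ (by rw [← hc]; exact vS_inv f) (vR_inv f)
    rw [← hf]
    refine (uV_zero _ m f).2 ⟨⟨0, ?_⟩, ⟨0, ?_⟩⟩
    · rw [hc, h5]; simp
    · rw [h5]; simp
  rw [h2]
  exact map_zero _

end P
end EC

open CategoryTheory
namespace EC

/-- the properties of the ring `ℤ[1/p]` used below -/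
structure RHyp (R : Type) [CommRing R] (p : ℕ) (q : R) : Prop where
  pp : p.Prime
  inj : ∀ a b : ℤ, (a : R) = b → a = b
  inv : (p : R) * q = 1
  den : ∀ r : R, ∃ (n : ℕ) (z : ℤ), (p : R) ^ n * r = z

section
variable {R : Type} [CommRing R] {p : ℕ} {q : R}

/-- the group -/
abbrev GG (R : Type) [CommRing R] : Type := Matrix.SpecialLinearGroup (Fin 2) R

lemma g_det (x : GG R) : x 0 0 * x 1 1 - x 0 1 * x 1 0 = 1 := by
  have := x.2
  rwa [Matrix.det_fin_two] at this

lemma g_ext {x y : GG R} (h1 : x 0 0 = y 0 0) (h2 : x 0 1 = y 0 1) (h3 : x 1 0 = y 1 0)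
    (h4 : x 1 1 = y 1 1) : x = y := by
  ext i j; fin_cases i <;> fin_cases j <;> assumption

lemma g_mul (x y : GG R) (i j : Fin 2) : (x * y) i j = x i 0 * y 0 j + x i 1 * y 1 j := by
  rw [Matrix.SpecialLinearGroup.coe_mul, Matrix.mul_apply, Fin.sum_univ_two]

/-- the standard embedding -/
def j0 (R : Type) [CommRing R] : Gam →* GG R := Matrix.SpecialLinearGroup.map (Int.castRingHom R)

lemma j0_apply (g : Gam) (i j : Fin 2) : j0 R g i j = (g i j : ℤ) := rfl

/-- the conjugate embedding, as a function -/
def j1f (h : RHyp R p q) (g : Gam) : GG R :=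
  ⟨!![((g 0 0 : ℤ) : R), p * (g 0 1 : ℤ); q * (g 1 0 : ℤ), (g 1 1 : ℤ)], by
    rw [Matrix.det_fin_two]
    have := det1 g
    have h2 := h.inv
    have h3 : ((g 0 0 * g 1 1 - g 0 1 * g 1 0 : ℤ) : R) = (1 : ℤ) := congrArg (Int.cast : ℤ → R) this
    push_cast at h3
    simp
    linear_combination h3 - (g 0 1 : R) * (g 1 0) * h2⟩

lemma j1f_00 (h : RHyp R p q) (g : Gam) : j1f h g 0 0 = (g 0 0 : ℤ) := rfl
lemma j1f_01 (h : RHyp R p q) (g : Gam) : j1f h g 0 1 = p * (g 0 1 : ℤ) := rfl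
lemma j1f_10 (h : RHyp R p q) (g : Gam) : j1f h g 1 0 = q * (g 1 0 : ℤ) := rfl
lemma j1f_11 (h : RHyp R p q) (g : Gam) : j1f h g 1 1 = (g 1 1 : ℤ) := rfl

/-- the conjugate embedding -/
def j1 (h : RHyp R p q) : Gam →* GG R where
  toFun g := j1f h g
  map_one' := by
    apply g_ext
    · rw [j1f_00]; simp
    · rw [j1f_01]; simp
    · rw [j1f_10]; simp
    · rw [j1f_11]; simp
  map_mul' x y := by
    have h2 := h.inv
    apply g_ext
    · rw [g_mul, j1f_00, j1f_00, j1f_01, j1f_00, j1f_10, g_mul]; push_cast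
      linear_combination - (x 0 1 : R) * y 1 0 * h2
    · rw [g_mul, j1f_00, j1f_01, j1f_01, j1f_01, j1f_11, g_mul]; push_cast
      ring
    · rw [g_mul, j1f_10, j1f_10, j1f_11, j1f_00, j1f_10, g_mul]; push_cast
      ring
    · rw [g_mul, j1f_10, j1f_11, j1f_11, j1f_01, j1f_11, g_mul]; push_cast
      linear_combination - (x 1 0 : R) * y 0 1 * h2

lemma j1_00 (h : RHyp R p q) (g : Gam) : j1 h g 0 0 = (g 0 0 : ℤ) := rfl
lemma j1_01 (h : RHyp R p q) (g : Gam) : j1 h g 0 1 = p * (g 0 1 : ℤ) := rfl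
lemma j1_10 (h : RHyp R p q) (g : Gam) : j1 h g 1 0 = q * (g 1 0 : ℤ) := rfl
lemma j1_11 (h : RHyp R p q) (g : Gam) : j1 h g 1 1 = (g 1 1 : ℤ) := rfl

lemma j0_inj (h : RHyp R p q) : Function.Injective (j0 R) := by
  intro x y hxy
  have : ∀ i j, x i j = y i j := fun i j => h.inj _ _ (by rw [← j0_apply, ← j0_apply, hxy])
  exact gam_ext (this _ _) (this _ _) (this _ _) (this _ _)

lemma p_cancel (h : RHyp R p q) {a b : R} (hab : (p : R) * a = p * b) : a = b := by
  have := h.inv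
  linear_combination q * hab - (a - b) * this

lemma q_cancel (h : RHyp R p q) {a b : R} (hab : q * a = q * b) : a = b := by
  have := h.inv
  linear_combination p * hab - (a - b) * this

lemma j1_inj (h : RHyp R p q) : Function.Injective (j1 h) := by
  intro x y hxy
  refine gam_ext (h.inj _ _ ?_) (h.inj _ _ (p_cancel h ?_)) (h.inj _ _ (q_cancel h ?_)) (h.inj _ _ ?_)
  · rw [← j1_00 h, hxy, j1_00]
  · rw [← j1_01 h, hxy, j1_01]
  · rw [← j1_10 h, hxy, j1_10]
  · rw [← j1_11 h, hxy, j1_11]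

lemma mk_gam (a b c d : ℤ) (h : a * d - b * c = 1) :
    ∃ y : Gam, y 0 0 = a ∧ y 0 1 = b ∧ y 1 0 = c ∧ y 1 1 = d :=
  ⟨⟨!![a, b; c, d], by rw [Matrix.det_fin_two]; exact h⟩, rfl, rfl, rfl, rfl⟩

/-- elements of the conjugate group which are integral -/
lemma j1_mem (h : RHyp R p q) (g : Gam) : (p : ℤ) ∣ g 1 0 ↔ j1 h g ∈ (j0 R).range := by
  have h2 := h.inv
  constructor
  · rintro ⟨c, hc⟩
    have hd := det1 g
    rw [hc] at hd
    obtain ⟨y, y1, y2, y3, y4⟩ := mk_gam (g 0 0) (p * g 0 1) c (g 1 1) (by linear_combination hd)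
    refine ⟨y, ?_⟩
    apply g_ext
    · rw [j0_apply, j1_00, y1]
    · rw [j0_apply, j1_01, y2]; push_cast; rfl
    · rw [j0_apply, j1_10, hc, y3]; push_cast; linear_combination - c * h2
    · rw [j0_apply, j1_11, y4]
  · rintro ⟨x, hx⟩
    refine ⟨x 1 0, h.inj _ _ ?_⟩
    have : j0 R x 1 0 = j1 h g 1 0 := by rw [hx]
    rw [j0_apply, j1_10] at this
    push_cast
    rw [this]
    linear_combination - (g 1 0 : R) * h2

lemma j0_mem (h : RHyp R p q) (g : Gam) (hg : (p : ℤ) ∣ g 0 1) : j0 R g ∈ (j1 h).range := by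
  have h2 := h.inv
  obtain ⟨c, hc⟩ := hg
  have hd := det1 g
  rw [hc] at hd
  obtain ⟨y, y1, y2, y3, y4⟩ := mk_gam (g 0 0) c (p * g 1 0) (g 1 1) (by linear_combination hd)
  refine ⟨y, ?_⟩
  apply g_ext
  · rw [j0_apply, j1_00, y1]
  · rw [j0_apply, j1_01, y2, hc]; push_cast; rfl
  · rw [j0_apply, j1_10, y3]; push_cast; linear_combination (g 1 0 : R) * h2
  · rw [j0_apply, j1_11, y4]

/-- integrality after scaling -/
def PB (p : ℕ) (x : GG R) (n : ℕ) : Prop := ∃ X : Fin 2 → Fin 2 → ℤ, ∀ i j, (p : R) ^ n * x i j = X i j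
/-- integrality after scaling, conjugated -/
def PA (p : ℕ) (x : GG R) (n : ℕ) : Prop := ∃ X : Fin 2 → Fin 2 → ℤ,
  (∀ i, (p : R) ^ n * (p * x i 0) = X i 0) ∧ (∀ i, (p : R) ^ n * x i 1 = X i 1)

lemma PB_succ {x : GG R} {n m : ℕ} (hn : n ≤ m) (h : PB p x n) : PB p x m := by
  obtain ⟨X, hX⟩ := h
  obtain ⟨k, rfl⟩ := Nat.exists_eq_add_of_le hn
  refine ⟨fun i j => p ^ k * X i j, fun i j => ?_⟩
  push_cast
  rw [← hX]; ring

lemma PA_succ {x : GG R} {n m : ℕ} (hn : n ≤ m) (h : PA p x n) : PA p x m := by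
  obtain ⟨X, hX, hX'⟩ := h
  obtain ⟨k, rfl⟩ := Nat.exists_eq_add_of_le hn
  refine ⟨fun i j => p ^ k * X i j, fun i => ?_, fun i => ?_⟩
  · push_cast
    rw [← hX]; ring
  · push_cast
    rw [← hX']; ring

lemma PB_ex (h : RHyp R p q) (x : GG R) : ∃ n, PB p x n := by
  have h1 : ∀ i j, ∃ n, ∀ m ≥ n, ∃ z : ℤ, (p : R) ^ m * x i j = z := by
    intro i j
    obtain ⟨n, z, hz⟩ := h.den (x i j)
    refine ⟨n, fun m hm => ?_⟩
    obtain ⟨k, rfl⟩ := Nat.exists_eq_add_of_le hm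
    refine ⟨p ^ k * z, ?_⟩
    push_cast
    rw [← hz]; ring
  choose n hn using h1
  have h2 : ∀ i j, n i j ≤ ∑ i, ∑ j, n i j := by
    intro i j
    exact (Finset.single_le_sum (f := fun j => n i j) (fun _ _ => Nat.zero_le _) (Finset.mem_univ j)).trans
      (Finset.single_le_sum (f := fun i => ∑ j, n i j) (fun _ _ => Nat.zero_le _) (Finset.mem_univ i))
  choose X hX using fun i j => hn i j _ (h2 i j)
  exact ⟨_, X, hX⟩

lemma PA_ex (h : RHyp R p q) (x : GG R) : ∃ n, PA p x n := by
  obtain ⟨n, X, hX⟩ := PB_ex h x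
  refine ⟨n, fun i => ![p * X i 0, X i 1], fun i => ?_, fun i => ?_⟩
  · simp only [Matrix.cons_val_zero]; push_cast; rw [← hX]; ring
  · exact hX i 1

/-- level for the first kind of vertices -/
noncomputable def nB (p : ℕ) (x : GG R) : ℕ := sInf {n | PB p x n}
/-- level for the second kind of vertices -/
noncomputable def nA (p : ℕ) (x : GG R) : ℕ := sInf {n | PA p x n}

lemma nB_le (h : RHyp R p q) (x : GG R) (n : ℕ) : nB p x ≤ n ↔ PB p x n :=
  ⟨fun hn => PB_succ hn (Nat.sInf_mem (PB_ex h x)), fun hn => Nat.sInf_le hn⟩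
lemma nA_le (h : RHyp R p q) (x : GG R) (n : ℕ) : nA p x ≤ n ↔ PA p x n :=
  ⟨fun hn => PA_succ hn (Nat.sInf_mem (PA_ex h x)), fun hn => Nat.sInf_le hn⟩

lemma PB_mul (x : GG R) (g : Gam) (n : ℕ) (hx : PB p x n) : PB p (x * j0 R g) n := by
  obtain ⟨X, hX⟩ := hx
  refine ⟨fun i j => X i 0 * g 0 j + X i 1 * g 1 j, fun i j => ?_⟩
  push_cast
  rw [← hX, ← hX, g_mul, j0_apply, j0_apply]
  ring

lemma PA_mul (h : RHyp R p q) (x : GG R) (g : Gam) (n : ℕ) (hx : PA p x n) : PA p (x * j1 h g) n := by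
  obtain ⟨X, hX, hX'⟩ := hx
  have h2 := h.inv
  refine ⟨fun i j => X i 0 * g 0 j + X i 1 * g 1 j, fun i => ?_, fun i => ?_⟩
  · push_cast
    rw [← hX, ← hX', g_mul, j1_00, j1_10]
    linear_combination (p : R) ^ n * x i 1 * g 1 0 * h2
  · push_cast
    rw [← hX, ← hX', g_mul, j1_01, j1_11]
    ring

lemma nB_mul (h : RHyp R p q) (x b : GG R) (hb : b ∈ (j0 R).range) : nB p (x * b) = nB p x := by
  obtain ⟨g, rfl⟩ := hb
  unfold nB
  congr 1
  ext n
  refine ⟨fun hn => ?_, fun hn => PB_mul x g n hn⟩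
  have := PB_mul (x * j0 R g) g⁻¹ n hn
  rwa [map_inv, mul_inv_cancel_right] at this

lemma nA_mul (h : RHyp R p q) (x a : GG R) (ha : a ∈ (j1 h).range) : nA p (x * a) = nA p x := by
  obtain ⟨g, rfl⟩ := ha
  unfold nA
  congr 1
  ext n
  refine ⟨fun hn => ?_, fun hn => PA_mul h x g n hn⟩
  have := PA_mul h (x * j1 h g) g⁻¹ n hn
  rwa [map_inv, mul_inv_cancel_right] at this

lemma col_kill (hp : p.Prime) (a b c d : ℤ) (h : (p : ℤ) ∣ a * d - b * c) :
    ∃ g : Gam, (p : ℤ) ∣ a * g 0 0 + b * g 1 0 ∧ (p : ℤ) ∣ c * g 0 0 + d * g 1 0 := by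
  have hpi : Prime (p : ℤ) := Nat.prime_iff_prime_int.1 hp
  have key : ∀ a b c d : ℤ, (p : ℤ) ∣ a * d - b * c → ¬ (p : ℤ) ∣ a →
      ∃ g : Gam, (p : ℤ) ∣ a * g 0 0 + b * g 1 0 ∧ (p : ℤ) ∣ c * g 0 0 + d * g 1 0 := by
    intro a b c d h ha
    obtain ⟨u, v, huv⟩ := (Prime.coprime_iff_not_dvd hpi).2 ha
    refine ⟨⟨!![-(b * v), -1; 1, 0], by simp [Matrix.det_fin_two]⟩, ?_, ?_⟩
    · show (p : ℤ) ∣ a * (-(b * v)) + b * 1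
      exact ⟨b * u, by linear_combination (-b) * huv⟩
    · show (p : ℤ) ∣ c * (-(b * v)) + d * 1
      obtain ⟨e, he⟩ := h
      exact ⟨d * u + v * e, by linear_combination (-d) * huv + v * he⟩
  by_cases ha : (p : ℤ) ∣ a
  · by_cases hc : (p : ℤ) ∣ c
    · exact ⟨1, by simpa using ha, by simpa using hc⟩
    · obtain ⟨g, h1, h2⟩ := key c d a b (by obtain ⟨e, he⟩ := h; exact ⟨-e, by linear_combination -he⟩) hc
      exact ⟨g, h2, h1⟩
  · exact key a b c d h ha

lemma col_kill' (hp : p.Prime) (a b c d : ℤ) (h : (p : ℤ) ∣ a * d - b * c) :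
    ∃ g : Gam, (p : ℤ) ∣ a * g 0 1 + b * g 1 1 ∧ (p : ℤ) ∣ c * g 0 1 + d * g 1 1 := by
  obtain ⟨g, h1, h2⟩ := col_kill hp a b c d h
  refine ⟨g * gs, ?_, ?_⟩
  · rw [mul_ent, mul_ent, show gs 0 1 = -1 by decide, show gs 1 1 = 0 by decide]
    obtain ⟨e, he⟩ := h1; exact ⟨-e, by linear_combination -he⟩
  · rw [mul_ent, mul_ent, show gs 0 1 = -1 by decide, show gs 1 1 = 0 by decide]
    obtain ⟨e, he⟩ := h2; exact ⟨-e, by linear_combination -he⟩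

/-- data at a vertex of the second kind -/
lemma dataA (h : RHyp R p q) (x : GG R) : ∃ X : Fin 2 → Fin 2 → ℤ,
    (∀ i, (p : R) ^ (nA p x) * (p * x i 0) = X i 0) ∧ (∀ i, (p : R) ^ (nA p x) * x i 1 = X i 1) ∧
    (p : ℤ) ∣ X 0 0 * X 1 1 - X 0 1 * X 1 0 ∧ ¬ (∀ i j, (p : ℤ) ∣ X i j) := by
  obtain ⟨X, hX, hX'⟩ := (nA_le h x _).1 le_rfl
  have hdet : X 0 0 * X 1 1 - X 0 1 * X 1 0 = p ^ (nA p x) * p ^ (nA p x) * p := by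
    apply h.inj
    push_cast
    rw [← hX, ← hX, ← hX', ← hX']
    linear_combination (p : R) ^ (nA p x) * p ^ (nA p x) * p * g_det x
  refine ⟨X, hX, hX', ⟨_, by rw [hdet, mul_comm]⟩, fun hall => ?_⟩
  choose Y hY using hall
  cases hn : nA p x with
  | zero =>
    rw [hn, hY, hY, hY, hY] at hdet
    have hp0 : (p : ℤ) ≠ 0 := by exact_mod_cast h.pp.ne_zero
    have h1 : (p : ℤ) * (Y 0 0 * Y 1 1 - Y 0 1 * Y 1 0) = 1 := by
      apply mul_left_cancel₀ hp0
      linear_combination hdet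
    have h2 : (p : ℤ) ∣ 1 := ⟨_, h1.symm⟩
    exact (Nat.prime_iff_prime_int.1 h.pp).not_dvd_one h2
  | succ n =>
    have : nA p x ≤ n := (nA_le h x n).2 ⟨Y, fun i => p_cancel h ?_, fun i => p_cancel h ?_⟩
    · omega
    · have := hX i
      rw [hn, hY] at this
      push_cast at this
      rw [← this]; ring
    · have := hX' i
      rw [hn, hY] at this
      push_cast at this
      rw [← this]; ring

/-- data at a vertex of the first kind -/
lemma dataB (h : RHyp R p q) (x : GG R) : ∃ X : Fin 2 → Fin 2 → ℤ,
    (∀ i j, (p : R) ^ (nB p x) * x i j = X i j) ∧ (nB p x ≠ 0 →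
    (p : ℤ) ∣ X 0 0 * X 1 1 - X 0 1 * X 1 0 ∧ ¬ (∀ i j, (p : ℤ) ∣ X i j)) := by
  obtain ⟨X, hX⟩ := (nB_le h x _).1 le_rfl
  refine ⟨X, hX, fun h0 => ?_⟩
  obtain ⟨n, hn⟩ : ∃ n, nB p x = n + 1 := Nat.exists_eq_succ_of_ne_zero h0
  have hdet : X 0 0 * X 1 1 - X 0 1 * X 1 0 = p ^ (nB p x) * p ^ (nB p x) := by
    apply h.inj
    push_cast
    rw [← hX, ← hX, ← hX, ← hX]
    linear_combination (p : R) ^ (nB p x) * p ^ (nB p x) * g_det x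
  refine ⟨⟨p ^ n * p ^ n * p, by rw [hdet, hn]; ring⟩, fun hall => ?_⟩
  choose Y hY using hall
  have : nB p x ≤ n := (nB_le h x n).2 ⟨Y, fun i j => p_cancel h ?_⟩
  · omega
  · have := hX i j
    rw [hn, hY] at this
    push_cast at this
    rw [← this]; ring

lemma lt_AB (h : RHyp R p q) (x : GG R) (X : Fin 2 → Fin 2 → ℤ)
    (hX : ∀ i, (p : R) ^ (nA p x) * (p * x i 0) = X i 0) (hX' : ∀ i, (p : R) ^ (nA p x) * x i 1 = X i 1)
    (g : Gam) : nB p (x * j1 h g) ≤ nA p x ↔ ∀ i, (p : ℤ) ∣ X i 0 * g 0 0 + X i 1 * g 1 0 := by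
  have h2 := h.inv
  rw [nB_le h]
  have e0 : ∀ i, (p : R) * ((p : R) ^ (nA p x) * (x * j1 h g) i 0) = ((X i 0 * g 0 0 + X i 1 * g 1 0 : ℤ) : R) := by
    intro i
    push_cast
    rw [← hX, ← hX', g_mul, j1_00, j1_10]
    linear_combination (p : R) ^ (nA p x) * x i 1 * g 1 0 * h2
  have e1 : ∀ i, ((p : R) ^ (nA p x) * (x * j1 h g) i 1) = ((X i 0 * g 0 1 + X i 1 * g 1 1 : ℤ) : R) := by
    intro i
    push_cast
    rw [← hX, ← hX', g_mul, j1_01, j1_11]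
    ring
  constructor
  · rintro ⟨Y, hY⟩ i
    refine ⟨Y i 0, h.inj _ _ ?_⟩
    rw [← e0, hY]; push_cast; rfl
  · intro hd
    choose Z hZ using hd
    refine ⟨fun i => ![Z i, X i 0 * g 0 1 + X i 1 * g 1 1], fun i j => ?_⟩
    fin_cases j
    · apply p_cancel h
      refine (e0 i).trans ?_
      rw [hZ]; push_cast; rfl
    · exact e1 i

lemma lt_BA (h : RHyp R p q) (x : GG R) (X : Fin 2 → Fin 2 → ℤ)
    (hX : ∀ i j, (p : R) ^ (nB p x) * x i j = X i j) (h0 : nB p x ≠ 0)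
    (g : Gam) : nA p (x * j0 R g) < nB p x ↔ ∀ i, (p : ℤ) ∣ X i 0 * g 0 1 + X i 1 * g 1 1 := by
  obtain ⟨n, hn⟩ : ∃ n, nB p x = n + 1 := Nat.exists_eq_succ_of_ne_zero h0
  rw [hn, Nat.lt_succ_iff, nA_le h]
  have e0 : ∀ i, (p : R) ^ n * (p * (x * j0 R g) i 0) = ((X i 0 * g 0 0 + X i 1 * g 1 0 : ℤ) : R) := by
    intro i
    push_cast
    rw [← hX, ← hX, g_mul, j0_apply, j0_apply, hn]
    ring
  have e1 : ∀ i, p * ((p : R) ^ n * (x * j0 R g) i 1) = ((X i 0 * g 0 1 + X i 1 * g 1 1 : ℤ) : R) := by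
    intro i
    push_cast
    rw [← hX, ← hX, g_mul, j0_apply, j0_apply, hn]
    ring
  constructor
  · rintro ⟨Y, hY, hY'⟩ i
    refine ⟨Y i 1, h.inj _ _ ?_⟩
    rw [← e1, hY']; push_cast; rfl
  · intro hd
    choose Z hZ using hd
    refine ⟨fun i => ![X i 0 * g 0 0 + X i 1 * g 1 0, Z i], e0, fun i => ?_⟩
    apply p_cancel h
    refine (e1 i).trans ?_
    rw [hZ]; push_cast; rfl

lemma g_a1 (h : RHyp R p q) (x : GG R) : ∃ a ∈ (j1 h).range, nB p (x * a) ≤ nA p (x * a) := by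
  obtain ⟨X, hX, hX', hd, -⟩ := dataA h x
  obtain ⟨g, h1, h2⟩ := col_kill h.pp _ _ _ _ hd
  refine ⟨j1 h g, ⟨g, rfl⟩, ?_⟩
  rw [nA_mul h _ _ ⟨g, rfl⟩, lt_AB h x X hX hX']
  intro i
  fin_cases i
  · exact h1
  · exact h2

lemma g_a2 (h : RHyp R p q) (x a : GG R) (ha : a ∈ (j1 h).range) (h1 : nB p x ≤ nA p x)
    (h2 : nB p (x * a) ≤ nA p (x * a)) : a ∈ (j0 R).range := by
  obtain ⟨g, rfl⟩ := ha
  obtain ⟨X, hX, hX', -, hn⟩ := dataA h x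
  rw [nA_mul h _ _ ⟨g, rfl⟩, lt_AB h x X hX hX'] at h2
  have h1' : nB p (x * j1 h 1) ≤ nA p x := by simpa using h1
  rw [lt_AB h x X hX hX'] at h1'
  have hpi : Prime (p : ℤ) := Nat.prime_iff_prime_int.1 h.pp
  have hc : ∀ i, (p : ℤ) ∣ X i 0 := fun i => by simpa using h1' i
  rw [← j1_mem]
  by_contra hg
  apply hn
  have hc' : ∀ i, (p : ℤ) ∣ X i 1 := fun i => by
    have := (Int.dvd_iff_dvd_of_dvd_add (h2 i)).1 (dvd_mul_of_dvd_left (hc i) _)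
    exact (hpi.dvd_or_dvd this).resolve_right hg
  intro i j
  fin_cases j
  · exact hc i
  · exact hc' i

lemma g_b1 (h : RHyp R p q) (x : GG R) : x ∈ (j0 R).range ∨ ∃ b ∈ (j0 R).range, nA p (x * b) < nB p (x * b) := by
  obtain ⟨X, hX, hX'⟩ := dataB h x
  by_cases h0 : nB p x = 0
  · left
    rw [h0] at hX
    have hX : ∀ i j, x i j = X i j := fun i j => by simpa using hX i j
    obtain ⟨y, y1, y2, y3, y4⟩ := mk_gam (X 0 0) (X 0 1) (X 1 0) (X 1 1) (by
      apply h.inj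
      have := g_det x
      rw [hX, hX, hX, hX] at this
      simpa using this)
    refine ⟨y, ?_⟩
    apply g_ext <;> rw [hX, j0_apply]
    · rw [y1]
    · rw [y2]
    · rw [y3]
    · rw [y4]
  · right
    obtain ⟨hd, -⟩ := hX' h0
    obtain ⟨g, h1, h2⟩ := col_kill' h.pp _ _ _ _ hd
    refine ⟨j0 R g, ⟨g, rfl⟩, ?_⟩
    rw [nB_mul h _ _ ⟨g, rfl⟩, lt_BA h x X hX h0]
    intro i
    fin_cases i
    · exact h1
    · exact h2

lemma g_b2 (h : RHyp R p q) (x b : GG R) (hb : b ∈ (j0 R).range) (h1 : nA p x < nB p x)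
    (h2 : nA p (x * b) < nB p (x * b)) : b ∈ (j1 h).range := by
  obtain ⟨g, rfl⟩ := hb
  have h0 : nB p x ≠ 0 := by omega
  obtain ⟨X, hX, hX'⟩ := dataB h x
  obtain ⟨-, hn⟩ := hX' h0
  rw [nB_mul h _ _ ⟨g, rfl⟩, lt_BA h x X hX h0] at h2
  have h1' : nA p (x * j0 R 1) < nB p x := by simpa using h1
  rw [lt_BA h x X hX h0] at h1'
  have hpi : Prime (p : ℤ) := Nat.prime_iff_prime_int.1 h.pp
  have hc : ∀ i, (p : ℤ) ∣ X i 1 := fun i => by simpa using h1' i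
  apply j0_mem
  by_contra hg
  apply hn
  have hc' : ∀ i, (p : ℤ) ∣ X i 0 := fun i => by
    have := (Int.dvd_iff_dvd_of_dvd_add (by rw [add_comm]; exact h2 i)).1 (dvd_mul_of_dvd_left (hc i) _)
    exact (hpi.dvd_or_dvd this).resolve_right hg
  intro i j
  fin_cases j
  · exact hc' i
  · exact hc i

lemma g_b3 (h : RHyp R p q) (x : GG R) (hx : x ∈ (j0 R).range) : nB p x = 0 := by
  rw [← Nat.le_zero, nB_le h]
  obtain ⟨g, rfl⟩ := hx
  exact ⟨fun i j => g i j, fun i j => by simp [j0_apply]⟩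

lemma G_uniq (h : RHyp R p q) {M : Type*} (f : GG R → M) (fA : ∀ x g, f (x * j1 h g) = f x)
    (fB : ∀ x g, f (x * j0 R g) = f x) (x : GG R) : f x = f 1 :=
  tree_uniq (A := (j1 h).range) (B := (j0 R).range) (fun x => 2 * nA p x + 1) (fun x => 2 * nB p x)
    (fun x a ha => by simp only [nA_mul h x a ha]) (fun x b hb => by simp only [nB_mul h x b hb])
    (fun x => by
      obtain ⟨a, ha, h1⟩ := g_a1 h x
      exact ⟨a, ha, by omega⟩)
    (fun x => (g_b1 h x).imp_right (by
      rintro ⟨b, hb, h1⟩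
      exact ⟨b, hb, by omega⟩)) f
    (by rintro x _ ⟨g, rfl⟩; exact fA x g) (by rintro x _ ⟨g, rfl⟩; exact fB x g) x

lemma G_exists (h : RHyp R p q) {M : Type*} [AddCommGroup M] (φ : GG R → M)
    (hφ : ∀ x (g : Gam), (p : ℤ) ∣ g 1 0 → φ (x * j1 h g) = φ x) :
    ∃ f g : GG R → M, (∀ x a, f (x * j1 h a) = f x) ∧ (∀ x b, g (x * j0 R b) = g x) ∧
      ∀ x, φ x = f x - g x := by
  obtain ⟨f, g, h1, h2, h3⟩ := tree_exists (A := (j1 h).range) (B := (j0 R).range)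
    (fun x => 2 * nA p x + 1) (fun x => 2 * nB p x)
    (fun x a ha => by simp only [nA_mul h x a ha]) (fun x b hb => by simp only [nB_mul h x b hb])
    (fun x => by omega)
    (fun x => by
      obtain ⟨a, ha, h1⟩ := g_a1 h x
      exact ⟨a, ha, by omega⟩)
    (fun x a ha h1 h2 => g_a2 h x a ha (by omega) (by omega))
    (fun x => (g_b1 h x).imp_right (by
      rintro ⟨b, hb, h1⟩
      exact ⟨b, hb, by omega⟩))
    (fun x b hb h1 h2 => g_b2 h x b hb (by omega) (by omega))
    (fun x hx => by have := g_b3 h x hx; omega) φ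
    (by
      rintro x _ ⟨g, rfl⟩ hg
      exact hφ x g ((j1_mem h g).2 hg))
  exact ⟨f, g, fun x a => h1 x _ ⟨a, rfl⟩, fun x b => h2 x _ ⟨b, rfl⟩, h3⟩

end
end EC

open CategoryTheory
namespace EC

section co
variable {k Γ G : Type} [CommRing k] [Group Γ] [Group G]

/-- coinduction along a homomorphism -/
noncomputable abbrev Co (j : Γ →* G) (A : Rep.{0} k Γ) : Rep.{0} k G := Rep.coind j A

lemma Co_ext {j : Γ →* G} {A : Rep.{0} k Γ} {f g : Co j A} (h : ∀ x, f.1 x = g.1 x) : f = g :=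
  Subtype.ext (funext h)

/-- Shapiro for an injective homomorphism -/
lemma co_iso (j : Γ →* G) (hj : Function.Injective j) (A : Rep.{0} k Γ) (n : ℕ) :
    Nonempty (groupCohomology (Co j A) n ≃+ groupCohomology A n) := by
  let e : Γ ≃* j.range := MonoidHom.ofInjective hj
  have he : ∀ x, (e x : G) = j x := fun x => rfl
  let A' : Rep.{0} k j.range := Rep.of (X := A.V) (A.ρ.comp e.symm.toMonoidHom)
  let a : Co j A ⟶ Rep.coind j.range.subtype A' := mkHom (B := Rep.coind j.range.subtype A')
    { toFun := fun f => ⟨f.1, by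
        intro s h
        have := f.2 (e.symm s) h
        rw [← he, e.apply_symm_apply] at this
        exact this⟩
      map_add' := fun _ _ => rfl
      map_smul' := fun _ _ => rfl } (fun _ _ => rfl)
  let b : Rep.coind j.range.subtype A' ⟶ Co j A := mkHom (A := Rep.coind j.range.subtype A')
    { toFun := fun f => ⟨f.1, by
        intro s h
        have := f.2 (e s) h
        refine this.trans ?_
        show A.ρ (e.symm (e s)) _ = _
        rw [e.symm_apply_apply]⟩
      map_add' := fun _ _ => rfl
      map_smul' := fun _ _ => rfl } (fun _ _ => rfl)
  have hab : a ≫ b = 𝟙 _ := rep_ext fun _ => rfl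
  have hba : b ≫ a = 𝟙 _ := rep_ext fun _ => rfl
  have e1 : groupCohomology (Co j A) n ≃+ groupCohomology (Rep.coind j.range.subtype A') n :=
    { Hm a n with
      invFun := Hm b n
      left_inv := fun x => by
        show Hm b n (Hm a n x) = x
        rw [← Hm_comp, hab, Hm_id]
      right_inv := fun x => by
        show Hm a n (Hm b n x) = x
        rw [← Hm_comp, hba, Hm_id] }
  have e2 : groupCohomology (Rep.coind j.range.subtype A') n ≃+ groupCohomology A' n :=
    (groupCohomology.coindIso A' n).toLinearEquiv.toAddEquiv
  have e3 : groupCohomology A n ≃+ groupCohomology A' n :=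
    (groupCohomology.mapIso (A := A') (B := A) e (LinearEquiv.refl k A.V) (by
      intro g
      apply LinearMap.ext; intro x
      show A.ρ g x = A.ρ (e.symm (e g)) x
      rw [e.symm_apply_apply]) n).toLinearEquiv.toAddEquiv
  exact ⟨(e1.trans e2).trans e3.symm⟩

end co

section main
variable {R : Type} [CommRing R] {p : ℕ} {q : R} {P : Type} [MulAction Gam P] {pt : P}

/-- trivial representation of the big group -/
abbrev ZG (R : Type) [CommRing R] : Rep.{0} ℤ (GG R) := Rep.trivial ℤ (GG R) ℤ

lemma co_inv (f : Co (j0 R) ZZ) (g : Gam) (x : GG R) : f.1 (j0 R g * x) = f.1 x := f.2 g x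

/-- constants into coinduced -/
noncomputable def cG (R : Type) [CommRing R] : ZG R ⟶ Co (j0 R) ZZ :=
  mkHom (A := ZG R) (B := Co (j0 R) ZZ)
    { toFun := fun (c : ℤ) => ⟨fun _ => c, fun _ _ => rfl⟩
      map_add' := fun _ _ => rfl
      map_smul' := fun _ _ => rfl } (fun _ _ => rfl)

lemma cG_apply (c : ℤ) (x : GG R) : ((cG R).hom c).1 x = c := rfl

/-- the family of functions on `P` -/
noncomputable def Pf (h : RHyp R p q) (hP : PHyp P pt) (f : Co (j0 R) ZZ) (x : GG R) : P → ℤ :=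
  fun t => f.1 ((j1 h (hP.tr t).choose)⁻¹ * x)

lemma Pf_eval (h : RHyp R p q) (hP : PHyp P pt) (hst : ∀ g : Gam, g • pt = pt ↔ (p : ℤ) ∣ g 1 0)
    (f : Co (j0 R) ZZ) (x : GG R) (g : Gam) : Pf h hP f x (g • pt) = f.1 ((j1 h g)⁻¹ * x) := by
  unfold Pf
  set g' := (hP.tr (g • pt)).choose
  have h1 : g' • pt = g • pt := (hP.tr (g • pt)).choose_spec
  have h2 : (g⁻¹ * g') • pt = pt := by rw [mul_smul, h1, inv_smul_smul]
  obtain ⟨y, hy⟩ := (j1_mem h _).1 ((hst _).1 h2)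
  have h3 : (j1 h g)⁻¹ = j0 R y * (j1 h g')⁻¹ := by rw [hy]; simp
  rw [h3, mul_assoc, co_inv]

lemma Pf_equi (h : RHyp R p q) (hP : PHyp P pt) (hst : ∀ g : Gam, g • pt = pt ↔ (p : ℤ) ∣ g 1 0)
    (f : Co (j0 R) ZZ) (g : Gam) (x : GG R) :
    (prW P).hom (Pf h hP f (j1 h g * x)) = (WW P).ρ g ((prW P).hom (Pf h hP f x)) := by
  refine Eq.trans ?_ (W_rho g _).symm
  have : Pf h hP f (j1 h g * x) = fun t => Pf h hP f x (g⁻¹ • t) := by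
    funext t
    obtain ⟨γ, rfl⟩ := hP.tr t
    rw [← mul_smul, Pf_eval h hP hst, Pf_eval h hP hst]
    simp [mul_assoc]
  rw [this]

/-- the second map, as a linear map -/
noncomputable def dGl (h : RHyp R p q) (hP : PHyp P pt) (hst : ∀ g : Gam, g • pt = pt ↔ (p : ℤ) ∣ g 1 0) :
    (Co (j0 R) ZZ).V →ₗ[ℤ] (Co (j1 h) (WW P)).V where
  toFun := fun f => ⟨fun x => (prW P).hom (Pf h hP f x), Pf_equi h hP hst f⟩
  map_add' := fun f g => Subtype.ext (funext fun x =>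
    ((prW P).hom).toLinearMap.map_add (Pf h hP f x) (Pf h hP g x))
  map_smul' := fun c f => Subtype.ext (funext fun x =>
    ((prW P).hom).toLinearMap.map_smul c (Pf h hP f x))

/-- the second map -/
noncomputable def dG (h : RHyp R p q) (hP : PHyp P pt) (hst : ∀ g : Gam, g • pt = pt ↔ (p : ℤ) ∣ g 1 0) :
    Co (j0 R) ZZ ⟶ Co (j1 h) (WW P) :=
  mkHom (A := Co (j0 R) ZZ) (B := Co (j1 h) (WW P)) (dGl h hP hst) (by
    intro g f
    apply Co_ext
    intro x
    show (prW P).hom (Pf h hP _ x) = (prW P).hom (Pf h hP f (x * g))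
    have : Pf h hP ((Co (j0 R) ZZ).ρ g f) x = Pf h hP f (x * g) := by
      funext t
      show f.1 (_ * x * g) = f.1 (_ * (x * g))
      rw [mul_assoc]
    exact congrArg (prW P).hom this)

lemma dG_apply (h : RHyp R p q) (hP : PHyp P pt) (hst : ∀ g : Gam, g • pt = pt ↔ (p : ℤ) ∣ g 1 0)
    (f : Co (j0 R) ZZ) (x : GG R) : ((dG h hP hst).hom f).1 x = (prW P).hom (Pf h hP f x) := rfl

lemma lift_W (h : RHyp R p q) (Ψ : Co (j1 h) (WW P)) : ∃ M : GG R → P → ℤ,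
    (∀ x, (prW P).hom (M x) = Ψ.1 x) ∧ ∀ g x t, M (j1 h g * x) t = M x (g⁻¹ • t) := by
  let r : GG R → GG R := fun x => (Quotient.mk (QuotientGroup.rightRel (j1 h).range) x).out
  have hr : ∀ x, ∃ s : Gam, j1 h s * r x = x := by
    intro x
    have := Quotient.mk_out (s := QuotientGroup.rightRel (j1 h).range) x
    obtain ⟨s, hs⟩ := QuotientGroup.rightRel_apply.1 this
    exact ⟨s, by rw [hs]; simp [r]⟩
  have hr2 : ∀ g x, r (j1 h g * x) = r x := by
    intro g x
    simp only [r]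
    congr 1
    apply Quotient.sound
    exact QuotientGroup.rightRel_apply.2 ⟨g⁻¹, by simp⟩
  choose s hs using hr
  have hs2 : ∀ g x, s (j1 h g * x) = g * s x := by
    intro g x
    apply j1_inj h
    have h1 := hs (j1 h g * x)
    rw [hr2] at h1
    apply mul_right_cancel (b := r x)
    rw [h1, map_mul, mul_assoc, hs]
  choose m hm using fun x => prW_surj (Ψ.1 x)
  refine ⟨fun x t => m (r x) ((s x)⁻¹ • t), fun x => ?_, fun g x t => ?_⟩
  · refine (W_rho (s x) (m (r x))).symm.trans ?_
    rw [hm]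
    have := Ψ.2 (s x) (r x)
    rw [hs] at this
    exact this.symm
  · simp only [hr2, hs2, mul_inv_rev, mul_smul]

lemma G_ses (h : RHyp R p q) (hP : PHyp P pt) (hst : ∀ g : Gam, g • pt = pt ↔ (p : ℤ) ∣ g 1 0) :
    SES (cG R) (dG h hP hst) where
  inj a ha := congrFun (congrArg Subtype.val ha) 1
  comp a := by
    apply Co_ext
    intro x
    exact (prW_zero _).2 ⟨a, fun t => rfl⟩
  exact f hf := by
    refine ⟨f.1 1, ?_⟩
    apply Co_ext
    intro x
    have h0 : ∀ (x : GG R) (g : Gam), f.1 ((j1 h g)⁻¹ * x) = f.1 x := by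
      intro x g
      have h1 : (prW P).hom (Pf h hP f x) = 0 := congrFun (congrArg Subtype.val hf) x
      obtain ⟨c, hc⟩ := (prW_zero _).1 h1
      have h2 := hc (g • pt)
      have h3 := hc ((1 : Gam) • pt)
      rw [Pf_eval h hP hst] at h2 h3
      rw [h2, ← h3]
      simp
    have := G_uniq h (fun x => f.1 x⁻¹) (fun x g => by
      show f.1 _ = f.1 _
      rw [mul_inv_rev, h0]) (fun x g => by
      show f.1 _ = f.1 _
      rw [mul_inv_rev, ← map_inv, co_inv]) x⁻¹
    simp only [inv_inv, inv_one] at this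
    exact this.symm
  surj Ψ := by
    obtain ⟨M, hM1, hM2⟩ := lift_W h Ψ
    obtain ⟨f', g', h1, h2, h3⟩ := G_exists h (fun x => M x⁻¹ pt) (fun x g hg => by
      show M (x * j1 h g)⁻¹ pt = M x⁻¹ pt
      rw [mul_inv_rev, ← map_inv, hM2, inv_inv, (hst g).2 hg])
    refine ⟨⟨fun x => - g' x⁻¹, fun g x => ?_⟩, ?_⟩
    · show - g' (j0 R g * x)⁻¹ = - g' x⁻¹
      rw [mul_inv_rev, ← map_inv, h2]
    · apply Co_ext
      intro x
      refine Eq.trans ?_ (hM1 x)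
      rw [dG_apply, ← sub_eq_zero, ← map_sub]
      refine (prW_zero _).2 ⟨- f' x⁻¹, fun t => ?_⟩
      obtain ⟨γ, rfl⟩ := hP.tr t
      show Pf h hP _ x (γ • pt) - M x (γ • pt) = _
      rw [Pf_eval h hP hst]
      show - g' ((j1 h γ)⁻¹ * x)⁻¹ - _ = _
      have h4 := h3 (x⁻¹ * j1 h γ)
      rw [h1, mul_inv_rev, inv_inv, ← map_inv, hM2, inv_inv] at h4
      rw [mul_inv_rev, inv_inv]
      linarith

end main
end EC

open CategoryTheory
namespace EC

lemma one_inv_smul {G : Type} [Group G] (n : ℤ) : (n • one_inv 1 : Inv (Rep.trivial ℤ G ℤ)) = one_inv n := by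
  apply Subtype.ext
  show n • (1 : ℤ) = n
  simp

lemma u_twelve {G : Type} [Group G] (χ : G →* Multiplicative (ZMod 12)) (m : ℕ) :
    u χ (Rep.trivial ℤ G ℤ) (m+1) (one_inv 12) = 0 := by
  let f : Inv (Per χ (Rep.trivial ℤ G ℤ)) := ⟨(fun _ => (1 : ℤ) : ZMod 12 → ℤ), fun g => rfl⟩
  have : invMap (psum χ (Rep.trivial ℤ G ℤ)) f = one_inv 12 := by
    apply Subtype.ext
    show ∑ q : ZMod 12, (1 : ℤ) = 12
    simp [ZMod.card]
  rw [← this, u_psum]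

section main
variable {R : Type} [CommRing R] {p : ℕ} {q : R} {P : Type} [MulAction Gam P] {pt : P}

/-- restriction to a finite subgroup -/
noncomputable def resF (R : Type) [CommRing R] (S : Subgroup Gam) :
    Co (j0 R) ZZ ⟶ Fn (GG R ⧸ S.map (j0 R)) (ZG R) :=
  mkHom (A := Co (j0 R) ZZ) (B := Fn (GG R ⧸ S.map (j0 R)) (ZG R))
    { toFun := fun f => ((fun y => Quotient.liftOn' y (fun x => f.1 x⁻¹) (by
        intro x y hxy
        obtain ⟨s, hs, h⟩ := QuotientGroup.leftRel_apply.1 hxy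
        have : y⁻¹ = j0 R s⁻¹ * x⁻¹ := by rw [map_inv, h]; simp
        show f.1 x⁻¹ = f.1 y⁻¹
        rw [this, co_inv])) : GG R ⧸ S.map (j0 R) → ℤ)
      map_add' := fun a b => by
        funext y
        induction y using Quotient.inductionOn'
        rfl
      map_smul' := fun a b => by
        funext y
        induction y using Quotient.inductionOn'
        rfl } (by
    intro g a
    funext y
    induction y using Quotient.inductionOn' with
    | h y =>
    show a.1 (y⁻¹ * g) = a.1 (g⁻¹ * y)⁻¹
    rw [mul_inv_rev, inv_inv])

lemma resF_apply (S : Subgroup Gam) (f : Co (j0 R) ZZ) (x : GG R) :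
    ((resF R S).hom f : GG R ⧸ S.map (j0 R) → ℤ) (x : GG R ⧸ S.map (j0 R)) = f.1 x⁻¹ := rfl

lemma chi_j0 (φ : R →+* ZMod 12) (g : Gam) : chiOf φ (j0 R g) = chi g := by
  have : ∀ i j, φ (j0 R g i j) = Int.castRingHom (ZMod 12) (g i j) := by
    intro i j
    rw [j0_apply]; simp
  rw [chiOf_apply, this, this, this, this]
  rfl

lemma ord_dvd (h : RHyp R p q) (φ : R →+* ZMod 12) (S : Subgroup Gam) [Finite S]
    (hS : ∀ g ∈ S, chi g = 1 → g = 1) (m : ℕ) (n : ℤ)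
    (hn : Hm (cG R) (2*(m+1)) (u (chiOf φ) (ZG R) (m+1) (one_inv n)) = 0) :
    (Nat.card S : ℤ) ∣ n := by
  let S' := S.map (j0 R)
  have e : S ≃ S' := (S.equivMapOfInjective (j0 R) (j0_inj h)).toEquiv
  have : Finite S' := Finite.of_equiv _ e
  have := Fintype.ofFinite S'
  have hS' : ∀ g ∈ S', chiOf φ g = 1 → g = 1 := by
    rintro _ ⟨g, hg, rfl⟩ h1
    rw [chi_j0] at h1
    rw [hS g hg h1, map_one]
  have h1 := congrArg (Hm (resF R S) (2*(m+1))) hn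
  rw [map_zero, u_nat, u_nat, u_zero_nm (chiOf φ) (coset_free (chiOf φ) hS'),
    Nm_coset (chiOf φ) hS'] at h1
  obtain ⟨a, ha⟩ := h1
  change n = ∑ t : S', (a : ℤ) at ha
  rw [Finset.sum_const, Finset.card_univ, ← Nat.card_eq_fintype_card, ← Nat.card_congr e] at ha
  exact ⟨a, by rw [ha]; simp⟩

lemma ord_twelve (h : RHyp R p q) (φ : R →+* ZMod 12) (m : ℕ) (n : ℤ)
    (hn : Hm (cG R) (2*(m+1)) (u (chiOf φ) (ZG R) (m+1) (one_inv n)) = 0) : 12 ∣ n := by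
  have h1 := ord_dvd h φ (Subgroup.zpowers gs) free_gs m n hn
  have h2 := ord_dvd h φ (Subgroup.zpowers gr) free_gr m n hn
  rw [Nat.card_zpowers, ord_gs] at h1
  rw [Nat.card_zpowers, ord_gr] at h2
  push_cast at h1 h2
  omega

lemma cyc_gen {K : Type*} [AddCommGroup K] (k0 y : K) (h0 : ∀ x : K, ∃ n : ℤ, x = n • k0)
    (h12 : (12 : ℤ) • k0 = 0) (hy : ∀ n : ℤ, n • y = 0 → 12 ∣ n) (x : K) : ∃ n : ℤ, x = n • y := by
  obtain ⟨a, rfl⟩ := h0 y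
  have hc : IsCoprime a 12 := by
    rw [Int.isCoprime_iff_gcd_eq_one]
    obtain ⟨c, hc⟩ : (Int.gcd a 12 : ℤ) ∣ 12 := Int.gcd_dvd_right _ _
    obtain ⟨d, hd⟩ : (Int.gcd a 12 : ℤ) ∣ a := Int.gcd_dvd_left _ _
    have : (12 : ℤ) ∣ c := by
      apply hy
      rw [← mul_smul, show c * a = d * 12 by rw [hd]; linear_combination (-d) * hc, mul_smul, h12, smul_zero]
    obtain ⟨e, he⟩ := this
    have h1 : (Int.gcd a 12 : ℤ) * e = 1 := by
      have : (12 : ℤ) * (Int.gcd a 12 * e) = 12 * 1 := by linear_combination -hc - (Int.gcd a 12 : ℤ) * he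
      exact mul_left_cancel₀ (by norm_num) this
    have h2 : (Int.gcd a 12 : ℤ) = 1 := Int.eq_one_of_mul_eq_one_right (by positivity) h1
    exact_mod_cast h2
  obtain ⟨s, t, hst⟩ := hc
  obtain ⟨n, rfl⟩ := h0 x
  refine ⟨n * s, ?_⟩
  rw [← mul_smul, mul_assoc, show s * a = 1 - t * 12 by linear_combination hst, mul_sub, sub_smul, mul_one,
    ← mul_assoc, mul_smul _ (12 : ℤ), h12, smul_zero, sub_zero]

lemma split12 {H H' : Type*} [AddCommGroup H] [AddCommGroup H'] (y : H) (h12 : (12 : ℤ) • y = 0)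
    (κ : H' →+ H) (hs : ∀ x, ∃ (n : ℤ) (z : H'), x = n • y + κ z)
    (hi : ∀ (n : ℤ) (z : H'), n • y + κ z = 0 → 12 ∣ n ∧ z = 0) : Nonempty (H ≃+ ZMod 12 × H') := by
  let a : ZMod 12 →+ H := ZMod.lift 12 ⟨zmultiplesHom H y, by simpa using h12⟩
  have ha : ∀ n : ℤ, a n = n • y := fun n => by simp [a]
  let F : ZMod 12 × H' →+ H := a.coprod κ
  refine ⟨(AddEquiv.ofBijective F ⟨?_, ?_⟩).symm⟩
  · rw [injective_iff_map_eq_zero]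
    rintro ⟨n, z⟩ hn
    obtain ⟨n, rfl⟩ := ZMod.intCast_surjective n
    have : n • y + κ z = 0 := by rw [← ha]; exact hn
    obtain ⟨h1, h2⟩ := hi n z this
    have : (n : ZMod 12) = 0 := (ZMod.intCast_zmod_eq_zero_iff_dvd n 12).2 h1
    rw [this, h2]; rfl
  · intro x
    obtain ⟨n, z, rfl⟩ := hs x
    exact ⟨(n, z), by rw [← ha]; rfl⟩

theorem G_split (h : RHyp R p q) (hP : PHyp P pt) (hst : ∀ g : Gam, g • pt = pt ↔ (p : ℤ) ∣ g 1 0)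
    (φ : R →+* ZMod 12) (m : ℕ) :
    Nonempty (groupCohomology (ZG R) (2*(m+1+1)) ≃+ ZMod 12 × groupCohomology (WW P) (2*(m+1)+1)) := by
  obtain ⟨e0⟩ := co_iso (j0 R) (j0_inj h) ZZ (2*(m+1+1))
  obtain ⟨e0'⟩ := co_iso (j0 R) (j0_inj h) ZZ (2*(m+1)+1)
  obtain ⟨e1⟩ := co_iso (j1 h) (j1_inj h) (WW P) (2*(m+1)+1)
  let y : groupCohomology (ZG R) (2*(m+1+1)) := u (chiOf φ) (ZG R) (m+1+1) (one_inv 1)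
  have hy : ∀ n : ℤ, n • y = u (chiOf φ) (ZG R) (m+1+1) (one_inv n) := fun n => by
    rw [← one_inv_smul, map_zsmul]
  let κ : groupCohomology (WW P) (2*(m+1)+1) →+ groupCohomology (ZG R) (2*(m+1+1)) :=
    (del (G_ses h hP hst) (2*(m+1)+1)).comp e1.symm.toAddMonoidHom
  have hκ : ∀ z, Hm (cG R) (2*(m+1+1)) (κ z) = 0 := fun z =>
    (ex1 (G_ses h hP hst) (2*(m+1)+1) _).2 ⟨_, rfl⟩
  refine split12 y ?_ κ ?_ ?_
  · rw [hy]; exact u_twelve _ _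
  · intro x
    obtain ⟨n, hn⟩ := cyc_gen (u chi ZZ (m+1+1) (one_inv 1)) (e0 (Hm (cG R) _ y)) (fun x => by
        obtain ⟨n, hn⟩ := gamZ_even (m+1) x
        exact ⟨n, by rw [← map_zsmul, one_inv_smul]; exact hn⟩)
      (by rw [← map_zsmul, one_inv_smul]; exact u_twelve _ _)
      (fun n hn => by
        rw [← map_zsmul, ← map_zsmul] at hn
        apply ord_twelve h φ (m+1) n
        rw [← hy]
        exact e0.injective (hn.trans (map_zero e0).symm)) (e0 (Hm (cG R) _ x))
    rw [← map_zsmul, ← map_zsmul] at hn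
    have h1 : Hm (cG R) (2*(m+1)+1+1) (x - n • y) = 0 := by
      rw [map_sub, sub_eq_zero]
      exact e0.injective hn
    obtain ⟨z, hz⟩ := (ex1 (G_ses h hP hst) (2*(m+1)+1) _).1 h1
    refine ⟨n, e1 z, ?_⟩
    have : κ (e1 z) = x - n • y := by
      rw [← hz]
      exact congrArg (del (G_ses h hP hst) (2*(m+1)+1)) (e1.symm_apply_apply z)
    rw [this]; abel
  · intro n z hz
    have h1 := congrArg (Hm (cG R) (2*(m+1+1))) hz
    rw [map_add, hκ, add_zero, map_zero, hy] at h1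
    have h2 := ord_twelve h φ (m+1) n h1
    have h3 : n • y = 0 := by
      obtain ⟨c, rfl⟩ := h2
      rw [mul_comm (12 : ℤ) c, mul_smul, hy 12, u_twelve]; exact zsmul_zero c
    refine ⟨h2, ?_⟩
    rw [h3, zero_add] at hz
    obtain ⟨w, hw⟩ := (ex3 (G_ses h hP hst) (2*(m+1)+1) _).1 hz
    have hw0 : w = 0 := e0'.injective ((gamZ_odd m _).trans (map_zero e0').symm)
    rw [hw0, map_zero] at hw
    exact e1.symm.injective (hw.symm.trans (map_zero e1.symm).symm)

end main
end EC

open CategoryTheory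
namespace EC

section cnt
variable {P : Type} [MulAction Gam P] {pt : P}

/-- mod two functions invariant under an element -/
def AA (P : Type) [MulAction Gam P] (g : Gam) : Submodule (ZMod 2) (P → ZMod 2) where
  carrier := {f | ∀ t, f (g • t) = f t}
  add_mem' := by
    intro a b ha hb t
    simp only [Pi.add_apply]
    rw [ha t, hb t]
  zero_mem' := fun _ => rfl
  smul_mem' := by
    intro c a ha t
    simp only [Pi.smul_apply]
    rw [ha t]

lemma AA_mem (g : Gam) (f : P → ZMod 2) : f ∈ AA P g ↔ ∀ t, f (g • t) = f t := Iff.rfl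

lemma AA_inv (g : Gam) (f : P → ZMod 2) : f ∈ AA P g ↔ ∀ t, f (g⁻¹ • t) = f t := by
  constructor
  · intro h t
    rw [← h (g⁻¹ • t), smul_inv_smul]
  · intro h t
    rw [← h (g • t), inv_smul_smul]

lemma AA_pow (g : Gam) (f : P → ZMod 2) (h : f ∈ AA P g) (x : Subgroup.zpowers g) (t : P) :
    f (x • t) = f t := by
  obtain ⟨x, n, rfl⟩ := x
  show f (g ^ n • t) = f t
  induction n using Int.induction_on generalizing t with
  | zero => simp
  | succ n ih => rw [zpow_add_one, mul_smul, ih, h]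
  | pred n ih => rw [zpow_sub_one, mul_smul, ih, (AA_inv g f).1 h]

/-- invariant functions are functions on orbits -/
def AA_equiv (g : Gam) : AA P g ≃ₗ[ZMod 2] (MulAction.orbitRel.Quotient (Subgroup.zpowers g) P → ZMod 2) where
  toFun f := fun y => Quotient.liftOn' y f.1 (by
    rintro a b ⟨x, rfl⟩
    exact AA_pow g f.1 f.2 x b)
  invFun F := ⟨fun t => F (Quotient.mk'' t), fun t => by
    refine congrArg F (Quotient.sound' ?_)
    exact ⟨⟨g, Subgroup.mem_zpowers g⟩, rfl⟩⟩
  map_add' a b := by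
    funext y
    induction y using Quotient.inductionOn'
    rfl
  map_smul' a b := by
    funext y
    induction y using Quotient.inductionOn'
    rfl
  left_inv f := rfl
  right_inv F := by
    funext y
    induction y using Quotient.inductionOn'
    rfl

lemma AA_rank [Finite P] (g : Gam) : Module.finrank (ZMod 2) (AA P g) =
    Nat.card (MulAction.orbitRel.Quotient (Subgroup.zpowers g) P) := by
  have := Fintype.ofFinite (MulAction.orbitRel.Quotient (Subgroup.zpowers g) P)
  rw [(AA_equiv g).finrank_eq, Module.finrank_fintype_fun_eq_card, Nat.card_eq_fintype_card]

lemma burnside [Finite P] {n : ℕ} (g : Gam) [Fintype (Subgroup.zpowers g)] (hn : orderOf g = n) (h0 : n ≠ 0) :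
    ∑ k ∈ Finset.range n, Nat.card {t : P // g ^ k • t = t} = Module.finrank (ZMod 2) (AA P g) * n := by
  classical
  have := Fintype.ofFinite (MulAction.orbitRel.Quotient (Subgroup.zpowers g) P)
  have := Fintype.ofFinite P
  have h := MulAction.sum_card_fixedBy_eq_card_orbits_mul_card_group (Subgroup.zpowers g) P
  rw [AA_rank, Nat.card_eq_fintype_card]
  have hc : Fintype.card (Subgroup.zpowers g) = n := by rw [← Nat.card_eq_fintype_card, Nat.card_zpowers, hn]
  rw [hc] at h
  have h2 := sum_zp hn h0 (fun x => Nat.card {t : P // x • t = t})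
  rw [← h2]
  refine Eq.trans (Finset.sum_congr rfl fun x _ => ?_) h
  rw [← Nat.card_eq_fintype_card]
  rfl

lemma fix_congr {g g' : Gam} (h : ∀ t : P, g • t = t ↔ g' • t = t) :
    Nat.card {t : P // g • t = t} = Nat.card {t : P // g' • t = t} :=
  Nat.card_congr (Equiv.subtypeEquivRight h)


lemma cnt_gs [Finite P] (h : PHyp P pt) :
    2 * Nat.card P + 2 * Nat.card {t : P // gs • t = t} = 4 * Module.finrank (ZMod 2) (AA P gs) := by
  have hb := burnside (P := P) gs ord_gs (by norm_num)
  have e2 : ∀ t : P, gs ^ 2 • t = t := fun t => by rw [gs2]; exact h.neg t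
  have c0 : Nat.card {t : P // gs ^ 0 • t = t} = Nat.card P :=
    Nat.card_congr (Equiv.subtypeUnivEquiv fun t => by simp)
  have c2 : Nat.card {t : P // gs ^ 2 • t = t} = Nat.card P :=
    Nat.card_congr (Equiv.subtypeUnivEquiv e2)
  have c3 : Nat.card {t : P // gs ^ 3 • t = t} = Nat.card {t : P // gs • t = t} :=
    fix_congr fun t => by rw [pow_succ', mul_smul, e2]
  have c1 : Nat.card {t : P // gs ^ 1 • t = t} = Nat.card {t : P // gs • t = t} := by rw [pow_one]
  simp only [Finset.sum_range_succ, Finset.sum_range_zero] at hb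
  rw [c0, c1, c2, c3] at hb
  omega

lemma gr_fix (h : PHyp P pt) (t : P) : gr ^ 2 • t = t ↔ gr • t = t := by
  have e3 : gr ^ 3 • t = t := by rw [gr3]; exact h.neg t
  constructor
  · intro h2
    rw [pow_succ, pow_succ', mul_smul, mul_smul] at e3
    have : gr ^ 3 • t = gr • gr ^ 2 • t := by rw [pow_succ', mul_smul]
    rw [h2, gr3, h.neg] at this
    exact this.symm
  · intro h1
    rw [pow_two, mul_smul, h1, h1]

lemma cnt_gr [Finite P] (h : PHyp P pt) :
    2 * Nat.card P + 4 * Nat.card {t : P // gr • t = t} = 6 * Module.finrank (ZMod 2) (AA P gr) := by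
  have hb := burnside (P := P) gr ord_gr (by norm_num)
  have e3 : ∀ t : P, gr ^ 3 • t = t := fun t => by rw [gr3]; exact h.neg t
  have c0 : Nat.card {t : P // gr ^ 0 • t = t} = Nat.card P :=
    Nat.card_congr (Equiv.subtypeUnivEquiv fun t => by simp)
  have c3 : Nat.card {t : P // gr ^ 3 • t = t} = Nat.card P :=
    Nat.card_congr (Equiv.subtypeUnivEquiv e3)
  have c1 : Nat.card {t : P // gr ^ 1 • t = t} = Nat.card {t : P // gr • t = t} := by rw [pow_one]
  have c2 : Nat.card {t : P // gr ^ 2 • t = t} = Nat.card {t : P // gr • t = t} := fix_congr (gr_fix h)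
  have c4 : Nat.card {t : P // gr ^ 4 • t = t} = Nat.card {t : P // gr • t = t} :=
    fix_congr fun t => by rw [pow_succ', mul_smul, e3]
  have c5 : Nat.card {t : P // gr ^ 5 • t = t} = Nat.card {t : P // gr • t = t} :=
    fix_congr fun t => by rw [show 5 = 2 + 3 from rfl, pow_add, mul_smul, e3]; exact gr_fix h t
  simp only [Finset.sum_range_succ, Finset.sum_range_zero] at hb
  rw [c0, c1, c2, c3, c4, c5] at hb
  omega

lemma inf_rank (h : PHyp P pt) : Module.finrank (ZMod 2) ↥(AA P gs ⊓ AA P gr) = 1 := by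
  have e : (AA P gs ⊓ AA P gr) = Submodule.span (ZMod 2) {(fun _ => 1 : P → ZMod 2)} := by
    ext f
    rw [Submodule.mem_span_singleton]
    constructor
    · rintro ⟨h1, h2⟩
      refine ⟨f pt, ?_⟩
      funext t
      have := two_inv h f 0 0 (fun t => by rw [add_zero]; exact (AA_inv gs f).1 h1 t)
        (fun t => by rw [add_zero]; exact (AA_inv gr f).1 h2 t) t
      simp [this]
    · rintro ⟨c, rfl⟩
      exact ⟨fun _ => rfl, fun _ => rfl⟩
  rw [e]
  exact finrank_span_singleton (fun h => one_ne_zero (congrFun h pt))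

lemma quot_rank [Finite P] (h : PHyp P pt) :
    Module.finrank (ZMod 2) ((P → ZMod 2) ⧸ (AA P gs ⊔ AA P gr)) +
      Module.finrank (ZMod 2) (AA P gs) + Module.finrank (ZMod 2) (AA P gr) = Nat.card P + 1 := by
  have := Fintype.ofFinite P
  have h1 := Submodule.finrank_quotient_add_finrank (AA P gs ⊔ AA P gr)
  have h2 := Submodule.finrank_sup_add_finrank_inf_eq (AA P gs) (AA P gr)
  rw [inf_rank h] at h2
  rw [Module.finrank_fintype_fun_eq_card, ← Nat.card_eq_fintype_card] at h1
  omega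

/-- the map from integral functions -/
noncomputable def Lam (h : PHyp P pt) (m : ℕ) : (P → ℤ) →+ groupCohomology (WW P) (2*(m+1)+1) where
  toFun f := rW (WW P) (W_neg h) m ((prW P).hom f)
  map_zero' := by
    have : (prW P).hom (0 : P → ℤ) = 0 := (prW_zero _).2 ⟨0, fun _ => rfl⟩
    rw [this, map_zero]
  map_add' f g := by
    have : (prW P).hom (f + g : P → ℤ) = (prW P).hom f + (prW P).hom g := map_add (prW P).hom f g
    rw [this, map_add]

/-- reduction mod two -/
def red (P : Type) : (P → ℤ) →+ (P → ZMod 2) where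
  toFun f := fun t => (f t : ZMod 2)
  map_zero' := by funext t; simp
  map_add' f g := by funext t; simp

lemma prW_sub (f g : P → ℤ) : (prW P).hom f - (prW P).hom g = (prW P).hom (f - g : P → ℤ) :=
  (map_sub (prW P).hom f g).symm

lemma prW_add (f g : P → ℤ) : (prW P).hom f + (prW P).hom g = (prW P).hom (f + g : P → ℤ) :=
  (map_add (prW P).hom f g).symm

lemma prW_eq (f g : P → ℤ) : (prW P).hom f = (prW P).hom g ↔ ∃ c : ℤ, ∀ t, f t = g t + c := by
  rw [← sub_eq_zero, prW_sub, prW_zero]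
  refine exists_congr fun c => forall_congr' fun t => ?_
  rw [Pi.sub_apply, sub_eq_iff_eq_add']

lemma prW_inv_gs (h : PHyp P pt) (f : P → ℤ) (hf : (WW P).ρ gs ((prW P).hom f) = (prW P).hom f) (t : P) :
    f (gs⁻¹ • t) = f t := by
  rw [W_rho] at hf
  obtain ⟨c, hc⟩ := (prW_eq _ _).1 hf
  have e2 : gs⁻¹ • gs⁻¹ • t = t := by
    rw [← mul_smul, ← mul_inv_rev, ← pow_two, gs2, inv_neg, inv_one, h.neg]
  have h1 := hc t
  have h2 := hc (gs⁻¹ • t)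
  simp only [e2] at h2
  omega

lemma prW_inv_gr (h : PHyp P pt) (f : P → ℤ) (hf : (WW P).ρ gr ((prW P).hom f) = (prW P).hom f) (t : P) :
    f (gr⁻¹ • t) = f t := by
  rw [W_rho] at hf
  obtain ⟨c, hc⟩ := (prW_eq _ _).1 hf
  have e2 : gr⁻¹ • gr⁻¹ • gr⁻¹ • t = t := by
    rw [← mul_smul, ← mul_smul, ← mul_inv_rev, ← mul_inv_rev, ← pow_two, ← pow_succ', gr3, inv_neg, inv_one, h.neg]
  have h1 := hc t
  have h2 := hc (gr⁻¹ • t)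
  have h3 := hc (gr⁻¹ • gr⁻¹ • t)
  simp only [e2] at h3
  omega

lemma val_cast (a : ZMod 2) : (((a.val : ℕ) : ℤ) : ZMod 2) = a := by
  rw [Int.cast_natCast, ZMod.natCast_val, ZMod.cast_id]

lemma Lam_zero (h : PHyp P pt) (m : ℕ) (f : P → ℤ) :
    Lam h m f = 0 ↔ red P f ∈ AA P gs ⊔ AA P gr := by
  refine (rW_zero (WW P) (W_neg h) m ((prW P).hom f)).trans ?_
  constructor
  · rintro ⟨a, b, c, ha, hb, hw⟩
    obtain ⟨α, rfl⟩ := prW_surj a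
    obtain ⟨β, rfl⟩ := prW_surj b
    obtain ⟨γ, rfl⟩ := prW_surj c
    rw [prW_sub, prW_add, prW_add, prW_eq] at hw
    obtain ⟨c, hc⟩ := hw
    rw [Submodule.mem_sup]
    refine ⟨red P (fun t => α t + c), ?_, red P (fun t => - β t), ?_, ?_⟩
    · rw [AA_inv]
      intro t
      show ((α (gs⁻¹ • t) + c : ℤ) : ZMod 2) = ((α t + c : ℤ) : ZMod 2)
      rw [prW_inv_gs h α ha]
    · rw [AA_inv]
      intro t
      show ((- β (gr⁻¹ • t) : ℤ) : ZMod 2) = ((- β t : ℤ) : ZMod 2)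
      rw [prW_inv_gr h β hb]
    · funext t
      show ((α t + c : ℤ) : ZMod 2) + ((- β t : ℤ) : ZMod 2) = ((f t : ℤ) : ZMod 2)
      rw [hc t]
      have : (γ t : ZMod 2) + γ t = 0 := CharTwo.add_self_eq_zero _
      simp only [Pi.add_apply, Pi.sub_apply, Int.cast_add, Int.cast_sub, Int.cast_neg, this]
      ring
  · intro hf
    obtain ⟨a, ha, b, hb, hab⟩ := Submodule.mem_sup.1 hf
    have hg : ∀ t, ∃ c : ℤ, f t = (a t).val + (b t).val + (c + c) := by
      intro t
      have : (((f t - ((a t).val + (b t).val) : ℤ)) : ZMod 2) = 0 := by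
        rw [Int.cast_sub, Int.cast_add, val_cast, val_cast, sub_eq_zero]
        exact (congrFun hab t).symm
      obtain ⟨c, hc⟩ := (ZMod.intCast_zmod_eq_zero_iff_dvd _ 2).1 this
      exact ⟨c, by push_cast at hc; omega⟩
    choose c hc using hg
    refine ⟨(prW P).hom (fun t => ((a t).val : ℤ)), (prW P).hom (fun t => - ((b t).val : ℤ)), (prW P).hom c, ?_, ?_, ?_⟩
    · rw [W_rho]
      congr 1
      funext t
      rw [(AA_inv gs a).1 ha]
    · rw [W_rho]
      congr 1
      funext t
      rw [(AA_inv gr b).1 hb]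
    · rw [prW_sub, prW_add, prW_add, prW_eq]
      refine ⟨0, fun t => ?_⟩
      rw [hc t]
      simp only [Pi.add_apply, Pi.sub_apply]
      ring

lemma ker_theta [Finite P] (h : PHyp P pt) (m r : ℕ)
    (hr : r + Module.finrank (ZMod 2) (AA P gs) + Module.finrank (ZMod 2) (AA P gr) = Nat.card P + 1) :
    Nonempty ((theta pt m).ker ≃+ (Fin r → ZMod 2)) := by
  let Q := (P → ZMod 2) ⧸ (AA P gs ⊔ AA P gr)
  have hQ : Module.finrank (ZMod 2) Q = Module.finrank (ZMod 2) (Fin r → ZMod 2) := by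
    have := quot_rank h
    rw [Module.finrank_fin_fun]
    show Module.finrank (ZMod 2) ((P → ZMod 2) ⧸ (AA P gs ⊔ AA P gr)) = r
    omega
  obtain ⟨e⟩ := FiniteDimensional.nonempty_linearEquiv_of_finrank_eq hQ
  let ψ : (P → ℤ) →+ Q := ((AA P gs ⊔ AA P gr).mkQ.toAddMonoidHom).comp (red P)
  have hψ : Function.Surjective ψ := by
    intro y
    obtain ⟨f, rfl⟩ := Submodule.mkQ_surjective _ y
    refine ⟨fun t => ((f t).val : ℤ), ?_⟩
    show (AA P gs ⊔ AA P gr).mkQ (red P _) = _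
    congr 1
    funext t
    exact val_cast (f t)
  have hk : (Lam h m).ker = ψ.ker := by
    ext f
    rw [AddMonoidHom.mem_ker, AddMonoidHom.mem_ker, Lam_zero]
    exact (Submodule.Quotient.mk_eq_zero _).symm
  have hrange : (Lam h m).range = (theta pt m).ker := by
    ext x
    rw [AddMonoidHom.mem_ker, theta_zero h]
    constructor
    · rintro ⟨f, rfl⟩
      exact ⟨_, rfl⟩
    · rintro ⟨w, rfl⟩
      obtain ⟨f, rfl⟩ := prW_surj w
      exact ⟨f, rfl⟩
  have e1 := QuotientAddGroup.quotientKerEquivRange (Lam h m)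
  have e2 := QuotientAddGroup.quotientKerEquivOfSurjective ψ hψ
  have e3 := QuotientAddGroup.quotientAddEquivOfEq hk
  rw [hrange] at e1
  exact ⟨(e1.symm.trans e3).trans (e2.trans e.toAddEquiv)⟩

end cnt
end EC

open CategoryTheory
namespace EC

lemma combine {G : Type*} [AddCommGroup G] {s N : ℕ} (c : (Fin s → ZMod 2) →+ G)
    (hc : Function.Injective c) (t : G) (hN : ∀ n : ℤ, n • t = 0 ↔ (N : ℤ) ∣ n)
    (hdis : ∀ (n : ℤ) y, c y = n • t → n • t = 0) (hgen : ∀ x, ∃ y, ∃ n : ℤ, x = c y + n • t) :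
    Nonempty (G ≃+ (Fin s → ZMod 2) × ZMod N) := by
  let l : ZMod N →+ G := ZMod.lift N ⟨zmultiplesHom G t, by
    rw [zmultiplesHom_apply]
    exact (hN N).2 dvd_rfl⟩
  have hl : ∀ n : ℤ, l (n : ZMod N) = n • t := fun n => by
    show ZMod.lift N _ (n : ZMod N) = _
    rw [ZMod.lift_coe]
    rfl
  let F : (Fin s → ZMod 2) × ZMod N →+ G := c.coprod l
  have hF : ∀ y (n : ℤ), F (y, (n : ZMod N)) = c y + n • t := fun y n => by
    rw [← hl]
    exact AddMonoidHom.coprod_apply _ _ _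
  refine ⟨(AddEquiv.ofBijective F ⟨?_, ?_⟩).symm⟩
  · rw [injective_iff_map_eq_zero]
    rintro ⟨y, z⟩ h
    obtain ⟨n, rfl⟩ := ZMod.intCast_surjective z
    rw [hF] at h
    have h1 : c y = (-n) • t := by rw [neg_smul]; exact eq_neg_of_add_eq_zero_left h
    have h2 := hdis _ _ h1
    rw [h2, ← map_zero c] at h1
    have h3 : y = 0 := hc h1
    have h4 : (n : ZMod N) = 0 := (ZMod.intCast_zmod_eq_zero_iff_dvd _ _).2 ((hN n).1 (by
      rw [neg_smul, neg_eq_zero] at h2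
      exact h2))
    rw [h3, h4]
    rfl
  · intro x
    obtain ⟨y, n, rfl⟩ := hgen x
    exact ⟨_, hF y n⟩

section cls
variable {G B : Type*} [AddCommGroup G] [AddCommGroup B] (θ : G →+ B) {r : ℕ}

lemma ker_two (e : θ.ker ≃+ (Fin r → ZMod 2)) (x : G) (hx : θ x = 0) : x + x = 0 := by
  let y : θ.ker := ⟨x, hx⟩
  have h : y + y = 0 := e.injective (by
    rw [map_add, map_zero]
    funext i
    exact CharTwo.add_self_eq_zero _)
  exact congrArg Subtype.val h

lemma cls_odd (e : θ.ker ≃+ (Fin r → ZMod 2)) (q : G) (hq : ∀ x, ∃ n : ℤ, θ x = n • θ q)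
    (N : ℕ) (hN1 : N = 1 ∨ N = 3) (hN : ∀ n : ℤ, n • θ q = 0 ↔ (N : ℤ) ∣ n) :
    Nonempty (G ≃+ (Fin r → ZMod 2) × ZMod N) := by
  have hz : ∀ n : ℤ, (N : ℤ) ∣ n → (n * 4) • q = 0 := by
    intro n hn
    have h1 : θ (n • q) = 0 := by rw [map_zsmul]; exact (hN n).2 hn
    have h2 := ker_two θ e _ h1
    have : (n * 4) • q = (n • q + n • q) + (n • q + n • q) := by
      rw [← add_smul, ← add_smul]
      congr 1
      ring
    rw [this, h2, add_zero]
  have hz' : ∀ n : ℤ, n • (4 : ℤ) • q = 0 ↔ (N : ℤ) ∣ n := by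
    intro n
    rw [smul_smul]
    constructor
    · intro h
      have h2 : (n * 4) • θ q = 0 := by rw [← map_zsmul, h, map_zero]
      have := (hN _).1 h2
      rcases hN1 with rfl | rfl
      · simp
      · push_cast at this ⊢
        omega
    · exact hz n
  refine combine (θ.ker.subtype.comp e.symm.toAddMonoidHom)
    (Subtype.val_injective.comp e.symm.injective) ((4 : ℤ) • q) hz' ?_ ?_
  · intro n y h
    have h1 : θ (n • (4 : ℤ) • q) = 0 := by
      rw [← h]
      exact (e.symm y).2
    rw [hz']
    rw [smul_smul, map_zsmul, hN] at h1
    rcases hN1 with rfl | rfl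
    · simp
    · push_cast at h1 ⊢
      omega
  · intro x
    obtain ⟨n, hn⟩ := hq x
    have h1 : θ (x - n • (4 : ℤ) • q) = 0 := by
      rw [map_sub, hn, smul_smul, map_zsmul, ← sub_smul, hN]
      rcases hN1 with rfl | rfl
      · simp
      · push_cast
        omega
    refine ⟨e ⟨_, h1⟩, n, ?_⟩
    show x = (e.symm (e ⟨_, h1⟩)).1 + _
    rw [e.symm_apply_apply, sub_add_cancel]

lemma cls_even (e : θ.ker ≃+ (Fin r → ZMod 2)) (q : G) (hq : ∀ x, ∃ n : ℤ, θ x = n • θ q)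
    (ht : ∀ x, x + x = 0 → θ x = 0)
    (N M : ℕ) (hN0 : N = 2 * M) (hM : M ≠ 0) (hN : ∀ n : ℤ, n • θ q = 0 ↔ (N : ℤ) ∣ n) :
    Nonempty (G ≃+ (Fin (r-1) → ZMod 2) × ZMod (2 * N)) := by
  have hw : θ ((N : ℤ) • q) = 0 := by rw [map_zsmul]; exact (hN N).2 dvd_rfl
  let w : θ.ker := ⟨(N : ℤ) • q, hw⟩
  let v := e w
  have hv : v ≠ 0 := by
    intro h
    have h0 : w = 0 := e.injective (h.trans (map_zero e).symm)
    have h1 : (N : ℤ) • q = 0 := congrArg Subtype.val h0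
    have h2 : θ ((M : ℤ) • q) = 0 := ht _ (by
      rw [← add_smul, ← h1, hN0]
      congr 1
      push_cast
      ring)
    rw [map_zsmul, hN, hN0] at h2
    push_cast at h2
    obtain ⟨k, hk⟩ := h2
    have hM' : (M : ℤ) ≠ 0 := by exact_mod_cast hM
    have : (M : ℤ) * (1 - 2 * k) = 0 := by linear_combination hk
    rcases mul_eq_zero.1 this with h | h <;> omega
  obtain ⟨D, hD⟩ := Submodule.exists_isCompl (Submodule.span (ZMod 2) {v})
  have hr : Module.finrank (ZMod 2) D = Module.finrank (ZMod 2) (Fin (r-1) → ZMod 2) := by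
    have h1 := Submodule.finrank_add_eq_of_isCompl hD
    rw [finrank_span_singleton hv, Module.finrank_fin_fun] at h1
    rw [Module.finrank_fin_fun]
    omega
  obtain ⟨d⟩ := FiniteDimensional.nonempty_linearEquiv_of_finrank_eq hr
  have hkv : ∀ k : ℤ, e (k • w) = (k : ZMod 2) • v := fun k => by
    rw [map_zsmul, Int.cast_smul_eq_zsmul]
  have hkq : ∀ k : ℤ, ((k • w : θ.ker) : G) = (k * N) • q := fun k => by
    rw [mul_smul]
    rfl
  have hzero : ∀ k : ℤ, (k : ZMod 2) • v = 0 ↔ (2 : ℤ) ∣ k := fun k => by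
    rw [smul_eq_zero, or_iff_left hv]
    exact ZMod.intCast_zmod_eq_zero_iff_dvd k 2
  have hkz : ∀ k : ℤ, (k * N) • q = 0 ↔ (2 : ℤ) ∣ k := fun k => by
    rw [← hzero, ← hkv, ← hkq, map_eq_zero_iff e e.injective]
    exact (Subtype.ext_iff (a1 := k • w) (a2 := 0)).symm
  have hNpos : (N : ℤ) ≠ 0 := by
    rw [hN0]
    push_cast
    have hM' : (M : ℤ) ≠ 0 := by exact_mod_cast hM
    omega
  let c : (Fin (r-1) → ZMod 2) →+ G := (θ.ker.subtype.comp e.symm.toAddMonoidHom).comp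
    (D.subtype.toAddMonoidHom.comp d.symm.toLinearMap.toAddMonoidHom)
  have hcdef : ∀ y, c y = (e.symm (d.symm y).1).1 := fun _ => rfl
  refine combine c ?_ q ?_ ?_ ?_
  · intro a b hab
    rw [hcdef, hcdef] at hab
    exact d.symm.injective (Subtype.ext (e.symm.injective (Subtype.ext hab)))
  · intro n
    constructor
    · intro h
      have h1 : n • θ q = 0 := by rw [← map_zsmul, h, map_zero]
      obtain ⟨k, rfl⟩ := (hN n).1 h1
      rw [mul_comm, hkz] at h
      push_cast
      rw [mul_comm]
      exact mul_dvd_mul_left _ h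
    · rintro ⟨k, rfl⟩
      have := (hkz (2 * k)).2 (dvd_mul_right _ _)
      rw [← this]
      congr 1
      push_cast
      ring
  · intro n y h
    have h1 : n • θ q = 0 := by
      rw [← map_zsmul, ← h]
      exact (e.symm _).2
    obtain ⟨k, rfl⟩ := (hN n).1 h1
    rw [mul_comm] at h ⊢
    rw [← hkq, hcdef] at h
    have h2 : e.symm (d.symm y).1 = k • w := Subtype.ext h
    rw [e.symm_apply_eq, hkv] at h2
    have h3 : (k : ZMod 2) • v ∈ Submodule.span (ZMod 2) {v} ⊓ D :=
      ⟨Submodule.smul_mem _ _ (Submodule.mem_span_singleton_self v), by rw [← h2]; exact (d.symm y).2⟩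
    rw [hD.inf_eq_bot, Submodule.mem_bot, hzero] at h3
    exact (hkz k).2 h3
  · intro x
    obtain ⟨n, hn⟩ := hq x
    have h1 : θ (x - n • q) = 0 := by rw [map_sub, hn, map_zsmul, sub_self]
    have h2 : e ⟨_, h1⟩ ∈ Submodule.span (ZMod 2) {v} ⊔ D := by
      rw [hD.sup_eq_top]
      trivial
    obtain ⟨a, ha, b, hb, hab⟩ := Submodule.mem_sup.1 h2
    obtain ⟨k, rfl⟩ := Submodule.mem_span_singleton.1 ha
    obtain ⟨k, rfl⟩ := ZMod.intCast_surjective k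
    refine ⟨d ⟨b, hb⟩, n + k * N, ?_⟩
    rw [hcdef, d.symm_apply_apply]
    have h3 : e.symm b = ⟨_, h1⟩ - k • w := by
      rw [e.symm_apply_eq, map_sub, hkv, ← hab]
      abel
    show x = (e.symm b).1 + _
    rw [h3, add_smul, AddSubgroup.coe_sub, hkq]
    have : ∀ a b c : G, a = (a - b - c) + (b + c) := fun a b c => by abel
    exact this _ _ _

end cls

section cond
variable {P : Type} [MulAction Gam P] {pt : P}

lemma gs_inv2 (h : PHyp P pt) (t : P) : gs⁻¹ • gs⁻¹ • t = t := by
  rw [← mul_smul, ← mul_inv_rev, ← pow_two, gs2, inv_neg, inv_one, h.neg]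

lemma gr_inv3 (h : PHyp P pt) (t : P) : gr⁻¹ • gr⁻¹ • gr⁻¹ • t = t := by
  rw [← mul_smul, ← mul_smul, ← mul_inv_rev, ← mul_inv_rev, ← pow_two, ← pow_succ', gr3, inv_neg, inv_one, h.neg]

lemma pow_inv_succ (g : Gam) (n : ℕ) (t : P) : (g ^ (n+1))⁻¹ • t = g⁻¹ • (g ^ n)⁻¹ • t := by
  rw [← mul_smul, pow_succ, mul_inv_rev]

lemma sum4 (h : PHyp P pt) (F : P → ℤ) (t : P) :
    ∑ j ∈ Finset.range 4, F ((gs ^ j)⁻¹ • t) = 2 * (F t + F (gs⁻¹ • t)) := by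
  simp only [Finset.sum_range_succ, Finset.sum_range_zero, pow_inv_succ, pow_zero, inv_one, one_smul, gs_inv2 h]
  ring

lemma sum6 (h : PHyp P pt) (F : P → ℤ) (t : P) :
    ∑ j ∈ Finset.range 6, F ((gr ^ j)⁻¹ • t) = 2 * (F t + F (gr⁻¹ • t) + F (gr⁻¹ • gr⁻¹ • t)) := by
  simp only [Finset.sum_range_succ, Finset.sum_range_zero, pow_inv_succ, pow_zero, inv_one, one_smul, gr_inv3 h]
  ring

lemma condS_fix (h : PHyp P pt) (hf : ∃ t : P, gs • t = t) (v : ℤ) :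
    (∃ F : P → ℤ, ∀ t, v = ∑ j ∈ Finset.range 4, F ((gs ^ j)⁻¹ • t)) ↔ (4 : ℤ) ∣ v := by
  constructor
  · rintro ⟨F, hF⟩
    obtain ⟨t, ht⟩ := hf
    have := hF t
    rw [sum4 h, inv_smul_eq_iff.2 ht.symm] at this
    exact ⟨F t, by rw [this]; ring⟩
  · rintro ⟨k, rfl⟩
    refine ⟨fun _ => k, fun t => ?_⟩
    refine Eq.trans ?_ (sum4 h (fun _ => k) t).symm
    ring

lemma condR_fix (h : PHyp P pt) (hf : ∃ t : P, gr • t = t) (v : ℤ) :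
    (∃ F : P → ℤ, ∀ t, v = ∑ j ∈ Finset.range 6, F ((gr ^ j)⁻¹ • t)) ↔ (6 : ℤ) ∣ v := by
  constructor
  · rintro ⟨F, hF⟩
    obtain ⟨t, ht⟩ := hf
    have := hF t
    rw [sum6 h, inv_smul_eq_iff.2 ht.symm, inv_smul_eq_iff.2 ht.symm] at this
    exact ⟨F t, by rw [this]; ring⟩
  · rintro ⟨k, rfl⟩
    refine ⟨fun _ => k, fun t => ?_⟩
    refine Eq.trans ?_ (sum6 h (fun _ => k) t).symm
    ring

lemma condS_free [Countable P] (h : PHyp P pt) (hf : ¬ ∃ t : P, gs • t = t) (v : ℤ) :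
    (∃ F : P → ℤ, ∀ t, v = ∑ j ∈ Finset.range 4, F ((gs ^ j)⁻¹ • t)) ↔ (2 : ℤ) ∣ v := by
  constructor
  · rintro ⟨F, hF⟩
    have := hF pt
    rw [sum4 h] at this
    exact ⟨_, this⟩
  · rintro ⟨k, rfl⟩
    obtain ⟨e, he⟩ := exists_injective_nat P
    refine ⟨fun t => if e t < e (gs⁻¹ • t) then k else 0, fun t => ?_⟩
    refine Eq.trans ?_ (sum4 h (fun t => if e t < e (gs⁻¹ • t) then k else 0) t).symm
    simp only [gs_inv2 h]
    have hne : e t ≠ e (gs⁻¹ • t) := fun hh => hf ⟨t, (inv_smul_eq_iff.1 (he hh).symm).symm⟩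
    rcases lt_or_gt_of_ne hne with h1 | h1
    · rw [if_pos h1, if_neg (by omega), add_zero]
    · rw [if_neg (by omega), if_pos h1, zero_add]

lemma condR_free [Countable P] (h : PHyp P pt) (hf : ¬ ∃ t : P, gr • t = t) (v : ℤ) :
    (∃ F : P → ℤ, ∀ t, v = ∑ j ∈ Finset.range 6, F ((gr ^ j)⁻¹ • t)) ↔ (2 : ℤ) ∣ v := by
  constructor
  · rintro ⟨F, hF⟩
    have := hF pt
    rw [sum6 h] at this
    exact ⟨_, this⟩
  · rintro ⟨k, rfl⟩
    obtain ⟨e, he⟩ := exists_injective_nat P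
    refine ⟨fun t => if e t < e (gr⁻¹ • t) ∧ e t < e (gr⁻¹ • gr⁻¹ • t) then k else 0, fun t => ?_⟩
    refine Eq.trans ?_ (sum6 h (fun t => if e t < e (gr⁻¹ • t) ∧ e t < e (gr⁻¹ • gr⁻¹ • t) then k else 0) t).symm
    simp only [gr_inv3 h]
    have hne : ∀ t, e t ≠ e (gr⁻¹ • t) := fun t hh => hf ⟨t, (inv_smul_eq_iff.1 (he hh).symm).symm⟩
    have h1 := hne t
    have h2 := hne (gr⁻¹ • t)
    have h3 := hne (gr⁻¹ • gr⁻¹ • t)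
    rw [gr_inv3 h] at h3
    congr 1
    split_ifs <;> omega

lemma theta_gen (h : PHyp P pt) (m : ℕ) (s r : ℤ) (hs : s = 2 ∨ s = 4) (hr : r = 2 ∨ r = 6)
    (cS : ∀ v : ℤ, (∃ F : P → ℤ, ∀ t, v = ∑ j ∈ Finset.range 4, F ((gs ^ j)⁻¹ • t)) ↔ s ∣ v)
    (cR : ∀ v : ℤ, (∃ F : P → ℤ, ∀ t, v = ∑ j ∈ Finset.range 6, F ((gr ^ j)⁻¹ • t)) ↔ r ∣ v) :
    ∃ q, (∀ x, ∃ n : ℤ, theta pt m x = n • theta pt m q) ∧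
      ∀ n : ℤ, n • theta pt m q = 0 ↔ (4 : ℤ) ∣ n * s ∧ (6 : ℤ) ∣ n * r := by
  obtain ⟨f0, h1, h2⟩ := exV ZZ s r rfl rfl
  change vS f0 = s at h1
  change vR f0 = r at h2
  obtain ⟨q, hq⟩ := (theta_range h m f0).2 ⟨(cS _).2 (by rw [h1]), (cR _).2 (by rw [h2])⟩
  have hn : ∀ n : ℤ, n • theta pt m q = u chi (Fn VV ZZ) (m+1+1) (n • f0) := fun n => by
    rw [hq, map_zsmul]
  have hvS : ∀ n : ℤ, vS (n • f0) = n * s := fun n => by rw [← h1]; rfl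
  have hvR : ∀ n : ℤ, vR (n • f0) = n * r := fun n => by rw [← h2]; rfl
  refine ⟨q, fun x => ?_, fun n => ?_⟩
  · obtain ⟨f, hf⟩ := uV_surj ZZ (m+1) (theta pt m x)
    obtain ⟨c1, c2⟩ := (theta_range h m f).1 ⟨x, hf.symm⟩
    obtain ⟨a, ha⟩ := (cS _).1 c1
    obtain ⟨b, hb⟩ := (cR _).1 c2
    refine ⟨3 * a - 2 * b, ?_⟩
    rw [hn, ← hf, ← sub_eq_zero, ← map_sub, uVZ_zero, vS_sub, vR_sub, hvS, hvR, ha, hb]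
    constructor
    · rcases hs with rfl | rfl
      · exact ⟨b - a, by ring⟩
      · exact ⟨-2 * a + 2 * b, by ring⟩
    · rcases hr with rfl | rfl
      · exact ⟨b - a, by ring⟩
      · exact ⟨3 * (b - a), by ring⟩
  · rw [hn, uVZ_zero, hvS, hvR]

end cond
end EC

open CategoryTheory
namespace EC

/-- the projective line over the field with `p` elements -/
def PP (p : ℕ) : Type := OnePoint (ZMod p)

section act
variable (p : ℕ) [Fact p.Prime]

/-- reduction mod `p` -/
noncomputable def redp : Gam →* Matrix.GeneralLinearGroup (Fin 2) (ZMod p) :=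
  (Matrix.SpecialLinearGroup.toGL).comp (Matrix.SpecialLinearGroup.map (Int.castRingHom (ZMod p)))

lemma redp_apply (g : Gam) (i j : Fin 2) : redp p g i j = ((g i j : ℤ) : ZMod p) := rfl

/-- action on the projective line -/
noncomputable instance actPP : MulAction Gam (PP p) :=
  letI : MulAction (Matrix.GeneralLinearGroup (Fin 2) (ZMod p)) (PP p) := OnePoint.instGLAction
  MulAction.compHom (PP p) (redp p)

variable {p}

/-- the point at infinity -/
def ptI : PP p := (OnePoint.infty : OnePoint (ZMod p))
/-- finite points -/
def ptF (k : ZMod p) : PP p := ((k : OnePoint (ZMod p)))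

set_option linter.unusedSectionVars false

lemma ptF_ne (k : ZMod p) : ptF k ≠ ptI := OnePoint.coe_ne_infty k
lemma ptF_inj {k l : ZMod p} (h : ptF k = ptF l) : k = l := OnePoint.coe_injective h
lemma PP_cases (t : PP p) : t = ptI ∨ ∃ k, t = ptF k := by
  rcases Option.eq_none_or_eq_some t with h | ⟨k, h⟩
  · exact Or.inl h
  · exact Or.inr ⟨k, h⟩

lemma act_I (g : Gam) : g • (ptI : PP p) =
    if ((g 1 0 : ℤ) : ZMod p) = 0 then ptI else ptF (((g 0 0 : ℤ) : ZMod p) / ((g 1 0 : ℤ) : ZMod p)) :=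
  OnePoint.smul_infty_eq_ite (redp p g)

lemma act_F (g : Gam) (k : ZMod p) : g • ptF k =
    if ((g 1 0 : ℤ) : ZMod p) * k + ((g 1 1 : ℤ) : ZMod p) = 0 then ptI else
      ptF ((((g 0 0 : ℤ) : ZMod p) * k + ((g 0 1 : ℤ) : ZMod p)) / (((g 1 0 : ℤ) : ZMod p) * k + ((g 1 1 : ℤ) : ZMod p))) :=
  OnePoint.smul_some_eq_ite (g := redp p g) (k := k)

instance finPP : Finite (PP p) := inferInstanceAs (Finite (Option (ZMod p)))

lemma cardPP : Nat.card (PP p) = p + 1 := by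
  have : Nat.card (Option (ZMod p)) = p + 1 := by
    rw [Nat.card_eq_fintype_card, Fintype.card_option, ZMod.card]
  exact this

lemma PP_st (g : Gam) : g • (ptI : PP p) = ptI ↔ (p : ℤ) ∣ g 1 0 := by
  rw [act_I, ← ZMod.intCast_zmod_eq_zero_iff_dvd]
  split_ifs with h
  · simp [h]
  · simp [h, ptF_ne]

lemma PP_hyp : PHyp (PP p) ptI where
  neg := by
    intro t
    have e10 : (-1 : Gam) 1 0 = 0 := by decide
    have e00 : (-1 : Gam) 0 0 = -1 := by decide
    have e01 : (-1 : Gam) 0 1 = 0 := by decide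
    have e11 : (-1 : Gam) 1 1 = -1 := by decide
    rcases PP_cases t with rfl | ⟨k, rfl⟩
    · rw [PP_st, e10]
      exact dvd_zero _
    · rw [act_F, e10, e00, e01, e11]
      simp
  cusp := by
    rw [PP_st]
    have : (gs * gr) 1 0 = 0 := by decide
    rw [this]
    exact dvd_zero _
  tr := by
    intro t
    rcases PP_cases t with rfl | ⟨k, rfl⟩
    · exact ⟨1, one_smul _ _⟩
    · obtain ⟨n, rfl⟩ := ZMod.intCast_surjective k
      let g : Gam := ⟨!![n, -1; 1, 0], by simp [Matrix.det_fin_two]⟩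
      have e10 : g 1 0 = 1 := rfl
      have e00 : g 0 0 = n := rfl
      refine ⟨g, ?_⟩
      rw [act_I, e10, e00]
      simp

lemma fix_gs (t : PP p) : gs • t = t ↔ ∃ k, t = ptF k ∧ k * k = -1 := by
  have e10 : gs 1 0 = 1 := by decide
  have e00 : gs 0 0 = 0 := by decide
  have e01 : gs 0 1 = -1 := by decide
  have e11 : gs 1 1 = 0 := by decide
  rcases PP_cases t with rfl | ⟨k, rfl⟩
  · constructor
    · intro h
      rw [act_I, e10, e00] at h
      simp [ptF_ne] at h
    · rintro ⟨k, hk, -⟩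
      exact absurd hk.symm (ptF_ne k)
  · rw [act_F, e10, e00, e01, e11]
    have h1 : (∃ l, ptF k = ptF l ∧ l * l = -1) ↔ k * k = -1 :=
      ⟨fun ⟨l, hl, h⟩ => by rw [ptF_inj hl]; exact h, fun h => ⟨k, rfl, h⟩⟩
    rw [h1]
    simp only [Int.cast_one, Int.cast_zero, Int.cast_neg, one_mul, zero_mul, add_zero, zero_add]
    split_ifs with hk
    · simp [hk, (ptF_ne _).symm]
    · constructor
      · intro h
        have := ptF_inj h
        rw [div_eq_iff hk] at this
        exact this.symm
      · intro h
        rw [← h, mul_div_cancel_right₀ _ hk]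

lemma fix_gr (t : PP p) : gr • t = t ↔ ∃ k, t = ptF k ∧ k * k - k + 1 = 0 := by
  have e10 : gr 1 0 = -1 := by decide
  have e00 : gr 0 0 = 0 := by decide
  have e01 : gr 0 1 = 1 := by decide
  have e11 : gr 1 1 = 1 := by decide
  rcases PP_cases t with rfl | ⟨k, rfl⟩
  · constructor
    · intro h
      rw [act_I, e10, e00] at h
      simp [ptF_ne] at h
    · rintro ⟨k, hk, -⟩
      exact absurd hk.symm (ptF_ne k)
  · rw [act_F, e10, e00, e01, e11]
    have h1 : (∃ l, ptF k = ptF l ∧ l * l - l + 1 = 0) ↔ k * k - k + 1 = 0 :=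
      ⟨fun ⟨l, hl, h⟩ => by rw [ptF_inj hl]; exact h, fun h => ⟨k, rfl, h⟩⟩
    rw [h1]
    simp only [Int.cast_one, Int.cast_zero, Int.cast_neg, neg_mul, one_mul, zero_mul, zero_add]
    split_ifs with hk
    · have : k = 1 := by linear_combination -hk
      subst this
      simp [(ptF_ne _).symm]
    · constructor
      · intro h
        have := ptF_inj h
        rw [div_eq_iff hk] at this
        linear_combination this
      · intro h
        congr 1
        rw [div_eq_iff hk]
        linear_combination h

lemma fix_le (g : Gam) (b c : ZMod p) (h : ∀ t : PP p, g • t = t → ∃ k, t = ptF k ∧ k * k + b * k + c = 0) :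
    Nat.card {t : PP p // g • t = t} ≤ 2 := by
  by_cases h0 : ∃ t : PP p, g • t = t
  · obtain ⟨t, ht⟩ := h0
    obtain ⟨k, rfl, hk⟩ := h t ht
    have hsub : {t : PP p | g • t = t} ⊆ {ptF k, ptF (-b - k)} := by
      intro t ht
      obtain ⟨l, rfl, hl⟩ := h t ht
      have : (l - k) * (l - (-b - k)) = 0 := by linear_combination hl - hk
      rcases mul_eq_zero.1 this with h | h
      · left
        rw [sub_eq_zero.1 h]
      · right
        rw [sub_eq_zero.1 h]
        rfl
    exact (Set.ncard_le_ncard hsub (Set.toFinite _)).trans ((Set.ncard_insert_le _ _).trans (by rw [Set.ncard_singleton]))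
  · have : IsEmpty {t : PP p // g • t = t} := ⟨fun t => h0 ⟨t.1, t.2⟩⟩
    rw [Nat.card_of_isEmpty]
    norm_num

lemma card_ne {g : Gam} : (∃ t : PP p, g • t = t) ↔ Nat.card {t : PP p // g • t = t} ≠ 0 := by
  rw [Nat.card_ne_zero]
  constructor
  · rintro ⟨t, ht⟩
    exact ⟨⟨⟨t, ht⟩⟩, inferInstance⟩
  · rintro ⟨⟨t⟩, -⟩
    exact ⟨t.1, t.2⟩

lemma ex_gs : (∃ t : PP p, gs • t = t) ↔ p % 4 ≠ 3 := by
  rw [← ZMod.exists_sq_eq_neg_one_iff]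
  constructor
  · rintro ⟨t, ht⟩
    obtain ⟨k, -, hk⟩ := (fix_gs t).1 ht
    exact ⟨k, hk.symm⟩
  · rintro ⟨k, hk⟩
    exact ⟨ptF k, (fix_gs _).2 ⟨k, rfl, hk.symm⟩⟩

lemma le_gs : Nat.card {t : PP p // gs • t = t} ≤ 2 :=
  fix_le gs 0 1 fun t ht => by
    obtain ⟨k, h1, h2⟩ := (fix_gs t).1 ht
    exact ⟨k, h1, by linear_combination h2⟩

lemma le_gr : Nat.card {t : PP p // gr • t = t} ≤ 2 :=
  fix_le gr (-1) 1 fun t ht => by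
    obtain ⟨k, h1, h2⟩ := (fix_gr t).1 ht
    exact ⟨k, h1, by linear_combination h2⟩

/-- the structure of the odd cohomology of the representation -/
lemma H_main (hp3 : 3 < p) (m : ℕ) :
    (p % 12 = 1 → Nonempty (groupCohomology (WW (PP p)) (2*(m+1)+1) ≃+ (Fin ((p - 7) / 6) → ZMod 2) × ZMod 1)) ∧
    (p % 12 = 5 → Nonempty (groupCohomology (WW (PP p)) (2*(m+1)+1) ≃+ (Fin ((p + 1) / 6) → ZMod 2) × ZMod 3)) ∧
    (p % 12 = 7 → Nonempty (groupCohomology (WW (PP p)) (2*(m+1)+1) ≃+ (Fin ((p - 7) / 6) → ZMod 2) × ZMod 4)) ∧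
    (p % 12 = 11 → Nonempty (groupCohomology (WW (PP p)) (2*(m+1)+1) ≃+ (Fin ((p + 1) / 6) → ZMod 2) × ZMod 12)) := by
  have H := PP_hyp (p := p)
  have c1 := cnt_gs H
  have c2 := cnt_gr H
  have l1 := le_gs (p := p)
  have l2 := le_gr (p := p)
  have x1 := ex_gs (p := p)
  have n1 := card_ne (p := p) (g := gs)
  have n2 := card_ne (p := p) (g := gr)
  have tt := theta_tors H m
  have kk := ker_theta H m
  rw [cardPP] at c1 c2 kk
  refine ⟨fun h => ?_, fun h => ?_, fun h => ?_, fun h => ?_⟩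
  · have f1 := x1.2 (by omega)
    have f2 := n2.2 (by omega)
    have f1' := n1.1 f1
    obtain ⟨e⟩ := kk ((p-7)/6) (by omega)
    obtain ⟨q, hq, hn⟩ := theta_gen H m 4 6 (by norm_num) (by norm_num) (condS_fix H f1) (condR_fix H f2)
    exact cls_odd (theta ptI m) e q hq 1 (by norm_num) (fun n => by rw [hn]; push_cast; omega)
  · have f1 := x1.2 (by omega)
    have f2 := mt n2.1 (by omega)
    have f1' := n1.1 f1
    obtain ⟨e⟩ := kk ((p+1)/6) (by omega)
    obtain ⟨q, hq, hn⟩ := theta_gen H m 4 2 (by norm_num) (by norm_num) (condS_fix H f1) (condR_free H f2)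
    exact cls_odd (theta ptI m) e q hq 3 (by norm_num) (fun n => by rw [hn]; push_cast; omega)
  · have f1 := mt x1.1 (by omega)
    have f2 := n2.2 (by omega)
    have f1' := mt n1.2 f1
    obtain ⟨e⟩ := kk ((p-7)/6+1) (by omega)
    obtain ⟨q, hq, hn⟩ := theta_gen H m 2 6 (by norm_num) (by norm_num) (condS_free H f1) (condR_fix H f2)
    exact cls_even (theta ptI m) e q hq tt 2 1 (by norm_num) (by norm_num) (fun n => by rw [hn]; push_cast; omega)
  · have f1 := mt x1.1 (by omega)
    have f2 := mt n2.1 (by omega)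
    have f1' := mt n1.2 f1
    obtain ⟨e⟩ := kk ((p+1)/6+1) (by omega)
    obtain ⟨q, hq, hn⟩ := theta_gen H m 2 2 (by norm_num) (by norm_num) (condS_free H f1) (condR_free H f2)
    exact cls_even (theta ptI m) e q hq tt 6 3 (by norm_num) (by norm_num) (fun n => by rw [hn]; push_cast; omega)

end act

section ring
variable (p : ℕ)

lemma R_hyp (hp : p.Prime) : RHyp (Localization.Away (p : ℤ)) p (IsLocalization.Away.invSelf (p : ℤ)) where
  pp := hp
  inj := by
    intro a b h
    have hi : Function.Injective (algebraMap ℤ (Localization.Away (p : ℤ))) :=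
      IsLocalization.injective _ (powers_le_nonZeroDivisors_of_noZeroDivisors (x := (p : ℤ)) (by exact_mod_cast hp.ne_zero))
    apply hi
    simpa using h
  inv := by
    have := IsLocalization.Away.mul_invSelf (S := Localization.Away (p : ℤ)) (p : ℤ)
    simpa using this
  den := by
    intro r
    obtain ⟨n, a, h⟩ := IsLocalization.Away.surj (p : ℤ) r
    refine ⟨n, a, ?_⟩
    rw [mul_comm]
    simpa using h

/-- reduction mod twelve -/
lemma phi_ex (hp : p.Prime) (hp3 : 3 < p) : Nonempty (Localization.Away (p : ℤ) →+* ZMod 12) := by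
  have hu : IsUnit (Int.castRingHom (ZMod 12) (p : ℤ)) := by
    have : Nat.Coprime p 12 := by
      rw [Nat.Prime.coprime_iff_not_dvd hp]
      intro h
      have h1 : p ≤ 12 := Nat.le_of_dvd (by norm_num) h
      interval_cases p <;> revert hp h <;> decide
    rw [eq_intCast, Int.cast_natCast]
    exact (ZMod.isUnit_iff_coprime p 12).2 this
  exact ⟨IsLocalization.Away.lift (p : ℤ) hu⟩

end ring

/-- additive equivalences are linear over the integers, whatever the module structures -/
def toLin {A B : Type*} [AddCommGroup A] [AddCommGroup B] [i : Module ℤ A] [j : Module ℤ B] (e : A ≃+ B) : A ≃ₗ[ℤ] B :=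
  { e with
    map_smul' := fun n x => by
      exact (congrArg e (int_smul_eq_zsmul i n x)).trans
        ((map_zsmul e n x).trans (int_smul_eq_zsmul j n (e x)).symm) }

end EC

theorem even_cohomology_SL2_Z_inv_p (p : ℕ) (hp : p.Prime) (hp3 : 3 < p)
    (i : ℕ) (hi : 2 ≤ i) :
    (p % 12 = 1 → Nonempty ((groupCohomology (Rep.trivial ℤ
      (Matrix.SpecialLinearGroup (Fin 2) (Localization.Away (p : ℤ))) ℤ) (2 * i)) ≃ₗ[ℤ]
        ((Fin ((p - 7) / 6) → ZMod 2) × ZMod 12))) ∧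
    (p % 12 = 5 → Nonempty ((groupCohomology (Rep.trivial ℤ
      (Matrix.SpecialLinearGroup (Fin 2) (Localization.Away (p : ℤ))) ℤ) (2 * i)) ≃ₗ[ℤ]
        ((Fin ((p + 1) / 6) → ZMod 2) × ZMod 12 × ZMod 3))) ∧
    (p % 12 = 7 → Nonempty ((groupCohomology (Rep.trivial ℤ
      (Matrix.SpecialLinearGroup (Fin 2) (Localization.Away (p : ℤ))) ℤ) (2 * i)) ≃ₗ[ℤ]
        ((Fin ((p - 7) / 6) → ZMod 2) × ZMod 12 × ZMod 4))) ∧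
    (p % 12 = 11 → Nonempty ((groupCohomology (Rep.trivial ℤ
      (Matrix.SpecialLinearGroup (Fin 2) (Localization.Away (p : ℤ))) ℤ) (2 * i)) ≃ₗ[ℤ]
        ((Fin ((p + 1) / 6) → ZMod 2) × ZMod 12 × ZMod 12))) := by
  have : Fact p.Prime := ⟨hp⟩
  obtain ⟨m, rfl⟩ : ∃ m, i = m + 1 + 1 := ⟨i - 2, by omega⟩
  obtain ⟨φ⟩ := EC.phi_ex p hp hp3
  obtain ⟨e⟩ := EC.G_split (EC.R_hyp p hp) (EC.PP_hyp (p := p)) EC.PP_st φ m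
  obtain ⟨h1, h5, h7, h11⟩ := EC.H_main (p := p) hp3 m
  have key : ∀ (r N : ℕ), Nonempty (groupCohomology (EC.WW (EC.PP p)) (2*(m+1)+1) ≃+ (Fin r → ZMod 2) × ZMod N) →
      Nonempty (groupCohomology (EC.ZG (Localization.Away (p : ℤ))) (2*(m+1+1)) ≃+
        (Fin r → ZMod 2) × ZMod 12 × ZMod N) := by
    rintro r N ⟨f⟩
    exact ⟨(e.trans ((AddEquiv.refl _).prodCongr f)).trans
      (AddEquiv.prodAssoc.symm.trans ((AddEquiv.prodComm.prodCongr (AddEquiv.refl _)).trans AddEquiv.prodAssoc))⟩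
  refine ⟨fun h => ?_, fun h => ?_, fun h => ?_, fun h => ?_⟩
  · obtain ⟨f⟩ := key _ _ (h1 h)
    exact ⟨EC.toLin (f.trans ((AddEquiv.refl _).prodCongr (AddEquiv.prodUnique (N := ZMod 1))))⟩
  · obtain ⟨f⟩ := key _ _ (h5 h)
    exact ⟨EC.toLin f⟩
  · obtain ⟨f⟩ := key _ _ (h7 h)
    exact ⟨EC.toLin f⟩
  · obtain ⟨f⟩ := key _ _ (h11 h)
    exact ⟨EC.toLin f⟩
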